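/- Let γ > 1 and φ, ψ ∈ C¹_b(ℝ). Suppose that either 0 ≤ μ < 1 and λ > 0, or μ = 1 and λ > 2. Then there exists ε₀ > 0 such that for every 0 < ε ≤ ε₀, the Cauchy problem u_t − v_x = 0, v_t + p(u)_x = −(λ/(1+t)^μ) v with initial data (u(0,x), v(0,x)) = (1 + εφ(x), εψ(x)) has a unique global C¹_b solution (u,v) on [0,∞)×ℝ with u everywhere positive, and there is a constant C > 0 such that the Riemann invariants satisfy the decay estimate ‖(r_t(t), s_t(t))‖_{L^∞} + ‖(r_x(t), s_x(t))‖_{L^∞} ≤ C ε (1+t)^{−μ} for all t ≥ 0. -/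

import Mathlib

noncomputable section
open Real Set

/-- Partial derivative with respect to time of a function of `(t, x)`. -/
def pdt (f : ℝ → ℝ → ℝ) (t x : ℝ) : ℝ := deriv (fun τ => f τ x) t

/-- Partial derivative with respect to space of a function of `(t, x)`. -/
def pdx (f : ℝ → ℝ → ℝ) (t x : ℝ) : ℝ := deriv (fun ξ => f t ξ) x

/-- The strip `[0,T] × ℝ`. -/
def strip (T : ℝ) : Set (ℝ × ℝ) := Set.Icc 0 T ×ˢ (Set.univ : Set ℝ)

/-- The half-space `[0,∞) × ℝ`. -/
def stripInf : Set (ℝ × ℝ) := Set.Ici (0 : ℝ) ×ˢ (Set.univ : Set ℝ)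

/-- The pressure `p(u) = u^(-γ)/γ`. -/
def pres (γ u : ℝ) : ℝ := u ^ (-γ) / γ

/-- The sound speed `c(u) = u^(-(γ+1)/2)`. -/
def cspeed (γ u : ℝ) : ℝ := u ^ (-(γ + 1) / 2)

/-- The first Riemann invariant `r = v - (2/(γ-1)) u^(-(γ-1)/2) + 2/(γ-1)`. -/
def rInv (γ u v : ℝ) : ℝ := v - (2 / (γ - 1)) * u ^ (-(γ - 1) / 2) + 2 / (γ - 1)

/-- The second Riemann invariant `s = v + (2/(γ-1)) u^(-(γ-1)/2) - 2/(γ-1)`. -/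
def sInv (γ u v : ℝ) : ℝ := v + (2 / (γ - 1)) * u ^ (-(γ - 1) / 2) - 2 / (γ - 1)

/-- `(u,v)` solves the damped compressible Euler system on the set `S`. -/
def IsEulerOn (γ lam μ : ℝ) (u v : ℝ → ℝ → ℝ) (S : Set (ℝ × ℝ)) : Prop :=
  ∀ p ∈ S, pdt u p.1 p.2 - pdx v p.1 p.2 = 0 ∧
    pdt v p.1 p.2 + pdx (fun t x => pres γ (u t x)) p.1 p.2
      = -(lam / (1 + p.1) ^ μ) * v p.1 p.2

/-- `f` is `C¹` on `S ⊆ ℝ × ℝ`. -/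
def IsC1On (f : ℝ → ℝ → ℝ) (S : Set (ℝ × ℝ)) : Prop :=
  ContDiffOn ℝ 1 (fun p : ℝ × ℝ => f p.1 p.2) S

/-- `f` is `C²` on `S ⊆ ℝ × ℝ`. -/
def IsC2On (f : ℝ → ℝ → ℝ) (S : Set (ℝ × ℝ)) : Prop :=
  ContDiffOn ℝ 2 (fun p : ℝ × ℝ => f p.1 p.2) S

/-- `f` is `C¹_b` on `S ⊆ ℝ × ℝ`: `C¹` with `f` and its first partials bounded. -/
def IsC1bOn (f : ℝ → ℝ → ℝ) (S : Set (ℝ × ℝ)) : Prop :=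
  IsC1On f S ∧ ∃ M : ℝ, ∀ p ∈ S, |f p.1 p.2| + |pdt f p.1 p.2| + |pdx f p.1 p.2| ≤ M

/-- `f : ℝ → ℝ` is `C¹_b`. -/
def IsC1b (f : ℝ → ℝ) : Prop :=
  ContDiff ℝ 1 f ∧ ∃ M : ℝ, ∀ x, |f x| + |deriv f x| ≤ M

/-- The damping coefficient `λ/(2(1+t)^μ)`. -/
def damp (lam μ t : ℝ) : ℝ := lam / (2 * (1 + t) ^ μ)

/-- `A(t) = exp(∫₀ᵗ λ/(2(1+τ)^μ) dτ)`. -/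
def Afun (lam μ t : ℝ) : ℝ := Real.exp (∫ τ in (0 : ℝ)..t, damp lam μ τ)

/-- `θ_γ(u)`. -/
def theta (γ u : ℝ) : ℝ :=
  if γ = 3 then Real.log u else (4 / (3 - γ)) * (u ^ ((3 - γ) / 4) - 1)

section Construction

open Topology

/-- Mean value inequality for the deviation from an affine function. -/
lemma abs_sub_sub_mul_le {F F' : ℝ → ℝ} {x x' m B : ℝ}
    (hF : ∀ t ∈ Set.uIcc x x', HasDerivAt F (F' t) t)
    (hB : ∀ t ∈ Set.uIcc x x', |F' t - m| ≤ B) :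
    |F x' - F x - m * (x' - x)| ≤ B * |x' - x| := by
  have h := (convex_uIcc x x').norm_image_sub_le_of_norm_hasDerivWithin_le
    (f := fun t => F t - m * t) (f' := fun t => F' t - m) (C := B) (x := x) (y := x')
    (fun t ht => by
      have := ((hF t ht).sub ((hasDerivAt_id t).const_mul m)).hasDerivWithinAt (s := Set.uIcc x x')
      rw [mul_one] at this
      exact this)
    (fun t ht => by simpa using hB t ht) Set.left_mem_uIcc Set.right_mem_uIcc
  have e : F x' - m * x' - (F x - m * x) = F x' - F x - m * (x' - x) := by ring
  simpa [Real.norm_eq_abs, e] using h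

lemma abs_sub_le_mul_abs_sub {F F' : ℝ → ℝ} {x x' B : ℝ}
    (hF : ∀ t ∈ Set.uIcc x x', HasDerivAt F (F' t) t)
    (hB : ∀ t ∈ Set.uIcc x x', |F' t| ≤ B) :
    |F x' - F x| ≤ B * |x' - x| := by
  simpa using abs_sub_sub_mul_le (m := 0) hF (by simpa using hB)

lemma abs_le_of_mem_uIcc {a b t δ : ℝ} (ha : |a| ≤ δ) (hb : |b| ≤ δ)
    (ht : t ∈ Set.uIcc a b) : |t| ≤ δ := by
  rw [abs_le] at *
  rcases Set.mem_uIcc.1 ht with h | h <;> constructor <;> linarith [h.1, h.2]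

/-- Bounds for the square root `P` of the sound speed, written as a function of `ρ`, its derivative
`Q`, and a primitive `H` of `1 / P`, on the interval `|ρ| ≤ δ`. -/
structure Profile (P Q H : ℝ → ℝ) (δ L : ℝ) : Prop where
  one_le : 1 ≤ L
  hasDerivAt_P : ∀ ρ, |ρ| ≤ δ → HasDerivAt P (Q ρ) ρ
  hasDerivAt_H : ∀ ρ, |ρ| ≤ δ → HasDerivAt H (1 / P ρ) ρ
  le_P : ∀ ρ, |ρ| ≤ δ → 1 / 2 ≤ P ρ
  P_le : ∀ ρ, |ρ| ≤ δ → P ρ ≤ 2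
  Q_le : ∀ ρ, |ρ| ≤ δ → |Q ρ| ≤ L
  Q_lip : ∀ ρ ρ', |ρ| ≤ δ → |ρ'| ≤ δ → |Q ρ' - Q ρ| ≤ L * |ρ' - ρ|
  H_zero : H 0 = 0

namespace Profile

variable {P Q H : ℝ → ℝ} {δ L : ℝ}

lemma P_lip (hp : Profile P Q H δ L) {ρ ρ' : ℝ} (h : |ρ| ≤ δ) (h' : |ρ'| ≤ δ) :
    |P ρ' - P ρ| ≤ L * |ρ' - ρ| :=
  abs_sub_le_mul_abs_sub (fun t ht => hp.hasDerivAt_P t (abs_le_of_mem_uIcc h h' ht))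
    (fun t ht => hp.Q_le t (abs_le_of_mem_uIcc h h' ht))

lemma taylor_P (hp : Profile P Q H δ L) {ρ ρ' : ℝ} (h : |ρ| ≤ δ) (h' : |ρ'| ≤ δ) :
    |P ρ' - P ρ - Q ρ * (ρ' - ρ)| ≤ L * (ρ' - ρ) ^ 2 := by
  have := abs_sub_sub_mul_le (F := P) (F' := Q) (x := ρ) (x' := ρ') (m := Q ρ)
    (B := L * |ρ' - ρ|)
    (fun t ht => hp.hasDerivAt_P t (abs_le_of_mem_uIcc h h' ht))
    (fun t ht => (hp.Q_lip ρ t h (abs_le_of_mem_uIcc h h' ht)).trans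
      (mul_le_mul_of_nonneg_left (Set.abs_sub_left_of_mem_uIcc ht) (by linarith [hp.one_le])))
  rwa [mul_assoc, abs_mul_abs_self, ← pow_two] at this

lemma inv_P_lip (hp : Profile P Q H δ L) {ρ ρ' : ℝ} (h : |ρ| ≤ δ) (h' : |ρ'| ≤ δ) :
    |1 / P ρ' - 1 / P ρ| ≤ 4 * L * |ρ' - ρ| := by
  have h1 := hp.le_P ρ h
  have h2 := hp.le_P ρ' h'
  have h3 := hp.P_lip h' h
  have e : 1 / P ρ' - 1 / P ρ = (P ρ - P ρ') / (P ρ' * P ρ) := by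
    field_simp
  rw [e, abs_div, div_le_iff₀ (abs_pos.2 (by positivity)), abs_of_pos (by positivity : 0 < P ρ' * P ρ)]
  have h4 : 1 / 4 ≤ P ρ' * P ρ := by nlinarith
  rw [abs_sub_comm ρ] at h3
  have : 0 ≤ L * |ρ' - ρ| := mul_nonneg (by linarith [hp.one_le]) (abs_nonneg _)
  nlinarith

lemma taylor_H (hp : Profile P Q H δ L) {ρ ρ' : ℝ} (h : |ρ| ≤ δ) (h' : |ρ'| ≤ δ) :
    |H ρ' - H ρ - (ρ' - ρ) / P ρ| ≤ 4 * L * (ρ' - ρ) ^ 2 := by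
  have := abs_sub_sub_mul_le (F := H) (F' := fun t => 1 / P t) (x := ρ) (x' := ρ') (m := 1 / P ρ)
    (B := 4 * L * |ρ' - ρ|)
    (fun t ht => hp.hasDerivAt_H t (abs_le_of_mem_uIcc h h' ht))
    (fun t ht => (hp.inv_P_lip h (abs_le_of_mem_uIcc h h' ht)).trans
      (mul_le_mul_of_nonneg_left (Set.abs_sub_left_of_mem_uIcc ht) (by linarith [hp.one_le])))
  rw [mul_assoc, abs_mul_abs_self, ← pow_two] at this
  rwa [div_eq_inv_mul, ← one_div]

lemma abs_H_le (hp : Profile P Q H δ L) {ρ : ℝ} (h : |ρ| ≤ δ) : |H ρ| ≤ 2 * |ρ| := by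
  have h0 : |(0 : ℝ)| ≤ δ := by simpa using (abs_nonneg ρ).trans h
  have := abs_sub_le_mul_abs_sub (F := H) (F' := fun t => 1 / P t) (x := 0) (x' := ρ) (B := 2)
    (fun t ht => hp.hasDerivAt_H t (abs_le_of_mem_uIcc h0 h ht))
    (fun t ht => by
      have := hp.le_P t (abs_le_of_mem_uIcc h0 h ht)
      rw [abs_of_pos (by positivity), div_le_iff₀ (by linarith)]
      linarith)
  simpa [hp.H_zero] using this

end Profile

set_option maxHeartbeats 1000000 in
/-- Consistency error of one step of the scheme for the transported quantity. -/
lemma transport_error {s h k a A L ϖ P0 Pp P1 Q H0 Hp H1 y0 y1 z0 D Dm Dp rp r1 : ℝ}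
    (hs : |s| = 1) (hh : 0 < h) (hk : k = h / 8) (ha : 0 ≤ a) (haA : a ≤ A)
    (hL : 1 ≤ L) (hϖ : 0 ≤ ϖ) (hP0 : 1 / 2 ≤ P0) (hP02 : P0 ≤ 2) (hQ : |Q| ≤ L)
    (hy0 : |y0| ≤ 1) (hz0 : |z0| ≤ 1) (hD : |D| ≤ 1) (hDm : |Dm| ≤ 1) (hDp : |Dp| ≤ 1)
    (hDy : |D - y0| ≤ ϖ) (hDmz : |Dm - z0| ≤ ϖ) (hDpz : |Dp - z0| ≤ ϖ) (hyy : |y1 - y0| ≤ ϖ)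
    (hrp : rp = s * k * P0 ^ 2 / 2 * (D - Dm)) (hr1 : r1 = s * h * (D + Dp) / 2)
    (hPp : |Pp - P0 - Q * rp| ≤ L * rp ^ 2) (hP1 : |P1 - P0 - Q * r1| ≤ L * r1 ^ 2)
    (hHp : |Hp - H0 - rp / P0| ≤ 4 * L * rp ^ 2) (hH1 : |H1 - H0 - r1 / P0| ≤ 4 * L * r1 ^ 2)
    (hPp0 : |Pp - P0| ≤ L * |rp|) (hPp1 : |Pp - P1| ≤ L * |rp - r1|) :
    |(Pp * (y0 + P0 ^ 2 / 8 * (y1 - y0) + s * k * (P0 * Q * (y0 + z0)) * D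
        - k * a / 2 * (y0 - z0)) + s * (a / 2) * Hp)
      - ((1 - P0 ^ 2 / 8 - k * a / 2) * (P0 * y0 + s * (a / 2) * H0)
        + P0 ^ 2 / 8 * (P1 * y1 + s * (a / 2) * H1) + s * k * (a ^ 2 / 4) * H0
        + s * k * Q * (P0 * y0) ^ 2)| ≤ k * (50 * L ^ 2 * (1 + A) * (ϖ + h)) := by
  have hs2 : s ^ 2 = 1 := by rw [← sq_abs, hs]; norm_num
  have hk0 : 0 < k := by rw [hk]; positivity
  have hA : 0 ≤ A := ha.trans haA
  have hPsq : P0 ^ 2 ≤ 4 := by nlinarith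
  have hrp4 : |rp| ≤ 4 * k := by
    rw [hrp, abs_mul, abs_div, abs_mul, abs_mul, hs, abs_of_pos hk0, abs_of_nonneg (sq_nonneg P0),
      abs_two]
    have : |D - Dm| ≤ 2 := (abs_sub _ _).trans (by linarith)
    have h2 : 1 * k * P0 ^ 2 / 2 ≤ 2 * k := by
      have := mul_le_mul_of_nonneg_left hPsq hk0.le
      linarith
    calc _ ≤ 2 * k * 2 := mul_le_mul h2 this (abs_nonneg _) (by positivity)
      _ = _ := by ring
  have hr1h : |r1| ≤ h := by
    rw [hr1, abs_div, abs_mul, abs_mul, hs, abs_of_pos hh, abs_two]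
    have : |D + Dp| ≤ 2 := (abs_add_le _ _).trans (by linarith)
    have := mul_le_mul_of_nonneg_left this hh.le
    linarith
  have hrpsq : rp ^ 2 ≤ 16 * k ^ 2 := by
    rw [← sq_abs]
    exact (pow_le_pow_left₀ (abs_nonneg _) hrp4 2).trans (by rw [mul_pow]; norm_num)
  have hr1sq : r1 ^ 2 ≤ h ^ 2 := by
    rw [← sq_abs]
    exact pow_le_pow_left₀ (abs_nonneg _) hr1h 2
  set p := P0 ^ 2 / 8 with hp
  have hp0 : 0 ≤ p := by positivity
  have hp2 : p ≤ 1 / 2 := by rw [hp]; linarith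
  set Rp := Pp - P0 - Q * rp with hRp
  set R1 := P1 - P0 - Q * r1 with hR1
  set Sp := Hp - H0 - rp / P0 with hSp
  set S1 := H1 - H0 - r1 / P0 with hS1
  have key : (Pp * (y0 + p * (y1 - y0) + s * k * (P0 * Q * (y0 + z0)) * D
        - k * a / 2 * (y0 - z0)) + s * (a / 2) * Hp)
      - ((1 - p - k * a / 2) * (P0 * y0 + s * (a / 2) * H0)
        + p * (P1 * y1 + s * (a / 2) * H1) + s * k * (a ^ 2 / 4) * H0
        + s * k * Q * (P0 * y0) ^ 2)
      = s * k * Q * P0 ^ 2 * ((y0 + z0) * (D - y0) - y0 * (((Dm - z0) + (Dp - z0)) / 2))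
        + k * a / 2 * P0 * (-(((Dm - z0) + (Dp - z0)) / 2))
        + y0 * (Rp - p * R1)
        + p * (Pp - P1) * (y1 - y0)
        + (Pp - P0) * (s * k * (P0 * Q * (y0 + z0) * D) - k * a / 2 * (y0 - z0))
        + s * (a / 2) * (Sp - p * S1) := by
    have e1 : Pp = P0 + Q * rp + Rp := by rw [hRp]; ring
    have e2 : P1 = P0 + Q * r1 + R1 := by rw [hR1]; ring
    have e3 : Hp = H0 + rp / P0 + Sp := by rw [hSp]; ring
    have e4 : H1 = H0 + r1 / P0 + S1 := by rw [hS1]; ring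
    have e5 : rp / P0 = s * k * P0 / 2 * (D - Dm) := by
      rw [hrp]; field_simp
    have e6 : p * (r1 / P0) = s * k * P0 / 2 * (D + Dp) := by
      rw [hr1, hp, hk]; field_simp
    have e7 : p * r1 = s * k * P0 ^ 2 / 2 * (D + Dp) := by
      rw [hr1, hp, hk]; ring
    clear_value Rp R1 Sp S1 p
    rw [e3, e4, e5]
    have e8 : p * (P1 * y1 + s * (a / 2) * (H0 + r1 / P0 + S1))
      = p * P1 * y1 + s * (a / 2) * (p * H0 + p * (r1 / P0) + p * S1) := by ring
    rw [e8, e6]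
    have e9 : p * P1 = p * P0 + Q * (p * r1) + p * R1 := by rw [e2]; ring
    have e10 : p * (Pp - P1) * (y1 - y0) = (p * Pp - p * P1) * (y1 - y0) := by ring
    rw [e10, e9, e7, e1, hrp]
    linear_combination (-k * a / 2 * P0 * (Dm + Dp) / 2) * hs2
  rw [key]
  have t1 : |s * k * Q * P0 ^ 2 * ((y0 + z0) * (D - y0) - y0 * (((Dm - z0) + (Dp - z0)) / 2))|
      ≤ k * (12 * L * ϖ) := by
    have b1 : |(y0 + z0) * (D - y0)| ≤ 2 * ϖ := by
      rw [abs_mul]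
      exact mul_le_mul ((abs_add_le _ _).trans (by linarith)) hDy (abs_nonneg _) (by norm_num)
    have b2 : |y0 * (((Dm - z0) + (Dp - z0)) / 2)| ≤ 1 * ϖ := by
      rw [abs_mul, abs_div, abs_two]
      exact mul_le_mul hy0 (by linarith [abs_add_le (Dm - z0) (Dp - z0)]) (by positivity)
        (by norm_num)
    have b3 : |s * k * Q * P0 ^ 2| ≤ k * L * 4 := by
      rw [abs_mul, abs_mul, abs_mul, hs, abs_of_pos hk0, abs_of_nonneg (sq_nonneg P0), one_mul]
      exact mul_le_mul (mul_le_mul_of_nonneg_left hQ hk0.le) hPsq (sq_nonneg _) (by positivity)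
    rw [abs_mul]
    calc _ ≤ k * L * 4 * (2 * ϖ + 1 * ϖ) := mul_le_mul b3
          ((abs_sub _ _).trans (add_le_add b1 b2)) (abs_nonneg _) (by positivity)
      _ = _ := by ring
  have t2 : |k * a / 2 * P0 * (-(((Dm - z0) + (Dp - z0)) / 2))| ≤ k * (A * ϖ) := by
    rw [abs_mul, abs_neg, abs_div _ (2 : ℝ), abs_two,
      abs_of_nonneg (by positivity : 0 ≤ k * a / 2 * P0)]
    calc _ ≤ k * A * ϖ := mul_le_mul (by
            have h1 : k * a / 2 * P0 ≤ k * A / 2 * 2 := by gcongr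
            linarith)
          (by linarith [abs_add_le (Dm - z0) (Dp - z0)]) (by positivity) (by positivity)
      _ = _ := by ring
  have t3 : |y0 * (Rp - p * R1)| ≤ k * (6 * L * h) := by
    have b1 : |Rp| ≤ L * (16 * k ^ 2) := hPp.trans (by gcongr)
    have b2 : |p * R1| ≤ 1 / 2 * (L * h ^ 2) := by
      rw [abs_mul, abs_of_nonneg hp0]
      exact mul_le_mul hp2 (hP1.trans (by gcongr)) (abs_nonneg _) (by norm_num)
    rw [abs_mul]
    calc _ ≤ 1 * (L * (16 * k ^ 2) + 1 / 2 * (L * h ^ 2)) := mul_le_mul hy0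
          ((abs_sub _ _).trans (add_le_add b1 b2)) (abs_nonneg _) (by norm_num)
      _ = _ := by rw [hk]; ring
  have t4 : |p * (Pp - P1) * (y1 - y0)| ≤ k * (6 * L * ϖ) := by
    rw [abs_mul, abs_mul, abs_of_nonneg hp0]
    have : |rp - r1| ≤ 12 * k := (abs_sub _ _).trans (by linarith)
    calc _ ≤ 1 / 2 * (L * (12 * k)) * ϖ := mul_le_mul (mul_le_mul hp2 (hPp1.trans (by gcongr))
          (abs_nonneg _) (by norm_num)) hyy (abs_nonneg _) (by positivity)
      _ = _ := by ring
  have t5 : |(Pp - P0) * (s * k * (P0 * Q * (y0 + z0) * D) - k * a / 2 * (y0 - z0))|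
      ≤ k * (L * h * (4 * L + A) / 2) := by
    have b1 : |s * k * (P0 * Q * (y0 + z0) * D)| ≤ k * (4 * L) := by
      rw [abs_mul, abs_mul, abs_mul, abs_mul, abs_mul, hs, abs_of_pos hk0, one_mul,
        abs_of_pos (by linarith : 0 < P0)]
      have c1 : P0 * |Q| ≤ 2 * L := mul_le_mul hP02 hQ (abs_nonneg _) (by norm_num)
      have c2 : |y0 + z0| ≤ 2 := (abs_add_le _ _).trans (by linarith)
      have c3 : P0 * |Q| * |y0 + z0| ≤ 2 * L * 2 :=
        mul_le_mul c1 c2 (abs_nonneg _) (by positivity)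
      have c4 : P0 * |Q| * |y0 + z0| * |D| ≤ 2 * L * 2 * 1 :=
        mul_le_mul c3 hD (abs_nonneg _) (by positivity)
      exact mul_le_mul_of_nonneg_left (by linarith) hk0.le
    have b2 : |k * a / 2 * (y0 - z0)| ≤ k * A := by
      rw [abs_mul, abs_of_nonneg (by positivity : 0 ≤ k * a / 2)]
      calc _ ≤ k * A / 2 * 2 := mul_le_mul (by gcongr)
            ((abs_sub _ _).trans (by linarith)) (abs_nonneg _) (by positivity)
        _ = _ := by ring
    rw [abs_mul]
    calc _ ≤ (L * (4 * k)) * (k * (4 * L) + k * A) := mul_le_mul (hPp0.trans (by gcongr))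
          ((abs_sub _ _).trans (add_le_add b1 b2)) (abs_nonneg _) (by positivity)
      _ = _ := by rw [hk]; ring
  have t6 : |s * (a / 2) * (Sp - p * S1)| ≤ k * (12 * A * L * h) := by
    have b1 : |Sp| ≤ 4 * L * (16 * k ^ 2) := hHp.trans (by gcongr)
    have b2 : |p * S1| ≤ 1 / 2 * (4 * L * h ^ 2) := by
      rw [abs_mul, abs_of_nonneg hp0]
      exact mul_le_mul hp2 (hH1.trans (by gcongr)) (abs_nonneg _) (by norm_num)
    rw [abs_mul, abs_mul, hs, one_mul, abs_of_nonneg (by positivity : 0 ≤ a / 2)]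
    calc _ ≤ A / 2 * (4 * L * (16 * k ^ 2) + 1 / 2 * (4 * L * h ^ 2)) := mul_le_mul (by linarith)
          ((abs_sub _ _).trans (add_le_add b1 b2)) (abs_nonneg _) (by positivity)
      _ = _ := by rw [hk]; ring
  refine (abs_add_le _ _).trans ((add_le_add ((abs_add_le _ _).trans (add_le_add
    ((abs_add_le _ _).trans (add_le_add ((abs_add_le _ _).trans (add_le_add
    ((abs_add_le _ _).trans (add_le_add t1 t2)) t3)) t4)) t5)) t6).trans ?_)
  have hLL : L ≤ L ^ 2 := by rw [pow_two]; exact le_mul_of_one_le_left (by linarith) hL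
  have hAL : A ≤ A * L ^ 2 := le_mul_of_one_le_right hA (by linarith)
  have hALL : A * L ≤ A * L ^ 2 := mul_le_mul_of_nonneg_left hLL hA
  have f1 : 18 * L * ϖ + A * ϖ ≤ 50 * L ^ 2 * (1 + A) * ϖ := by
    have : 18 * L + A ≤ 50 * L ^ 2 * (1 + A) := by linarith
    linarith [mul_le_mul_of_nonneg_right this hϖ]
  have f2 : 6 * L * h + L * h * (4 * L + A) / 2 + 12 * A * L * h ≤ 50 * L ^ 2 * (1 + A) * h := by
    have : 6 * L + L * (4 * L + A) / 2 + 12 * A * L ≤ 50 * L ^ 2 * (1 + A) := by linarith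
    linarith [mul_le_mul_of_nonneg_right this hh.le]
  calc _ = k * ((18 * L * ϖ + A * ϖ) +
        (6 * L * h + L * h * (4 * L + A) / 2 + 12 * A * L * h)) := by ring
    _ ≤ k * (50 * L ^ 2 * (1 + A) * ϖ + 50 * L ^ 2 * (1 + A) * h) := by gcongr
    _ = _ := by ring

/-- One explicit upwind step for `∂ₜ f = c ∂ₓ f - (a / 2) (f - g)` with `c = P (ρ) ^ 2`,
`ρ = (f + g) / 2`, signed mesh size `e`, time step `|e| / 8` and `α = a |e| / 16`. -/
def adv (P : ℝ → ℝ) (e α : ℝ) (f g : ℝ → ℝ) (x : ℝ) : ℝ :=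
  f x + 1 / 8 * P ((f x + g x) / 2) ^ 2 * (f (x + e) - f x) - α * (f x - g x)

/-- The derivative of `adv P e α f g` when `f` and `g` have derivatives `y` and `z`. -/
def advDeriv (P Q : ℝ → ℝ) (e α : ℝ) (f g y z : ℝ → ℝ) (x : ℝ) : ℝ :=
  y x + 1 / 8 * P ((f x + g x) / 2) ^ 2 * (y (x + e) - y x)
    + 1 / 8 * (P ((f x + g x) / 2) * Q ((f x + g x) / 2) * (y x + z x)) * (f (x + e) - f x)
    - α * (y x - z x)

/-- The combination of `f` and its derivative `y` whose transport equation is damped. -/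
def wave (P H : ℝ → ℝ) (s a : ℝ) (f g y : ℝ → ℝ) (x : ℝ) : ℝ :=
  P ((f x + g x) / 2) * y x + s * (a / 2) * H ((f x + g x) / 2)

lemma abs_half_add_le {a b M : ℝ} (ha : |a| ≤ M) (hb : |b| ≤ M) : |(a + b) / 2| ≤ M := by
  rw [abs_div, abs_two]; linarith [abs_add_le a b]

lemma adv_abs_le {P : ℝ → ℝ} {e α M : ℝ} {f g : ℝ → ℝ} {x : ℝ}
    (hP : P ((f x + g x) / 2) ^ 2 ≤ 4) (hα : 0 ≤ α) (hα2 : α ≤ 1 / 2)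
    (hf : ∀ x, |f x| ≤ M) (hg : ∀ x, |g x| ≤ M) : |adv P e α f g x| ≤ M := by
  unfold adv
  set p := 1 / 8 * P ((f x + g x) / 2) ^ 2 with hp
  have hp0 : 0 ≤ p := by positivity
  have hp2 : p ≤ 1 / 2 := by linarith
  have h1 := abs_le.1 (hf x)
  have h2 := abs_le.1 (hf (x + e))
  have h3 := abs_le.1 (hg x)
  have h4 : 0 ≤ 1 - p - α := by linarith
  rw [abs_le]
  constructor
  · nlinarith [mul_nonneg h4 (by linarith [h1.1] : 0 ≤ M + f x),
      mul_nonneg hp0 (by linarith [h2.1] : 0 ≤ M + f (x + e)),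
      mul_nonneg hα (by linarith [h3.1] : 0 ≤ M + g x)]
  · nlinarith [mul_nonneg h4 (by linarith [h1.2] : 0 ≤ M - f x),
      mul_nonneg hp0 (by linarith [h2.2] : 0 ≤ M - f (x + e)),
      mul_nonneg hα (by linarith [h3.2] : 0 ≤ M - g x)]

lemma hasDerivAt_adv {P Q : ℝ → ℝ} {e α : ℝ} {f g y z : ℝ → ℝ} {x : ℝ}
    (hf : ∀ t, HasDerivAt f (y t) t) (hg : ∀ t, HasDerivAt g (z t) t)
    (hP : HasDerivAt P (Q ((f x + g x) / 2)) ((f x + g x) / 2)) :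
    HasDerivAt (adv P e α f g) (advDeriv P Q e α f g y z x) x := by
  have h1 : HasDerivAt (fun t => P ((f t + g t) / 2)) (Q ((f x + g x) / 2) * ((y x + z x) / 2)) x :=
    HasDerivAt.comp (h₂ := P) x hP (((hf x).add (hg x)).div_const 2)
  have h2 : HasDerivAt (fun t => f (t + e)) (y (x + e)) x := (hf (x + e)).comp_add_const x e
  have := ((hf x).add (((h1.pow 2).const_mul (1 / 8)).mul (h2.sub (hf x)))).sub
    (((hf x).sub (hg x)).const_mul α)
  refine this.congr_deriv ?_
  unfold advDeriv
  simp only [Pi.sub_apply, Pi.pow_apply]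
  push_cast
  ring

lemma mem_uIcc_abs_sub_le {x e t h : ℝ} (he : |e| ≤ h) (ht : t ∈ Set.uIcc x (x + e)) :
    |t - x| ≤ h := by
  have := Set.abs_sub_left_of_mem_uIcc ht
  have h2 : |x + e - x| = |e| := by congr 1; ring
  linarith

/-- The difference quotient of `f` with step `e` deviates from `m` at most as the derivative. -/
lemma abs_quot_sub_le {f y : ℝ → ℝ} {x e h m B : ℝ} (he0 : e ≠ 0) (he : |e| ≤ h)
    (hf : ∀ t, HasDerivAt f (y t) t) (hB : ∀ t, |t - x| ≤ h → |y t - m| ≤ B) :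
    |(f (x + e) - f x) / e - m| ≤ B := by
  have := abs_sub_sub_mul_le (x := x) (x' := x + e) (m := m) (B := B) (fun t _ => hf t)
    (fun t ht => hB t (mem_uIcc_abs_sub_le he ht))
  rw [add_sub_cancel_left] at this
  have e1 : (f (x + e) - f x) / e - m = (f (x + e) - f x - m * e) / e := by field_simp
  rw [e1, abs_div, div_le_iff₀ (abs_pos.2 he0)]
  exact this

lemma wave_step {P Q H : ℝ → ℝ} {δ L : ℝ} (hp : Profile P Q H δ L) {s h k a a' A M B ϖ : ℝ}
    {f g y z : ℝ → ℝ} {x : ℝ} (hs : |s| = 1) (hh : 0 < h) (hk : k = h / 8) (ha : 0 ≤ a)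
    (haA : a ≤ A) (hkA : k * A / 2 ≤ 1 / 2) (hMδ : M ≤ δ) (hϖ : 0 ≤ ϖ)
    (hfM : ∀ t, |f t| ≤ M) (hgM : ∀ t, |g t| ≤ M)
    (hf : ∀ t, HasDerivAt f (y t) t) (hg : ∀ t, HasDerivAt g (z t) t)
    (hy : ∀ t, |t - x| ≤ h → |y t| ≤ 1) (hz : ∀ t, |t - x| ≤ h → |z t| ≤ 1)
    (hyϖ : ∀ t, |t - x| ≤ h → |y t - y x| ≤ ϖ) (hzϖ : ∀ t, |t - x| ≤ h → |z t - z x| ≤ ϖ)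
    (hB : ∀ t, |t - x| ≤ h → |wave P H s a f g y t| ≤ B) :
    |wave P H s a' (adv P (s * h) (k * a / 2) f g) (adv P (-(s * h)) (k * a / 2) g f)
        (advDeriv P Q (s * h) (k * a / 2) f g y z) x|
      ≤ (1 - k * a / 2) * B + k * (a ^ 2 / 2 * M) + |a' - a| * M + k * (L * (B + a * M) ^ 2)
        + k * (50 * L ^ 2 * (1 + A) * (ϖ + h)) := by
  have hs2 : s * s = 1 := by rw [← abs_mul_abs_self, hs]; norm_num
  have hs0 : s ≠ 0 := by rintro rfl; simp at hs
  have hk0 : 0 < k := by rw [hk]; positivity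
  have hL := hp.one_le
  have hM : 0 ≤ M := (abs_nonneg _).trans (hfM x)
  have hka : k * a / 2 ≤ 1 / 2 := by
    have := mul_le_mul_of_nonneg_left haA hk0.le
    linarith
  set e := s * h with he
  have he0 : e ≠ 0 := mul_ne_zero hs0 hh.ne'
  have heh : |e| ≤ h := by rw [he, abs_mul, hs, abs_of_pos hh, one_mul]
  have hneh : |-e| ≤ h := by rwa [abs_neg]
  have hneh0 : -e ≠ 0 := neg_ne_zero.2 he0
  have hρ : ∀ t, |(f t + g t) / 2| ≤ δ := fun t =>
    (abs_half_add_le (hfM t) (hgM t)).trans hMδ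
  have hPsq : ∀ t, P ((f t + g t) / 2) ^ 2 ≤ 4 := fun t => by
    have h1 := hp.le_P _ (hρ t)
    have h2 := hp.P_le _ (hρ t)
    nlinarith
  set fp := adv P e (k * a / 2) f g x with hfp
  set gp := adv P (-e) (k * a / 2) g f x with hgp
  have hfpM : |fp| ≤ M := adv_abs_le (hPsq x) (by positivity) hka hfM hgM
  have hgpM : |gp| ≤ M :=
    adv_abs_le (by rw [add_comm]; exact hPsq x) (by positivity) hka hgM hfM
  have hρp : |(fp + gp) / 2| ≤ δ := (abs_half_add_le hfpM hgpM).trans hMδ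
  set ρ0 := (f x + g x) / 2 with hρ0
  set ρ1 := (f (x + e) + g (x + e)) / 2 with hρ1
  set ρp := (fp + gp) / 2 with hρp'
  set D := (f (x + e) - f x) / e with hD
  set Dm := (g (x + -e) - g x) / (-e) with hDm
  set Dp := (g (x + e) - g x) / e with hDp
  have hx0 : |x - x| ≤ h := by simpa using hh.le
  have hxe : |x + e - x| ≤ h := by simpa using heh
  have e1 : f (x + e) - f x = s * h * D := by rw [hD, ← he]; field_simp
  have e2 : g (x + -e) - g x = -(s * h * Dm) := by rw [hDm, ← he]; field_simp
  have e3 : g (x + e) - g x = s * h * Dp := by rw [hDp, ← he]; field_simp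
  have hrp : ρp - ρ0 = s * k * P ρ0 ^ 2 / 2 * (D - Dm) := by
    rw [hρp', hfp, hgp, hρ0]
    unfold adv
    rw [add_comm (g x) (f x), e1, e2, hk]
    ring
  have hr1 : ρ1 - ρ0 = s * h * (D + Dp) / 2 := by
    rw [hρ1, hρ0]
    linear_combination e1 / 2 + e3 / 2
  have main := transport_error (A := A) (ϖ := ϖ) (y0 := y x) (y1 := y (x + e)) (z0 := z x)
    (D := D) (Dm := Dm)
    (Dp := Dp) (P0 := P ρ0) (Pp := P ρp) (P1 := P ρ1) (Q := Q ρ0) (H0 := H ρ0) (Hp := H ρp)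
    (H1 := H ρ1) (rp := ρp - ρ0) (r1 := ρ1 - ρ0) hs hh hk ha haA hL hϖ (hp.le_P _ (hρ x))
    (hp.P_le _ (hρ x)) (hp.Q_le _ (hρ x)) (hy x hx0) (hz x hx0)
    (by simpa using abs_quot_sub_le (m := 0) he0 heh hf (by simpa using hy))
    (by simpa using abs_quot_sub_le (m := 0) hneh0 hneh hg (by simpa using hz))
    (by simpa using abs_quot_sub_le (m := 0) he0 heh hg (by simpa using hz))
    (abs_quot_sub_le he0 heh hf hyϖ) (abs_quot_sub_le hneh0 hneh hg hzϖ)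
    (abs_quot_sub_le he0 heh hg hzϖ) (hyϖ _ hxe) hrp hr1
    (hp.taylor_P (hρ x) hρp) (hp.taylor_P (hρ x) (hρ _)) (hp.taylor_H (hρ x) hρp)
    (hp.taylor_H (hρ x) (hρ _)) (hp.P_lip (hρ x) hρp)
    (by
      have := hp.P_lip (hρ (x + e)) hρp
      rwa [← hρ1, ← sub_sub_sub_cancel_right ρp ρ1 ρ0] at this)
  have hW0 := hB x hx0
  have hW1 := hB (x + e) hxe
  rw [wave, ← hρ0] at hW0
  rw [wave, ← hρ1] at hW1
  have hH0 : |H ρ0| ≤ 2 * M := (hp.abs_H_le (hρ x)).trans (by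
    linarith [abs_half_add_le (hfM x) (hgM x)])
  have hHp : |H ρp| ≤ 2 * M := (hp.abs_H_le hρp).trans (by
    linarith [abs_half_add_le hfpM hgpM])
  have hBnn : 0 ≤ B := (abs_nonneg _).trans hW0
  have hY : |P ρ0 * y x| ≤ B + a * M := by
    have e5 : P ρ0 * y x = (P ρ0 * y x + s * (a / 2) * H ρ0) - s * (a / 2) * H ρ0 := by ring
    rw [e5]
    refine (abs_sub _ _).trans (add_le_add hW0 ?_)
    rw [abs_mul, abs_mul, hs, one_mul, abs_of_nonneg (by positivity : 0 ≤ a / 2)]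
    nlinarith
  have hY2 : (P ρ0 * y x) ^ 2 ≤ (B + a * M) ^ 2 := by
    rw [← sq_abs]; exact pow_le_pow_left₀ (abs_nonneg _) hY 2
  have hp0 : 0 ≤ P ρ0 ^ 2 / 8 := by positivity
  have hp1 : P ρ0 ^ 2 / 8 ≤ 1 / 2 := by linarith [hPsq x]
  have b1 : |(1 - P ρ0 ^ 2 / 8 - k * a / 2) * (P ρ0 * y x + s * (a / 2) * H ρ0)
      + P ρ0 ^ 2 / 8 * (P ρ1 * y (x + e) + s * (a / 2) * H ρ1)| ≤ (1 - k * a / 2) * B := by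
    refine (abs_add_le _ _).trans ?_
    rw [abs_mul, abs_mul, abs_of_nonneg hp0, abs_of_nonneg (by linarith)]
    have i1 := mul_le_mul_of_nonneg_left hW0
      (by linarith : 0 ≤ 1 - P ρ0 ^ 2 / 8 - k * a / 2)
    have i2 := mul_le_mul_of_nonneg_left hW1 hp0
    linarith
  have b2 : |s * k * (a ^ 2 / 4) * H ρ0| ≤ k * (a ^ 2 / 2 * M) := by
    rw [abs_mul, abs_mul, abs_mul, hs, one_mul, abs_of_pos hk0, abs_of_nonneg (by positivity)]
    calc _ ≤ k * (a ^ 2 / 4) * (2 * M) := by gcongr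
      _ = _ := by ring
  have b3 : |s * k * Q ρ0 * (P ρ0 * y x) ^ 2| ≤ k * (L * (B + a * M) ^ 2) := by
    rw [abs_mul, abs_mul, abs_mul, hs, one_mul, abs_of_pos hk0, abs_of_nonneg (sq_nonneg (P ρ0 * y x)),
      mul_assoc]
    have := hp.Q_le _ (hρ x)
    gcongr
  have b4 : |s * ((a' - a) / 2) * H ρp| ≤ |a' - a| * M := by
    rw [abs_mul, abs_mul, hs, one_mul, abs_div, abs_two]
    calc _ ≤ |a' - a| / 2 * (2 * M) := by gcongr
      _ = _ := by ring
  have e6 : wave P H s a' (adv P e (k * a / 2) f g) (adv P (-e) (k * a / 2) g f)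
        (advDeriv P Q e (k * a / 2) f g y z) x
      = ((P ρp * (y x + P ρ0 ^ 2 / 8 * (y (x + e) - y x) + s * k * (P ρ0 * Q ρ0 * (y x + z x)) * D
        - k * a / 2 * (y x - z x)) + s * (a / 2) * H ρp)
      - ((1 - P ρ0 ^ 2 / 8 - k * a / 2) * (P ρ0 * y x + s * (a / 2) * H ρ0)
        + P ρ0 ^ 2 / 8 * (P ρ1 * y (x + e) + s * (a / 2) * H ρ1) + s * k * (a ^ 2 / 4) * H ρ0
        + s * k * Q ρ0 * (P ρ0 * y x) ^ 2))
      + ((1 - P ρ0 ^ 2 / 8 - k * a / 2) * (P ρ0 * y x + s * (a / 2) * H ρ0)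
        + P ρ0 ^ 2 / 8 * (P ρ1 * y (x + e) + s * (a / 2) * H ρ1))
      + s * k * (a ^ 2 / 4) * H ρ0 + s * k * Q ρ0 * (P ρ0 * y x) ^ 2
      + s * ((a' - a) / 2) * H ρp := by
    rw [wave, ← hfp, ← hgp, ← hρp', advDeriv, ← hρ0, e1, hk]
    ring
  rw [e6]
  refine (abs_add_le _ _).trans ((add_le_add ((abs_add_le _ _).trans (add_le_add
    ((abs_add_le _ _).trans (add_le_add ((abs_add_le _ _).trans (add_le_add main b1)) b2))
    b3)) b4).trans (le_of_eq (by ring)))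

lemma abs_convex_sub_le {u0 u1 v0 v1 p q m r : ℝ} (hp0 : 0 ≤ p) (hp1 : p ≤ 1) (hq0 : 0 ≤ q)
    (hq1 : q ≤ 1) (h00 : |u0 - v0| ≤ m) (h11 : |u1 - v1| ≤ m) (h01 : |u0 - v1| ≤ m + r)
    (h10 : |u1 - v0| ≤ m + r) :
    |(u0 + p * (u1 - u0)) - (v0 + q * (v1 - v0))| ≤ m + |p - q| * r := by
  rcases le_total p q with h | h
  · have e : (u0 + p * (u1 - u0)) - (v0 + q * (v1 - v0))
        = (1 - q) * (u0 - v0) + p * (u1 - v1) + (q - p) * (u0 - v1) := by ring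
    rw [e, abs_of_nonpos (by linarith : p - q ≤ 0)]
    refine (abs_add_three _ _ _).trans ?_
    rw [abs_mul, abs_mul, abs_mul, abs_of_nonneg (by linarith : 0 ≤ 1 - q), abs_of_nonneg hp0,
      abs_of_nonneg (by linarith : 0 ≤ q - p)]
    have i1 := mul_le_mul_of_nonneg_left h00 (by linarith : 0 ≤ 1 - q)
    have i2 := mul_le_mul_of_nonneg_left h11 hp0
    have i3 := mul_le_mul_of_nonneg_left h01 (by linarith : 0 ≤ q - p)
    linarith
  · have e : (u0 + p * (u1 - u0)) - (v0 + q * (v1 - v0))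
        = (1 - p) * (u0 - v0) + q * (u1 - v1) + (p - q) * (u1 - v0) := by ring
    rw [e, abs_of_nonneg (by linarith : 0 ≤ p - q)]
    refine (abs_add_three _ _ _).trans ?_
    rw [abs_mul, abs_mul, abs_mul, abs_of_nonneg (by linarith : 0 ≤ 1 - p), abs_of_nonneg hq0,
      abs_of_nonneg (by linarith : 0 ≤ p - q)]
    have i1 := mul_le_mul_of_nonneg_left h00 (by linarith : 0 ≤ 1 - p)
    have i2 := mul_le_mul_of_nonneg_left h11 hq0
    have i3 := mul_le_mul_of_nonneg_left h10 (by linarith : 0 ≤ p - q)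
    linarith

lemma abs_prod_sub_le {a b c d a' b' c' d' L r m : ℝ} (hL : 0 ≤ L) (ha' : |a'| ≤ 2)
    (hb : |b| ≤ L) (hb' : |b'| ≤ L) (hc : |c| ≤ 2) (hc' : |c'| ≤ 2) (hd : |d| ≤ 1)
    (hab : |a - a'| ≤ r) (hbb : |b - b'| ≤ r) (hcc : |c - c'| ≤ 2 * m) (hdd : |d - d'| ≤ m) :
    |a * b * c * d - a' * b' * c' * d'| ≤ (2 * L + 4) * r + 8 * L * m := by
  have e : a * b * c * d - a' * b' * c' * d' = (a - a') * (b * (c * d)) + (b - b') * (a' * (c * d))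
      + (c - c') * (a' * (b' * d)) + (d - d') * (a' * (b' * c')) := by ring
  have hr : 0 ≤ r := (abs_nonneg _).trans hab
  have hm : 0 ≤ m := (abs_nonneg _).trans hdd
  have hcd : |c * d| ≤ 2 * 1 := by
    rw [abs_mul]; exact mul_le_mul hc hd (abs_nonneg _) (by norm_num)
  have t1 : |(a - a') * (b * (c * d))| ≤ r * (L * (2 * 1)) := by
    rw [abs_mul, abs_mul b]
    exact mul_le_mul hab (mul_le_mul hb hcd (abs_nonneg _) hL) (by positivity) hr
  have t2 : |(b - b') * (a' * (c * d))| ≤ r * (2 * (2 * 1)) := by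
    rw [abs_mul, abs_mul a']
    exact mul_le_mul hbb (mul_le_mul ha' hcd (abs_nonneg _) (by norm_num)) (by positivity) hr
  have t3 : |(c - c') * (a' * (b' * d))| ≤ 2 * m * (2 * (L * 1)) := by
    rw [abs_mul, abs_mul a', abs_mul b']
    exact mul_le_mul hcc (mul_le_mul ha' (mul_le_mul hb' hd (abs_nonneg _) hL) (by positivity)
      (by norm_num)) (by positivity) (by positivity)
  have t4 : |(d - d') * (a' * (b' * c'))| ≤ m * (2 * (L * 2)) := by
    rw [abs_mul, abs_mul a', abs_mul b']
    exact mul_le_mul hdd (mul_le_mul ha' (mul_le_mul hb' hc' (abs_nonneg _) hL) (by positivity)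
      (by norm_num)) (by positivity) (by positivity)
  rw [e]
  refine (abs_add_le _ _).trans ((add_le_add ((abs_add_three _ _ _).trans
    (add_le_add (add_le_add t1 t2) t3)) t4).trans (le_of_eq (by ring)))

set_option maxHeartbeats 1000000 in
lemma modulus_step {P Q H : ℝ → ℝ} {δ L : ℝ} (hp : Profile P Q H δ L) {s h k a A M R η C : ℝ}
    {f g y z : ℝ → ℝ} {x x' : ℝ} (hs : |s| = 1) (hh : 0 < h) (hk : k = h / 8) (ha : 0 ≤ a)
    (haA : a ≤ A) (hMδ : M ≤ δ) (hη : 0 ≤ η) (hC : 1 ≤ C)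
    (hfM : ∀ t, |f t| ≤ M) (hgM : ∀ t, |g t| ≤ M)
    (hf : ∀ t, HasDerivAt f (y t) t) (hg : ∀ t, HasDerivAt g (z t) t)
    (hy : ∀ t, |t| ≤ R + h → |y t| ≤ 1) (hz : ∀ t, |t| ≤ R + h → |z t| ≤ 1)
    (hyC : ∀ t t', |t| ≤ R + h → |t'| ≤ R + h → |y t - y t'| ≤ η + C * |t - t'|)
    (hzC : ∀ t t', |t| ≤ R + h → |t'| ≤ R + h → |z t - z t'| ≤ η + C * |t - t'|)
    (hx : |x| ≤ R) (hx' : |x'| ≤ R) :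
    |advDeriv P Q (s * h) (k * a / 2) f g y z x - advDeriv P Q (s * h) (k * a / 2) f g y z x'|
      ≤ (1 + k * (20 * L ^ 2 + A)) * (η + C * |x - x'|) := by
  have hs0 : s ≠ 0 := by rintro rfl; simp at hs
  have hk0 : 0 < k := by rw [hk]; positivity
  have hL := hp.one_le
  have hA : 0 ≤ A := ha.trans haA
  set e := s * h with he
  have he0 : e ≠ 0 := mul_ne_zero hs0 hh.ne'
  have heh : |e| = h := by rw [he, abs_mul, hs, abs_of_pos hh, one_mul]
  have hρ : ∀ t, |(f t + g t) / 2| ≤ δ := fun t =>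
    (abs_half_add_le (hfM t) (hgM t)).trans hMδ
  have hxh : |x| ≤ R + h := by linarith
  have hx'h : |x'| ≤ R + h := by linarith
  have near : ∀ {w t : ℝ}, |w| ≤ R → |t - w| ≤ h → |t| ≤ R + h := fun {w t} hw ht => by
    have := abs_add_le w (t - w)
    rw [add_sub_cancel] at this
    linarith
  have hxe : |x + e| ≤ R + h := near hx (by rw [add_sub_cancel_left, heh])
  have hx'e : |x' + e| ≤ R + h := near hx' (by rw [add_sub_cancel_left, heh])
  set d := |x - x'| with hd
  have hd0 : 0 ≤ d := abs_nonneg _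
  set m := η + C * d with hm
  have hdm : d ≤ m := by
    have := mul_le_mul_of_nonneg_right hC hd0
    rw [hm]; linarith
  have hm0 : 0 ≤ m := hd0.trans hdm
  have lip : ∀ {F F' : ℝ → ℝ}, (∀ t, HasDerivAt F (F' t) t) → (∀ t, |t| ≤ R + h → |F' t| ≤ 1) →
      |F x - F x'| ≤ d := fun {F F'} hF hF' => by
    have := abs_sub_le_mul_abs_sub (x := x') (x' := x) (B := 1) (fun t _ => hF t)
      (fun t ht => hF' t (abs_le_of_mem_uIcc hx'h hxh ht))
    rwa [one_mul] at this
  have hρd : |(f x + g x) / 2 - (f x' + g x') / 2| ≤ d := by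
    have := abs_half_add_le (lip hf hy) (lip hg hz)
    convert this using 2
    ring
  set ρ := (f x + g x) / 2 with hρx
  set ρ' := (f x' + g x') / 2 with hρx'
  have hPd : |P ρ - P ρ'| ≤ L * d := (hp.P_lip (hρ x') (hρ x)).trans (by gcongr)
  have hQd : |Q ρ - Q ρ'| ≤ L * d := (hp.Q_lip _ _ (hρ x') (hρ x)).trans (by gcongr)
  have hP1 := hp.le_P _ (hρ x)
  have hP2 := hp.P_le _ (hρ x)
  have hP1' := hp.le_P _ (hρ x')
  have hP2' := hp.P_le _ (hρ x')
  have hpq : |1 / 8 * P ρ ^ 2 - 1 / 8 * P ρ' ^ 2| ≤ 1 / 2 * (L * d) := by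
    have e1 : 1 / 8 * P ρ ^ 2 - 1 / 8 * P ρ' ^ 2 = (P ρ + P ρ') / 8 * (P ρ - P ρ') := by ring
    rw [e1, abs_mul, abs_of_nonneg (by linarith : 0 ≤ (P ρ + P ρ') / 8)]
    exact mul_le_mul (by linarith) hPd (abs_nonneg _) (by norm_num)
  have hsq : P ρ ^ 2 ≤ 4 := by nlinarith
  have hsq' : P ρ' ^ 2 ≤ 4 := by nlinarith
  have c1 := abs_convex_sub_le (u0 := y x) (u1 := y (x + e)) (v0 := y x') (v1 := y (x' + e))
    (p := 1 / 8 * P ρ ^ 2) (q := 1 / 8 * P ρ' ^ 2) (m := m) (r := C * h)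
    (by positivity) (by linarith) (by positivity) (by linarith) (hyC _ _ hxh hx'h)
    (by
      have := hyC _ _ hxe hx'e
      rwa [add_sub_add_right_eq_sub] at this)
    (by
      refine (hyC _ _ hxh hx'e).trans ?_
      have : |x - (x' + e)| ≤ d + h := by
        rw [← sub_sub]; exact (abs_sub _ _).trans (by rw [heh])
      have := mul_le_mul_of_nonneg_left this (by linarith : 0 ≤ C)
      rw [hm]; linarith)
    (by
      refine (hyC _ _ hxe hx'h).trans ?_
      have : |x + e - x'| ≤ d + h := by
        rw [add_sub_right_comm]; exact (abs_add_le _ _).trans (by rw [heh])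
      have := mul_le_mul_of_nonneg_left this (by linarith : 0 ≤ C)
      rw [hm]; linarith)
  have c2 : |1 / 8 * P ρ ^ 2 - 1 / 8 * P ρ' ^ 2| * (C * h) ≤ k * (4 * L * m) := by
    calc _ ≤ 1 / 2 * (L * d) * (C * h) := by gcongr
      _ = k * (4 * L * (C * d)) := by rw [hk]; ring
      _ ≤ _ := by gcongr; linarith
  set D := (f (x + e) - f x) / e with hD
  set D' := (f (x' + e) - f x') / e with hD'
  have hDD : |D - D'| ≤ m := by
    have := abs_quot_sub_le (f := fun t => f (x + t) - f (x' + t))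
      (y := fun t => y (x + t) - y (x' + t)) (x := 0) (m := 0) (B := m) he0 heh.le
      (fun t => (HasDerivAt.comp_const_add x t (hf (x + t))).sub
        (HasDerivAt.comp_const_add x' t (hf (x' + t))))
      (fun t ht => by
        have := hyC (x + t) (x' + t) (near hx (by simpa using ht)) (near hx' (by simpa using ht))
        simpa using this)
    convert this using 2
    rw [hD, hD']
    simp only [add_zero, zero_add]
    field_simp
    ring
  have hD1 : |D| ≤ 1 := by
    have := abs_quot_sub_le (m := 0) (B := 1) he0 heh.le hf (x := x)
      (fun t ht => by simpa using hy t (near hx ht))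
    simpa using this
  have c3 := abs_prod_sub_le (a := P ρ) (b := Q ρ) (c := y x + z x) (d := D) (a' := P ρ')
    (b' := Q ρ') (c' := y x' + z x') (d' := D') (L := L) (r := L * d) (m := m) (by linarith)
    (by rw [abs_of_pos (by linarith)]; exact hP2') (hp.Q_le _ (hρ x)) (hp.Q_le _ (hρ x'))
    ((abs_add_le _ _).trans (by linarith [hy x hxh, hz x hxh]))
    ((abs_add_le _ _).trans (by linarith [hy x' hx'h, hz x' hx'h])) hD1 hPd hQd
    (by
      have e1 : y x + z x - (y x' + z x') = (y x - y x') + (z x - z x') := by ring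
      rw [e1]
      exact (abs_add_le _ _).trans (by linarith [hyC _ _ hxh hx'h, hzC _ _ hxh hx'h])) hDD
  have c4 : |k * a / 2 * ((y x - z x) - (y x' - z x'))| ≤ k * (A * m) := by
    rw [abs_mul, abs_of_nonneg (by positivity)]
    have e1 : (y x - z x) - (y x' - z x') = (y x - y x') - (z x - z x') := by ring
    have i1 : |(y x - z x) - (y x' - z x')| ≤ 2 * m := by
      rw [e1]
      exact (abs_sub _ _).trans (by linarith [hyC _ _ hxh hx'h, hzC _ _ hxh hx'h])
    calc _ ≤ k * A / 2 * (2 * m) := by gcongr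
      _ = _ := by ring
  have e2 : advDeriv P Q e (k * a / 2) f g y z x - advDeriv P Q e (k * a / 2) f g y z x'
      = ((y x + 1 / 8 * P ρ ^ 2 * (y (x + e) - y x))
          - (y x' + 1 / 8 * P ρ' ^ 2 * (y (x' + e) - y x')))
        + e / 8 * (P ρ * Q ρ * (y x + z x) * D - P ρ' * Q ρ' * (y x' + z x') * D')
        - k * a / 2 * ((y x - z x) - (y x' - z x')) := by
    have i1 : f (x + e) - f x = e * D := by rw [hD]; field_simp
    have i2 : f (x' + e) - f x' = e * D' := by rw [hD']; field_simp
    unfold advDeriv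
    rw [i1, i2]
    ring
  rw [e2]
  have c5 : |e / 8 * (P ρ * Q ρ * (y x + z x) * D - P ρ' * Q ρ' * (y x' + z x') * D')|
      ≤ k * (((2 * L + 4) * (L * d) + 8 * L * m)) := by
    rw [abs_mul, abs_div, heh, abs_of_pos (by norm_num : (0 : ℝ) < 8), ← hk]
    gcongr
  refine (abs_sub _ _).trans ((add_le_add ((abs_add_le _ _).trans (add_le_add
    (c1.trans (add_le_add_right c2 m)) c5)) c4).trans ?_)
  have hLL : L ≤ L ^ 2 := by rw [pow_two]; exact le_mul_of_one_le_left (by linarith) hL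
  have hLm : L * m ≤ L ^ 2 * m := mul_le_mul_of_nonneg_right hLL hm0
  have hLd : L * d ≤ L ^ 2 * m := (mul_le_mul_of_nonneg_left hdm (by linarith)).trans hLm
  have hLLd : L ^ 2 * d ≤ L ^ 2 * m := mul_le_mul_of_nonneg_left hdm (by positivity)
  have : 4 * L * m + ((2 * L + 4) * (L * d) + 8 * L * m) + A * m ≤ (20 * L ^ 2 + A) * m := by
    have : 0 ≤ L ^ 2 * m := by positivity
    linarith
  have := mul_le_mul_of_nonneg_left this hk0.le
  linarith

lemma abs_adv_sub_sub_le {P : ℝ → ℝ} {s h k a ϖ : ℝ} {f g y : ℝ → ℝ} {x : ℝ}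
    (hP : P ((f x + g x) / 2) ^ 2 ≤ 4) (hs : |s| = 1) (hh : 0 < h) (hk : k = h / 8)
    (hf : ∀ t, HasDerivAt f (y t) t) (hyϖ : ∀ t, |t - x| ≤ h → |y t - y x| ≤ ϖ) :
    |adv P (s * h) (k * a / 2) f g x - f x
      - k * (s * P ((f x + g x) / 2) ^ 2 * y x - a / 2 * (f x - g x))| ≤ 4 * k * ϖ := by
  have hs0 : s ≠ 0 := by rintro rfl; simp at hs
  have heh : |s * h| = h := by rw [abs_mul, hs, abs_of_pos hh, one_mul]
  have he0 : s * h ≠ 0 := mul_ne_zero hs0 hh.ne'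
  have h1 := abs_quot_sub_le he0 heh.le hf hyϖ
  have e1 : adv P (s * h) (k * a / 2) f g x - f x
      - k * (s * P ((f x + g x) / 2) ^ 2 * y x - a / 2 * (f x - g x))
      = s * k * P ((f x + g x) / 2) ^ 2 * ((f (x + s * h) - f x) / (s * h) - y x) := by
    have i1 : f (x + s * h) - f x = s * h * ((f (x + s * h) - f x) / (s * h)) := by field_simp
    unfold adv
    rw [i1, hk]
    field_simp
    ring
  have hk0 : 0 < k := by rw [hk]; positivity
  rw [e1, abs_mul, abs_mul, abs_mul, hs, one_mul, abs_of_pos hk0, abs_of_nonneg (sq_nonneg (P _))]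
  calc _ ≤ k * 4 * ϖ := by gcongr
    _ = _ := by ring

/-- A damping coefficient `a` comparable to the rate `b`, which decays slower than the
solutions of `w' = -(a / 2) w`. -/
structure Damping (a b : ℝ → ℝ) (A κ : ℝ) : Prop where
  κ_pos : 0 < κ
  nonneg : ∀ t, 0 ≤ t → 0 ≤ a t
  le_mul : ∀ t, 0 ≤ t → a t ≤ A * b t
  b_pos : ∀ t, 0 ≤ t → 0 < b t
  b_le_one : ∀ t, 0 ≤ t → b t ≤ 1
  abs_sub_le : ∀ t k, 0 ≤ t → 0 ≤ k → |a (t + k) - a t| ≤ k * (A * b t ^ 2)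
  sub_le : ∀ t k, 0 ≤ t → 0 ≤ k → b t - b (t + k) ≤ k * ((a t / 2 - κ * b t) * b t)
  anti : ∀ t t', 0 ≤ t → t ≤ t' → b t' ≤ b t

/-- The two Riemann unknowns together with their space derivatives. -/
structure WaveState where
  f : ℝ → ℝ
  g : ℝ → ℝ
  y : ℝ → ℝ
  z : ℝ → ℝ

namespace WaveState

/-- Exchange of the two families of waves. -/
def swap (w : WaveState) : WaveState := ⟨w.g, w.f, w.z, w.y⟩

/-- One step of the upwind scheme. -/
def step (P Q : ℝ → ℝ) (s h α : ℝ) (w : WaveState) : WaveState :=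
  ⟨adv P (s * h) α w.f w.g, adv P (-(s * h)) α w.g w.f,
    advDeriv P Q (s * h) α w.f w.g w.y w.z, advDeriv P Q (-(s * h)) α w.g w.f w.z w.y⟩

lemma step_swap (P Q : ℝ → ℝ) (s h α : ℝ) (w : WaveState) :
    w.swap.step P Q (-s) h α = (w.step P Q s h α).swap := by
  simp [swap, step]

/-- The unknowns are bounded by `M` and differentiable with the recorded derivatives. -/
structure Bdd (w : WaveState) (M : ℝ) : Prop where
  f_le : ∀ x, |w.f x| ≤ M
  g_le : ∀ x, |w.g x| ≤ M
  hf : ∀ x, HasDerivAt w.f (w.y x) x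
  hg : ∀ x, HasDerivAt w.g (w.z x) x

lemma Bdd.swap {w : WaveState} {M : ℝ} (hw : w.Bdd M) : w.swap.Bdd M :=
  ⟨hw.g_le, hw.f_le, hw.hg, hw.hf⟩

/-- Bounds for the first family on `|x| ≤ R`: the damped quantity and the modulus of continuity
of the derivative. -/
structure Ctrl (w : WaveState) (P H : ℝ → ℝ) (s a R B η C : ℝ) : Prop where
  wave_le : ∀ x, |x| ≤ R → |wave P H s a w.f w.g w.y x| ≤ B
  modulus : ∀ x x', |x| ≤ R → |x'| ≤ R → |w.y x - w.y x'| ≤ η + C * |x - x'|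

variable {P Q H : ℝ → ℝ} {δ L : ℝ}

lemma Bdd.abs_rho_le {w : WaveState} {M : ℝ} (hw : w.Bdd M) (hMδ : M ≤ δ) (x : ℝ) :
    |(w.f x + w.g x) / 2| ≤ δ :=
  (abs_half_add_le (hw.f_le x) (hw.g_le x)).trans hMδ

lemma Bdd.P_sq_le (hp : Profile P Q H δ L) {w : WaveState} {M : ℝ} (hw : w.Bdd M) (hMδ : M ≤ δ)
    (x : ℝ) : P ((w.f x + w.g x) / 2) ^ 2 ≤ 4 := by
  have h1 := hp.le_P _ (hw.abs_rho_le hMδ x)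
  have h2 := hp.P_le _ (hw.abs_rho_le hMδ x)
  nlinarith

lemma Bdd.step (hp : Profile P Q H δ L) {w : WaveState} {M s h α : ℝ} (hw : w.Bdd M) (hMδ : M ≤ δ)
    (hα : 0 ≤ α) (hα2 : α ≤ 1 / 2) : (w.step P Q s h α).Bdd M where
  f_le x := adv_abs_le (hw.P_sq_le hp hMδ x) hα hα2 hw.f_le hw.g_le
  g_le x := adv_abs_le (hw.swap.P_sq_le hp hMδ x) hα hα2 hw.g_le hw.f_le
  hf x := hasDerivAt_adv hw.hf hw.hg (hp.hasDerivAt_P _ (hw.abs_rho_le hMδ x))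
  hg x := hasDerivAt_adv hw.hg hw.hf (hp.hasDerivAt_P _ (hw.swap.abs_rho_le hMδ x))

lemma Ctrl.y_le (hp : Profile P Q H δ L) {w : WaveState} {M s a R B η C : ℝ} (hw : w.Bdd M)
    (hMδ : M ≤ δ) (hs : |s| = 1) (ha : 0 ≤ a) (hc : w.Ctrl P H s a R B η C) {x : ℝ}
    (hx : |x| ≤ R) : |w.y x| ≤ 2 * (B + a * M) := by
  have hρ := hw.abs_rho_le hMδ x
  have h1 := hp.le_P _ hρ
  have h2 := hp.abs_H_le hρ
  have h3 := abs_half_add_le (hw.f_le x) (hw.g_le x)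
  have h4 := hc.wave_le x hx
  unfold wave at h4
  set ρ := (w.f x + w.g x) / 2
  have h5 : |s * (a / 2) * H ρ| ≤ a * M := by
    rw [abs_mul, abs_mul, hs, one_mul, abs_of_nonneg (by positivity : 0 ≤ a / 2)]
    calc _ ≤ a / 2 * (2 * M) := mul_le_mul_of_nonneg_left (by linarith) (by positivity)
      _ = _ := by ring
  have h6 : |P ρ * w.y x| ≤ B + a * M := by
    have := abs_sub (P ρ * w.y x + s * (a / 2) * H ρ) (s * (a / 2) * H ρ)
    rw [add_sub_cancel_right] at this
    linarith
  rw [abs_mul, abs_of_pos (by linarith)] at h6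
  have := mul_le_mul_of_nonneg_right h1 (abs_nonneg (w.y x))
  linarith

lemma Ctrl.step (hp : Profile P Q H δ L) {w : WaveState} {M s h k a a' A R B η C E : ℝ}
    (hw : w.Bdd M) (hMδ : M ≤ δ) (hs : |s| = 1) (hh : 0 < h) (hk : k = h / 8) (ha : 0 ≤ a)
    (haA : a ≤ A) (hkA : k * A / 2 ≤ 1 / 2) (hη : 0 ≤ η) (hC : 1 ≤ C) (hB1 : 2 * (B + a * M) ≤ 1)
    (hE : 50 * L ^ 2 * (1 + A) * (η + C * h + h) ≤ E)
    (hc : w.Ctrl P H s a R B η C) (hc' : w.swap.Ctrl P H (-s) a R B η C) :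
    (w.step P Q s h (k * a / 2)).Ctrl P H s a' (R - h)
      ((1 - k * a / 2) * B + k * (a ^ 2 / 2 * M) + |a' - a| * M + k * (L * (B + a * M) ^ 2) + k * E)
      ((1 + k * (20 * L ^ 2 + A)) * η) ((1 + k * (20 * L ^ 2 + A)) * C) := by
  have hs' : |-s| = 1 := by rwa [abs_neg]
  have hy : ∀ t, |t| ≤ R → |w.y t| ≤ 1 := fun t ht => (hc.y_le hp hw hMδ hs ha ht).trans hB1
  have hz : ∀ t, |t| ≤ R → |w.z t| ≤ 1 := fun t ht =>
    (hc'.y_le hp hw.swap hMδ hs' ha ht).trans hB1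
  have hk0 : 0 < k := by rw [hk]; positivity
  have near : ∀ {x t : ℝ}, |x| ≤ R - h → |t - x| ≤ h → |t| ≤ R := fun {x t} hx ht => by
    have := abs_add_le x (t - x)
    rw [add_sub_cancel] at this
    linarith
  constructor
  · intro x hx
    have hxR : |x| ≤ R := by linarith
    have mod : ∀ t, |t - x| ≤ h → η + C * |t - x| ≤ η + C * h := fun t ht => by gcongr
    refine (wave_step hp (a' := a') (ϖ := η + C * h) hs hh hk ha haA hkA hMδ (by positivity)
      hw.f_le hw.g_le hw.hf hw.hg
      (fun t ht => hy t (near hx ht)) (fun t ht => hz t (near hx ht))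
      (fun t ht => (hc.modulus t x (near hx ht) hxR).trans (mod t ht))
      (fun t ht => (hc'.modulus t x (near hx ht) hxR).trans (mod t ht))
      (fun t ht => hc.wave_le t (near hx ht))).trans ?_
    have := mul_le_mul_of_nonneg_left hE hk0.le
    linarith
  · intro x x' hx hx'
    have e : R - h + h = R := by ring
    refine (modulus_step hp (R := R - h) hs hh hk ha haA hMδ hη hC hw.f_le hw.g_le hw.hf hw.hg
      (by rwa [e]) (by rwa [e]) (by rw [e]; exact hc.modulus) (by rw [e]; exact hc'.modulus)
      hx hx').trans (le_of_eq (by ring))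

lemma Ctrl.mono {w : WaveState} {s a R R' B B' η C : ℝ} (hc : w.Ctrl P H s a R B η C)
    (hR : R' ≤ R) (hB : B ≤ B') : w.Ctrl P H s a R' B' η C :=
  ⟨fun x hx => (hc.wave_le x (hx.trans hR)).trans hB,
    fun x x' hx hx' => hc.modulus x x' (hx.trans hR) (hx'.trans hR)⟩

end WaveState

/-- The upwind scheme with mesh size `h`. -/
def evol (P Q a : ℝ → ℝ) (s h : ℝ) (w : WaveState) : ℕ → WaveState
  | 0 => w
  | n + 1 => (evol P Q a s h w n).step P Q s h (h / 8 * a (n * (h / 8)) / 2)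

lemma evol_swap (P Q a : ℝ → ℝ) (s h : ℝ) (w : WaveState) (n : ℕ) :
    evol P Q a (-s) h w.swap n = (evol P Q a s h w n).swap := by
  induction n with
  | zero => rfl
  | succ n ih => rw [evol, ih, WaveState.step_swap, evol]

/-- Small data for the damped system. -/
structure SmallData (P Q H a b : ℝ → ℝ) (δ L A κ K M : ℝ) (w : WaveState) : Prop where
  profile : Profile P Q H δ L
  damping : Damping a b A κ
  M_pos : 0 < M
  M_le : M ≤ δ
  K_nonneg : 0 ≤ K
  small : A ^ 2 / 2 + A + L * M * (K + A) ^ 2 ≤ κ * K / 2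
  small_deriv : 2 * ((K + A) * M) ≤ 1
  large : 2 + A ≤ K * b 0
  bdd : w.Bdd M
  y_le : ∀ x, |w.y x| ≤ M
  z_le : ∀ x, |w.z x| ≤ M
  y_cont : Continuous w.y
  z_cont : Continuous w.z

namespace SmallData

variable {P Q H a b : ℝ → ℝ} {δ L A κ K M : ℝ} {w : WaveState}

lemma swap (hd : SmallData P Q H a b δ L A κ K M w) : SmallData P Q H a b δ L A κ K M w.swap :=
  { hd with
    bdd := hd.bdd.swap
    y_le := hd.z_le
    z_le := hd.y_le
    y_cont := hd.z_cont
    z_cont := hd.y_cont }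

lemma A_nonneg (hd : SmallData P Q H a b δ L A κ K M w) : 0 ≤ A := by
  have h1 := hd.damping.nonneg 0 le_rfl
  have h2 := hd.damping.le_mul 0 le_rfl
  have h3 := hd.damping.b_pos 0 le_rfl
  by_contra h
  have := mul_neg_of_neg_of_pos (not_le.1 h) h3
  linarith

lemma a_le (hd : SmallData P Q H a b δ L A κ K M w) {t : ℝ} (ht : 0 ≤ t) : a t ≤ A :=
  (hd.damping.le_mul t ht).trans
    (mul_le_of_le_one_right hd.A_nonneg (hd.damping.b_le_one t ht))

lemma evol_bdd (hd : SmallData P Q H a b δ L A κ K M w) {s h : ℝ} (hh : 0 < h)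
    (hhA : h / 8 * A / 2 ≤ 1 / 2) (n : ℕ) : (evol P Q a s h w n).Bdd M := by
  induction n with
  | zero => exact hd.bdd
  | succ n ih =>
    have ht : 0 ≤ n * (h / 8) := by positivity
    have h1 := hd.damping.nonneg _ ht
    refine ih.step hd.profile hd.M_le (by positivity) (le_trans ?_ hhA)
    have := hd.a_le ht
    gcongr

lemma wave_init (hp : Profile P Q H δ L) {w : WaveState} {M s a K' : ℝ} (hw : w.Bdd M)
    (hMδ : M ≤ δ) (hs : |s| = 1) (ha : 0 ≤ a) (hM : 0 ≤ M) (hy : ∀ x, |w.y x| ≤ M)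
    (hK : 2 + a ≤ K') (x : ℝ) : |wave P H s a w.f w.g w.y x| ≤ K' * M := by
  have hρ := hw.abs_rho_le hMδ x
  have h1 := hp.le_P _ hρ
  have h1' := hp.P_le _ hρ
  have h2 := hp.abs_H_le hρ
  have h3 := abs_half_add_le (hw.f_le x) (hw.g_le x)
  unfold wave
  set ρ := (w.f x + w.g x) / 2
  have h5 : |s * (a / 2) * H ρ| ≤ a * M := by
    rw [abs_mul, abs_mul, hs, one_mul, abs_of_nonneg (by positivity : 0 ≤ a / 2)]
    calc _ ≤ a / 2 * (2 * M) := mul_le_mul_of_nonneg_left (by linarith) (by positivity)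
      _ = _ := by ring
  have h6 : |P ρ * w.y x| ≤ 2 * M := by
    rw [abs_mul, abs_of_pos (by linarith)]
    exact mul_le_mul h1' (hy x) (abs_nonneg _) (by norm_num)
  have := mul_le_mul_of_nonneg_right hK hM
  exact (abs_add_le _ _).trans (by linarith)

lemma rate_step (hd : SmallData P Q H a b δ L A κ K M w) {t k E : ℝ} (ht : 0 ≤ t) (hk : 0 ≤ k)
    (hE : E ≤ κ * K * M * b t ^ 2 / 2) :
    (1 - k * a t / 2) * (K * M * b t) + k * (a t ^ 2 / 2 * M) + |a (t + k) - a t| * M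
      + k * (L * (K * M * b t + a t * M) ^ 2) + k * E ≤ K * M * b (t + k) := by
  have ha := hd.damping.nonneg t ht
  have hab := hd.damping.le_mul t ht
  have hb := hd.damping.b_pos t ht
  have hM := hd.M_pos
  have hK := hd.K_nonneg
  have hL := hd.profile.one_le
  have hA := hd.A_nonneg
  have i1 : a t ^ 2 / 2 * M ≤ M * b t ^ 2 * (A ^ 2 / 2) := by
    have : a t ^ 2 ≤ (A * b t) ^ 2 := by gcongr
    have := mul_le_mul_of_nonneg_right this hM.le
    linarith
  have i2 : |a (t + k) - a t| * M ≤ k * (M * b t ^ 2 * A) := by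
    have := mul_le_mul_of_nonneg_right (hd.damping.abs_sub_le t k ht hk) hM.le
    linarith
  have i3 : L * (K * M * b t + a t * M) ^ 2 ≤ M * b t ^ 2 * (L * M * (K + A) ^ 2) := by
    have : (K * M * b t + a t * M) ^ 2 ≤ (K * M * b t + A * b t * M) ^ 2 := by gcongr
    have := mul_le_mul_of_nonneg_left this (by linarith : 0 ≤ L)
    linarith
  have i4 := mul_le_mul_of_nonneg_left hd.small (by positivity : 0 ≤ M * b t ^ 2)
  have i5 := mul_le_mul_of_nonneg_left (hd.damping.sub_le t k ht hk) (by positivity : 0 ≤ K * M)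
  have i6 := mul_le_mul_of_nonneg_left (add_le_add (add_le_add i1 i3) hE) hk
  have i7 := mul_le_mul_of_nonneg_left i4 hk
  linarith

lemma evol_ctrl (hd : SmallData P Q H a b δ L A κ K M w) {s h T R η C : ℝ} (hs : |s| = 1) (hh : 0 < h)
    (hhA : h / 8 * A / 2 ≤ 1 / 2) (hη : 0 ≤ η) (hC : 1 ≤ C)
    (hE : 50 * L ^ 2 * (1 + A) * (exp ((20 * L ^ 2 + A) * T) * (η + C * h) + h)
      ≤ κ * K * M * b T ^ 2 / 2)
    (hy : ∀ x x', |x| ≤ R → |x'| ≤ R → |w.y x - w.y x'| ≤ η + C * |x - x'|)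
    (hz : ∀ x x', |x| ≤ R → |x'| ≤ R → |w.z x - w.z x'| ≤ η + C * |x - x'|) (n : ℕ)
    (hn : n * (h / 8) ≤ T) :
    (evol P Q a s h w n).Ctrl P H s (a (n * (h / 8))) (R - n * h) (K * M * b (n * (h / 8)))
        ((1 + h / 8 * (20 * L ^ 2 + A)) ^ n * η) ((1 + h / 8 * (20 * L ^ 2 + A)) ^ n * C) ∧
      (evol P Q a s h w n).swap.Ctrl P H (-s) (a (n * (h / 8))) (R - n * h) (K * M * b (n * (h / 8)))
        ((1 + h / 8 * (20 * L ^ 2 + A)) ^ n * η) ((1 + h / 8 * (20 * L ^ 2 + A)) ^ n * C) := by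
  have hs' : |-s| = 1 := by rwa [abs_neg]
  have hL := hd.profile.one_le
  have hA := hd.A_nonneg
  have hM := hd.M_pos
  have hK := hd.K_nonneg
  induction n with
  | zero =>
    have ha := hd.damping.nonneg 0 le_rfl
    have hK0 : 2 + a 0 ≤ K * b 0 := by linarith [hd.large, hd.a_le le_rfl]
    simp only [Nat.cast_zero, zero_mul, sub_zero, pow_zero, one_mul, evol]
    refine ⟨⟨fun x _ => ?_, hy⟩, ⟨fun x _ => ?_, hz⟩⟩
    · exact (wave_init hd.profile hd.bdd hd.M_le hs ha hM.le hd.y_le hK0 x).trans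
        (le_of_eq (by ring))
    · exact (wave_init hd.profile hd.bdd.swap hd.M_le hs' ha hM.le hd.z_le hK0 x).trans
        (le_of_eq (by ring))
  | succ n ih =>
    have hnT : n * (h / 8) ≤ T := by
      push_cast at hn
      linarith
    obtain ⟨ih1, ih2⟩ := ih hnT
    set X := 1 + h / 8 * (20 * L ^ 2 + A) with hX
    set k := h / 8 with hk
    set t := n * k with ht
    have hk0 : 0 < k := by positivity
    have ht0 : 0 ≤ t := by positivity
    have hΛ : 0 ≤ 20 * L ^ 2 + A := by positivity
    have hX1 : 1 ≤ X := by
      have : 0 ≤ k * (20 * L ^ 2 + A) := by positivity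
      linarith
    have hXn : X ^ n ≤ exp ((20 * L ^ 2 + A) * T) := by
      have : X ≤ exp (k * (20 * L ^ 2 + A)) := by
        rw [hX, add_comm]; exact add_one_le_exp _
      calc X ^ n ≤ exp (k * (20 * L ^ 2 + A)) ^ n := by gcongr
        _ = exp ((20 * L ^ 2 + A) * t) := by rw [← exp_nat_mul, ht]; ring_nf
        _ ≤ _ := by gcongr
    have hXn1 : 1 ≤ X ^ n := one_le_pow₀ hX1
    have hb := hd.damping.b_pos t ht0
    have hE' : 50 * L ^ 2 * (1 + A) * (X ^ n * η + X ^ n * C * h + h)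
        ≤ κ * K * M * b t ^ 2 / 2 := by
      have hbT := hd.damping.anti t T ht0 hnT
      have hbT0 := hd.damping.b_pos T (ht0.trans hnT)
      have hκ := hd.damping.κ_pos
      calc _ = 50 * L ^ 2 * (1 + A) * (X ^ n * (η + C * h) + h) := by ring
        _ ≤ 50 * L ^ 2 * (1 + A) * (exp ((20 * L ^ 2 + A) * T) * (η + C * h) + h) := by gcongr
        _ ≤ κ * K * M * b T ^ 2 / 2 := hE
        _ ≤ _ := by gcongr
    have hC' : 1 ≤ X ^ n * C := one_le_mul_of_one_le_of_one_le hXn1 hC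
    have ha := hd.damping.nonneg t ht0
    have hB1 : 2 * (K * M * b t + a t * M) ≤ 1 := by
      have h1 := mul_le_mul_of_nonneg_right (hd.damping.le_mul t ht0) hM.le
      have h2 := mul_le_mul_of_nonneg_left (hd.damping.b_le_one t ht0)
        (by positivity : 0 ≤ (K + A) * M)
      linarith [hd.small_deriv]
    have hw := hd.evol_bdd (s := s) hh hhA n
    have haA := hd.a_le ht0
    have s1 := ih1.step (Q := Q) (a' := a (t + k)) hd.profile hw hd.M_le hs hh hk ha haA hhA
      (by positivity) hC' hB1 hE' ih2
    have s2 := ih2.step (Q := Q) (a' := a (t + k)) hd.profile hw.swap hd.M_le hs' hh hk ha haA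
      hhA (by positivity) hC' hB1 hE' (by rw [neg_neg]; exact ih1)
    rw [WaveState.step_swap] at s2
    have e1 : ((n + 1 : ℕ) : ℝ) * k = t + k := by push_cast; ring
    have e2 : R - ((n + 1 : ℕ) : ℝ) * h ≤ R - n * h - h := by push_cast; linarith
    have r := hd.rate_step ht0 hk0.le le_rfl
    rw [e1, pow_succ', mul_assoc X _ η, mul_assoc X _ C]
    exact ⟨s1.mono e2 r, s2.mono e2 r⟩

end SmallData

lemma exists_affine_modulus {y : ℝ → ℝ} (hy : Continuous y) (R : ℝ) {η : ℝ} (hη : 0 < η) :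
    ∃ C, 1 ≤ C ∧ ∀ x x', |x| ≤ R → |x'| ≤ R → |y x - y x'| ≤ η + C * |x - x'| := by
  have huc := (isCompact_Icc (a := -R) (b := R)).uniformContinuousOn_of_continuous hy.continuousOn
  obtain ⟨B, hB⟩ := (isCompact_Icc (a := -R) (b := R)).exists_bound_of_continuousOn hy.continuousOn
  obtain ⟨d, hd, h⟩ := Metric.uniformContinuousOn_iff.1 huc η hη
  refine ⟨max 1 (2 * B / d), le_max_left _ _, fun x x' hx hx' => ?_⟩
  rw [abs_le] at hx hx'
  rcases lt_or_ge (dist x x') d with hlt | hge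
  · have h1 := h x hx x' hx' hlt
    rw [Real.dist_eq] at h1
    have : 0 ≤ max 1 (2 * B / d) * |x - x'| :=
      mul_nonneg (zero_le_one.trans (le_max_left _ _)) (abs_nonneg _)
    linarith
  · rw [Real.dist_eq] at hge
    have h1 : |y x - y x'| ≤ 2 * B := (abs_sub _ _).trans (by
      have := hB x hx; have := hB x' hx'
      rw [Real.norm_eq_abs] at *
      linarith)
    have hB0 : 0 ≤ 2 * B := (abs_nonneg _).trans h1
    have h2 : 2 * B ≤ 2 * B / d * |x - x'| := by
      calc 2 * B = 2 * B / d * d := by field_simp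
        _ ≤ _ := by gcongr
    have h3 : 2 * B / d * |x - x'| ≤ max 1 (2 * B / d) * |x - x'| := by
      gcongr; exact le_max_right _ _
    linarith

lemma eventually_small {c : ℝ} (hc : 0 < c) : ∀ᶠ h in 𝓝[>] (0 : ℝ), 0 < h ∧ h ≤ c :=
  Ioc_mem_nhdsGT hc

lemma eventually_mul_le {c σ : ℝ} (hσ : 0 < σ) : ∀ᶠ h in 𝓝[>] (0 : ℝ), c * h ≤ σ := by
  filter_upwards [eventually_small (show 0 < σ / (|c| + 1) by positivity)] with h ⟨h0, h1⟩
  rw [le_div_iff₀ (by positivity)] at h1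
  have := mul_le_mul_of_nonneg_right (le_abs_self c) h0.le
  linarith

lemma abs_sub_sub_nsmul_le {u : ℕ → ℝ} {k c ε : ℝ} {n : ℕ} (j : ℕ)
    (h : ∀ i, n ≤ i → i < n + j → |u (i + 1) - u i - k * c| ≤ k * ε) :
    |u (n + j) - u n - j * k * c| ≤ j * k * ε := by
  induction j with
  | zero => simp
  | succ j ih =>
    have h1 := ih fun i hi hij => h i hi (by omega)
    have h2 := h (n + j) (by omega) (by omega)
    rw [← add_assoc]
    push_cast
    have e : u (n + j + 1) - u n - (j + 1) * k * c
        = (u (n + j) - u n - j * k * c) + (u (n + j + 1) - u (n + j) - k * c) := by ring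
    rw [e]
    exact (abs_add_le _ _).trans (by linarith)

namespace SmallData

variable {P Q H a b : ℝ → ℝ} {δ L A κ K M : ℝ} {w : WaveState}

lemma K_pos (hd : SmallData P Q H a b δ L A κ K M w) : 0 < K := by
  refine lt_of_le_of_ne hd.K_nonneg fun h => ?_
  have h1 := hd.large
  have h2 := hd.A_nonneg
  rw [← h, zero_mul] at h1
  linarith

lemma eventually_cfl (_hd : SmallData P Q H a b δ L A κ K M w) :
    ∀ᶠ h in 𝓝[>] (0 : ℝ), 0 < h ∧ h ≤ 1 ∧ h / 8 * A / 2 ≤ 1 / 2 := by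
  filter_upwards [eventually_small one_pos, eventually_mul_le (c := A) one_pos] with h h1 h2
  exact ⟨h1.1, h1.2, by linarith⟩

/-- Bound and equicontinuity in space of the discrete derivatives. -/
lemma eventually_deriv (hd : SmallData P Q H a b δ L A κ K M w) {s : ℝ} (hs : |s| = 1) (R : ℝ)
    {T σ : ℝ} (hT : 0 ≤ T) (hσ : 0 < σ) :
    ∃ C, 1 ≤ C ∧ ∀ᶠ h in 𝓝[>] (0 : ℝ), ∀ n : ℕ, n * (h / 8) ≤ T → ∀ x, |x| ≤ R →
      |(evol P Q a s h w n).y x| ≤ 2 * ((K + A) * M) * b (n * (h / 8)) ∧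
      ∀ x', |x'| ≤ R →
        |(evol P Q a s h w n).y x - (evol P Q a s h w n).y x'| ≤ σ + C * |x - x'| := by
  have hL := hd.profile.one_le
  have hA := hd.A_nonneg
  have hM := hd.M_pos
  have hK := hd.K_pos
  have hκ := hd.damping.κ_pos
  have hbT := hd.damping.b_pos T hT
  set E := exp ((20 * L ^ 2 + A) * T) with hE
  set D := 50 * L ^ 2 * (1 + A) with hD
  set ω := κ * K * M * b T ^ 2 / 2 with hω
  have hE0 : 0 < E := exp_pos _
  have hD0 : 0 < D := by positivity
  have hω0 : 0 < ω := by positivity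
  set η := min (σ / E) (ω / (2 * D * E)) with hη
  have hη0 : 0 < η := by positivity
  have hη1 : E * η ≤ σ := by
    calc E * η ≤ E * (σ / E) := by gcongr; exact min_le_left _ _
      _ = σ := by field_simp
  have hη2 : D * (E * η) ≤ ω / 2 := by
    calc D * (E * η) ≤ D * (E * (ω / (2 * D * E))) := by gcongr; exact min_le_right _ _
      _ = ω / 2 := by field_simp
  obtain ⟨C₁, hC₁, h₁⟩ := exists_affine_modulus hd.y_cont (R + 8 * T) hη0
  obtain ⟨C₂, hC₂, h₂⟩ := exists_affine_modulus hd.z_cont (R + 8 * T) hη0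
  set C := max C₁ C₂ with hC
  have hC1 : 1 ≤ C := hC₁.trans (le_max_left _ _)
  have hE1 : 1 ≤ E := one_le_exp (by positivity)
  refine ⟨E * C, one_le_mul_of_one_le_of_one_le hE1 hC1, ?_⟩
  filter_upwards [hd.eventually_cfl, eventually_mul_le (c := D * (E * C + 1)) (half_pos hω0)]
    with h ⟨hh, hh1, hhA⟩ hsmall n hn x hx
  have key := (hd.evol_ctrl (R := R + 8 * T) hs hh hhA hη0.le hC1 (T := T) (by linarith)
    (fun x x' hx hx' => (h₁ x x' hx hx').trans (by gcongr; exact le_max_left _ _))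
    (fun x x' hx hx' => (h₂ x x' hx hx').trans (by gcongr; exact le_max_right _ _)) n hn).1
  have hR : ∀ x, |x| ≤ R → |x| ≤ R + 8 * T - n * h := fun x hx => by linarith
  have ht0 : 0 ≤ n * (h / 8) := by positivity
  have ha := hd.damping.nonneg _ ht0
  have hX : (1 + h / 8 * (20 * L ^ 2 + A)) ^ n ≤ E := by
    have : 1 + h / 8 * (20 * L ^ 2 + A) ≤ exp (h / 8 * (20 * L ^ 2 + A)) := by
      rw [add_comm]; exact add_one_le_exp _
    calc _ ≤ exp (h / 8 * (20 * L ^ 2 + A)) ^ n := by gcongr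
      _ = exp ((20 * L ^ 2 + A) * (n * (h / 8))) := by rw [← exp_nat_mul]; ring_nf
      _ ≤ _ := by rw [hE]; gcongr
  constructor
  · refine (key.y_le hd.profile (hd.evol_bdd hh hhA n) hd.M_le hs ha (hR x hx)).trans ?_
    have := mul_le_mul_of_nonneg_right (hd.damping.le_mul _ ht0) hM.le
    linarith
  · intro x' hx'
    refine (key.modulus x x' (hR x hx) (hR x' hx')).trans ?_
    have i1 := mul_le_mul_of_nonneg_right hX hη0.le
    have i2 := mul_le_mul_of_nonneg_right hX (by positivity : 0 ≤ C)
    have i3 := mul_le_mul_of_nonneg_right i2 (abs_nonneg (x - x'))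
    linarith

lemma eventually_deriv_le_one (hd : SmallData P Q H a b δ L A κ K M w) {s : ℝ} (hs : |s| = 1)
    (R : ℝ) {T : ℝ} (hT : 0 ≤ T) :
    ∀ᶠ h in 𝓝[>] (0 : ℝ), ∀ n : ℕ, n * (h / 8) ≤ T → ∀ x, |x| ≤ R →
      |(evol P Q a s h w n).y x| ≤ 1 := by
  obtain ⟨C, -, h⟩ := hd.eventually_deriv hs R hT one_pos
  filter_upwards [h, hd.eventually_cfl] with h h1 h2 n hn x hx
  have hh := h2.1
  have ht0 : 0 ≤ n * (h / 8) := by positivity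
  have hA := hd.A_nonneg
  have hM := hd.M_pos
  have hK := hd.K_pos
  refine (h1 n hn x hx).1.trans ?_
  have := mul_le_mul_of_nonneg_left (hd.damping.b_le_one _ ht0)
    (by positivity : 0 ≤ 2 * ((K + A) * M))
  linarith [hd.small_deriv]

/-- The right-hand side of the evolution equation for the first unknown. -/
def rhs (P : ℝ → ℝ) (s a f g y : ℝ) : ℝ :=
  s * P ((f + g) / 2) ^ 2 * y - a / 2 * (f - g)

lemma abs_add_le_of_abs_sub_le {x t R h : ℝ} (hx : |x| ≤ R) (ht : |t - x| ≤ h) : |t| ≤ R + h := by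
  have := abs_add_le x (t - x)
  rw [add_sub_cancel] at this
  linarith

/-- Equicontinuity in time of the discrete solutions. -/
lemma eventually_time_lip (hd : SmallData P Q H a b δ L A κ K M w) {s : ℝ} (hs : |s| = 1) (R : ℝ)
    {T : ℝ} (hT : 0 ≤ T) :
    ∀ᶠ h in 𝓝[>] (0 : ℝ), ∀ n j : ℕ, (n + j : ℕ) * (h / 8) ≤ T → ∀ x, |x| ≤ R →
      |(evol P Q a s h w (n + j)).f x - (evol P Q a s h w n).f x|
        ≤ j * (h / 8) * (12 + A * M) := by
  filter_upwards [hd.eventually_deriv_le_one hs (R + 1) hT, hd.eventually_cfl]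
    with h h1 ⟨hh, hh1, hhA⟩ n j hnj x hx
  have := abs_sub_sub_nsmul_le (u := fun n => (evol P Q a s h w n).f x) (k := h / 8) (c := 0)
    (ε := 12 + A * M) (n := n) j (fun i _ hij => by
      have hw := hd.evol_bdd (s := s) hh hhA i
      have hi : i * (h / 8) ≤ T := by
        refine le_trans ?_ hnj
        gcongr
      have ht0 : 0 ≤ i * (h / 8) := by positivity
      have ha := hd.damping.nonneg _ ht0
      have haA := hd.a_le ht0
      have hy := h1 i hi
      have hx1 : |x| ≤ R + 1 := by linarith
      have hPs := hw.P_sq_le hd.profile hd.M_le x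
      have hstep := abs_adv_sub_sub_le (a := a (i * (h / 8))) (ϖ := 2) hPs hs hh rfl hw.hf
        (fun t ht => (abs_sub _ _).trans (by
          have := hy t (abs_add_le_of_abs_sub_le hx (ht.trans hh1))
          linarith [hy x hx1]))
      change |adv P (s * h) (h / 8 * a (i * (h / 8)) / 2) (evol P Q a s h w i).f
        (evol P Q a s h w i).g x - (evol P Q a s h w i).f x - h / 8 * 0| ≤ _
      rw [mul_zero, sub_zero]
      set f' := adv P (s * h) (h / 8 * a (i * (h / 8)) / 2) (evol P Q a s h w i).f
        (evol P Q a s h w i).g x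
      set f := (evol P Q a s h w i).f x with hf
      set g := (evol P Q a s h w i).g x with hg
      set y := (evol P Q a s h w i).y x with hy'
      have hF : |s * P ((f + g) / 2) ^ 2 * y - a (i * (h / 8)) / 2 * (f - g)| ≤ 4 + A * M := by
        have i1 : |s * P ((f + g) / 2) ^ 2 * y| ≤ 4 * 1 := by
          rw [abs_mul, abs_mul, hs, one_mul, abs_of_nonneg (sq_nonneg (P _))]
          exact mul_le_mul hPs (hy x hx1) (abs_nonneg _) (by norm_num)
        have i2 : |a (i * (h / 8)) / 2 * (f - g)| ≤ A / 2 * (2 * M) := by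
          rw [abs_mul, abs_of_nonneg (by positivity)]
          exact mul_le_mul (by linarith) ((abs_sub _ _).trans
            (by linarith [hw.f_le x, hw.g_le x])) (abs_nonneg _) (by linarith)
        exact (abs_sub _ _).trans (by linarith)
      have hk0 : 0 < h / 8 := by positivity
      have hF' := mul_le_mul_of_nonneg_left hF hk0.le
      rw [← abs_of_pos hk0, ← abs_mul, abs_of_pos hk0] at hF'
      have := abs_add_le (f' - f - h / 8 * (s * P ((f + g) / 2) ^ 2 * y
        - a (i * (h / 8)) / 2 * (f - g))) (h / 8 * (s * P ((f + g) / 2) ^ 2 * y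
        - a (i * (h / 8)) / 2 * (f - g)))
      rw [sub_add_cancel] at this
      linarith)
  simpa using this

/-- Equicontinuity in time of the discrete derivatives. -/
lemma eventually_deriv_time (hd : SmallData P Q H a b δ L A κ K M w) {s : ℝ} (hs : |s| = 1)
    (R : ℝ) {T σ : ℝ} (hT : 0 ≤ T) (hσ : 0 < σ) :
    ∃ C, 0 ≤ C ∧ ∀ᶠ h in 𝓝[>] (0 : ℝ), ∀ n j : ℕ, (n + j : ℕ) * (h / 8) ≤ T → ∀ x, |x| ≤ R →
      |(evol P Q a s h w (n + j)).y x - (evol P Q a s h w n).y x| ≤ σ + C * (j * (h / 8)) := by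
  have hA := hd.A_nonneg
  have hM := hd.M_pos
  obtain ⟨C, hC, hC'⟩ := hd.eventually_deriv hs (R + 1) hT (by positivity : 0 < σ / 4)
  set d := min 1 (σ / (4 * C)) with hdd
  have hd0 : 0 < d := by positivity
  have hCd : C * d ≤ σ / 4 := by
    calc C * d ≤ C * (σ / (4 * C)) := by gcongr; exact min_le_right _ _
      _ = σ / 4 := by field_simp
  refine ⟨2 * (12 + A * M) / d, by positivity, ?_⟩
  filter_upwards [hC', hd.eventually_time_lip hs (R + 1) hT, hd.eventually_cfl]
    with h h1 h2 ⟨hh, hh1, hhA⟩ n j hnj x hx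
  have hn : n * (h / 8) ≤ T := by
    refine le_trans ?_ hnj
    gcongr
    omega
  have hx1 : |x| ≤ R + 1 := by linarith
  have hdle : d ≤ 1 := min_le_left _ _
  have hxd : |x + d| ≤ R + 1 := abs_add_le_of_abs_sub_le hx (by
    rw [add_sub_cancel_left, abs_of_pos hd0]; exact hdle)
  have quot : ∀ m : ℕ, m * (h / 8) ≤ T →
      |((evol P Q a s h w m).f (x + d) - (evol P Q a s h w m).f x) / d
        - (evol P Q a s h w m).y x| ≤ σ / 2 := fun m hm =>
    abs_quot_sub_le (h := d) hd0.ne' (abs_of_pos hd0).le (hd.evol_bdd hh hhA m).hf (fun t ht => by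
      have := (h1 m hm t (abs_add_le_of_abs_sub_le hx (ht.trans hdle))).2 x hx1
      have i := mul_le_mul_of_nonneg_left ht (by linarith : 0 ≤ C)
      linarith)
  have q1 := quot _ hnj
  have q2 := quot _ hn
  have t1 := h2 n j hnj x hx1
  have t2 := h2 n j hnj (x + d) hxd
  set f1 := (evol P Q a s h w (n + j)).f (x + d)
  set f2 := (evol P Q a s h w (n + j)).f x
  set f3 := (evol P Q a s h w n).f (x + d)
  set f4 := (evol P Q a s h w n).f x
  have t3 : |(f1 - f2) / d - (f3 - f4) / d| ≤ 2 * (12 + A * M) / d * (j * (h / 8)) := by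
    have e : (f1 - f2) / d - (f3 - f4) / d = ((f1 - f3) - (f2 - f4)) / d := by ring
    rw [e, abs_div, abs_of_pos hd0, div_mul_eq_mul_div]
    gcongr
    exact (abs_sub _ _).trans (by linarith)
  rw [abs_le] at *
  constructor <;> linarith [q1.1, q1.2, q2.1, q2.2, t3.1, t3.2]

end SmallData

namespace SmallData

variable {P Q H a b : ℝ → ℝ} {δ L A κ K M : ℝ} {w : WaveState}

lemma abs_rhs_sub_le (hp : Profile P Q H δ L) {s a a' f f' g g' y y' d e : ℝ} (hs : |s| = 1)
    (hMδ : M ≤ δ) (hf : |f| ≤ M) (hf' : |f'| ≤ M) (hg : |g| ≤ M) (hg' : |g'| ≤ M)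
    (hy : |y| ≤ 1) (ha' : 0 ≤ a') (haA : a' ≤ A) (hfd : |f - f'| ≤ d) (hgd : |g - g'| ≤ d)
    (hae : |a - a'| ≤ e) :
    |rhs P s a f g y - rhs P s a' f' g' y'| ≤ 4 * |y - y'| + (4 * L + A) * d + e * M := by
  have hρ := (abs_half_add_le hf hg).trans hMδ
  have hρ' := (abs_half_add_le hf' hg').trans hMδ
  have hL := hp.one_le
  have h1 := hp.le_P _ hρ
  have h2 := hp.P_le _ hρ
  have h1' := hp.le_P _ hρ'
  have h2' := hp.P_le _ hρ'
  have hd0 : 0 ≤ d := (abs_nonneg _).trans hfd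
  have he0 : 0 ≤ e := (abs_nonneg _).trans hae
  have h3 : |P ((f + g) / 2) - P ((f' + g') / 2)| ≤ L * d := by
    refine (hp.P_lip hρ' hρ).trans (mul_le_mul_of_nonneg_left ?_ (by linarith))
    have e0 : (f + g) / 2 - (f' + g') / 2 = ((f - f') + (g - g')) / 2 := by ring
    rw [e0]
    exact abs_half_add_le hfd hgd
  unfold rhs
  set p := P ((f + g) / 2)
  set p' := P ((f' + g') / 2)
  have e1 : s * p ^ 2 * y - a / 2 * (f - g) - (s * p' ^ 2 * y' - a' / 2 * (f' - g'))
      = s * p' ^ 2 * (y - y') + s * y * ((p + p') * (p - p'))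
        - a' / 2 * ((f - f') - (g - g')) - (a - a') / 2 * (f - g) := by ring
  have i1 : |s * p' ^ 2 * (y - y')| ≤ 4 * |y - y'| := by
    rw [abs_mul, abs_mul, hs, one_mul, abs_of_nonneg (sq_nonneg p')]
    gcongr
    nlinarith
  have i2 : |s * y * ((p + p') * (p - p'))| ≤ 1 * (4 * (L * d)) := by
    rw [abs_mul, abs_mul, hs, one_mul, abs_mul, abs_of_pos (by linarith : 0 < p + p')]
    exact mul_le_mul hy (mul_le_mul (by linarith) h3 (abs_nonneg _) (by norm_num))
      (mul_nonneg (by linarith) (abs_nonneg _)) zero_le_one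
  have i3 : |a' / 2 * ((f - f') - (g - g'))| ≤ A / 2 * (2 * d) := by
    rw [abs_mul, abs_of_nonneg (by positivity : 0 ≤ a' / 2)]
    exact mul_le_mul (by linarith) ((abs_sub _ _).trans (by linarith)) (abs_nonneg _) (by linarith)
  have i4 : |(a - a') / 2 * (f - g)| ≤ e / 2 * (2 * M) := by
    rw [abs_mul, abs_div, abs_two]
    exact mul_le_mul (by linarith) ((abs_sub _ _).trans (by linarith)) (abs_nonneg _) (by linarith)
  rw [e1]
  refine (abs_sub _ _).trans ((add_le_add ((abs_sub _ _).trans (add_le_add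
    ((abs_add_le _ _).trans (add_le_add i1 i2)) i3)) i4).trans (le_of_eq ?_))
  ring

lemma abs_a_sub_le (hd : SmallData P Q H a b δ L A κ K M w) {t t' : ℝ} (ht : 0 ≤ t)
    (ht' : 0 ≤ t') : |a t - a t'| ≤ A * |t - t'| := by
  have hA := hd.A_nonneg
  wlog h : t ≤ t' generalizing t t'
  · rw [abs_sub_comm, abs_sub_comm t]
    exact this ht' ht (le_of_not_ge h)
  have h1 := hd.damping.abs_sub_le t (t' - t) ht (by linarith)
  rw [add_sub_cancel] at h1
  have hb1 := hd.damping.b_le_one t ht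
  have hb0 := hd.damping.b_pos t ht
  rw [abs_sub_comm, abs_sub_comm t, abs_of_nonneg (by linarith : 0 ≤ t' - t), mul_comm A]
  refine h1.trans (mul_le_mul_of_nonneg_left ?_ (by linarith))
  exact mul_le_of_le_one_right hA (pow_le_one₀ hb0.le hb1)

/-- The discrete evolution equation integrated over several steps. -/
lemma eventually_taylor_time (hd : SmallData P Q H a b δ L A κ K M w) {s : ℝ} (hs : |s| = 1)
    (R : ℝ) {T σ : ℝ} (hT : 0 ≤ T) (hσ : 0 < σ) :
    ∃ C, 0 ≤ C ∧ ∀ᶠ h in 𝓝[>] (0 : ℝ), ∀ n j m : ℕ, n ≤ m → m ≤ n + j →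
      (n + j : ℕ) * (h / 8) ≤ T → ∀ x, |x| ≤ R →
      |(evol P Q a s h w (n + j)).f x - (evol P Q a s h w n).f x - j * (h / 8) *
          rhs P s (a (m * (h / 8))) ((evol P Q a s h w m).f x) ((evol P Q a s h w m).g x)
            ((evol P Q a s h w m).y x)|
        ≤ j * (h / 8) * (σ + C * (j * (h / 8))) := by
  have hA := hd.A_nonneg
  have hM := hd.M_pos
  have hL := hd.profile.one_le
  obtain ⟨C₁, hC₁, h₁⟩ := hd.eventually_deriv_time hs R hT (by positivity : 0 < σ / 16)
  obtain ⟨C₂, hC₂, h₂⟩ := hd.eventually_deriv hs (R + 1) hT (by positivity : 0 < σ / 16)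
  refine ⟨4 * C₁ + (4 * L + A) * (12 + A * M) + A * M,
    by positivity, ?_⟩
  filter_upwards [h₁, h₂, hd.eventually_deriv_le_one hs R hT, hd.eventually_time_lip hs R hT,
    hd.swap.eventually_time_lip (s := -s) (by rwa [abs_neg]) R hT, hd.eventually_cfl,
    eventually_mul_le (c := C₂) (by positivity : 0 < σ / 16)]
    with h h1 h2 h3 h4 h5 ⟨hh, hh1, hhA⟩ hsmall n j m hnm hmj hnj x hx
  simp only [evol_swap] at h5
  change ∀ n j : ℕ, _ → ∀ x, _ → |(evol P Q a s h w (n + j)).g x - (evol P Q a s h w n).g x| ≤ _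
    at h5
  have hk0 : 0 < h / 8 := by positivity
  refine abs_sub_sub_nsmul_le (u := fun n => (evol P Q a s h w n).f x) j fun i hni hij => ?_
  have hle : ∀ i, i ≤ n + j → i * (h / 8) ≤ T := fun i hi => le_trans (by gcongr) hnj
  have hi := hle i hij.le
  have hm := hle m hmj
  have hwi := hd.evol_bdd (s := s) hh hhA i
  have hwm := hd.evol_bdd (s := s) hh hhA m
  -- comparison of two levels between `n` and `n + j`
  have cmp : ∀ i m : ℕ, n ≤ i → i ≤ m → m ≤ n + j →
      |(evol P Q a s h w m).y x - (evol P Q a s h w i).y x| ≤ σ / 16 + C₁ * (j * (h / 8)) ∧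
      |(evol P Q a s h w m).f x - (evol P Q a s h w i).f x| ≤ j * (h / 8) * (12 + A * M) ∧
      |(evol P Q a s h w m).g x - (evol P Q a s h w i).g x| ≤ j * (h / 8) * (12 + A * M) ∧
      |(m : ℝ) * (h / 8) - i * (h / 8)| ≤ j * (h / 8) := by
    intro i m hni him hmj
    obtain ⟨l, rfl⟩ := Nat.exists_eq_add_of_le him
    have hlj : (l : ℝ) ≤ j := by
      have : l ≤ j := by omega
      exact_mod_cast this
    have hlT := hle _ hmj
    refine ⟨(h1 i l hlT x hx).trans (by gcongr), (h4 i l hlT x hx).trans (by gcongr),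
      (h5 i l hlT x hx).trans (by gcongr), ?_⟩
    have e : ((i + l : ℕ) : ℝ) * (h / 8) - i * (h / 8) = l * (h / 8) := by push_cast; ring
    rw [e, abs_of_nonneg (by positivity)]
    gcongr
  have cmp' : |(evol P Q a s h w i).y x - (evol P Q a s h w m).y x|
        ≤ σ / 16 + C₁ * (j * (h / 8)) ∧
      |(evol P Q a s h w i).f x - (evol P Q a s h w m).f x| ≤ j * (h / 8) * (12 + A * M) ∧
      |(evol P Q a s h w i).g x - (evol P Q a s h w m).g x| ≤ j * (h / 8) * (12 + A * M) ∧
      |(i : ℝ) * (h / 8) - m * (h / 8)| ≤ j * (h / 8) := by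
    rcases le_total i m with him | hmi
    · obtain ⟨c1, c2, c3, c4⟩ := cmp i m hni him hmj
      exact ⟨by rwa [abs_sub_comm], by rwa [abs_sub_comm], by rwa [abs_sub_comm],
        by rwa [abs_sub_comm]⟩
    · exact cmp m i hnm hmi hij.le
  obtain ⟨c1, c2, c3, c4⟩ := cmp'
  have hti : 0 ≤ i * (h / 8) := by positivity
  have htm : 0 ≤ m * (h / 8) := by positivity
  have hda := (hd.abs_a_sub_le hti htm).trans (mul_le_mul_of_nonneg_left c4 hA)
  have hrhs := abs_rhs_sub_le hd.profile hs hd.M_le (hwi.f_le x) (hwm.f_le x) (hwi.g_le x)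
    (hwm.g_le x) (h3 i hi x hx) (hd.damping.nonneg _ htm) (hd.a_le htm) c2 c3 hda
    (y' := (evol P Q a s h w m).y x)
  have hx1 : |x| ≤ R + 1 := by linarith
  have hstep := abs_adv_sub_sub_le (a := a (i * (h / 8))) (ϖ := σ / 8)
    (hwi.P_sq_le hd.profile hd.M_le x) hs hh rfl hwi.hf (fun t ht => by
      have i1 := (h2 i hi t (abs_add_le_of_abs_sub_le hx (ht.trans hh1))).2 x hx1
      have i2 := mul_le_mul_of_nonneg_left ht (by linarith : 0 ≤ C₂)
      linarith)
  change |adv P (s * h) (h / 8 * a (i * (h / 8)) / 2) (evol P Q a s h w i).f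
        (evol P Q a s h w i).g x - (evol P Q a s h w i).f x - _| ≤ _
  change |_ - _ - h / 8 * rhs P s (a (i * (h / 8))) ((evol P Q a s h w i).f x)
    ((evol P Q a s h w i).g x) ((evol P Q a s h w i).y x)| ≤ _ at hstep
  set f' := adv P (s * h) (h / 8 * a (i * (h / 8)) / 2) (evol P Q a s h w i).f
        (evol P Q a s h w i).g x
  set f := (evol P Q a s h w i).f x
  set F := rhs P s (a (i * (h / 8))) f ((evol P Q a s h w i).g x) ((evol P Q a s h w i).y x)
  set G := rhs P s (a (m * (h / 8))) ((evol P Q a s h w m).f x) ((evol P Q a s h w m).g x)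
    ((evol P Q a s h w m).y x)
  have i1 := mul_le_mul_of_nonneg_left hrhs hk0.le
  rw [← abs_of_pos hk0, ← abs_mul, abs_of_pos hk0] at i1
  have i2 := abs_add_le (f' - f - h / 8 * F) (h / 8 * (F - G))
  have e2 : f' - f - h / 8 * F + h / 8 * (F - G) = f' - f - h / 8 * G := by ring
  rw [e2] at i2
  have i3 := mul_le_mul_of_nonneg_left c1 hk0.le
  have i4 : 0 ≤ h / 8 * σ := by positivity
  linarith

end SmallData

/-- An ultrafilter of vanishing mesh sizes. -/
def meshUltrafilter : Ultrafilter ℝ := Ultrafilter.of (𝓝[>] (0 : ℝ))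

lemma eventually_mesh {p : ℝ → Prop} (h : ∀ᶠ x in 𝓝[>] (0 : ℝ), p x) :
    ∀ᶠ x in (meshUltrafilter : Filter ℝ), p x :=
  h.filter_mono (Ultrafilter.of_le _)

lemma tendsto_limUnder_mesh {u : ℝ → ℝ} {B : ℝ} (h : ∀ᶠ x in 𝓝[>] (0 : ℝ), |u x| ≤ B) :
    Filter.Tendsto u meshUltrafilter (𝓝 (Filter.limUnder (meshUltrafilter : Filter ℝ) u)) := by
  refine tendsto_nhds_limUnder ?_
  obtain ⟨l, -, hl⟩ := (isCompact_Icc (a := -B) (b := B)).ultrafilter_le_nhds'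
    (meshUltrafilter.map u) (by
      refine Ultrafilter.mem_map.2 ?_
      filter_upwards [eventually_mesh h] with x hx
      exact abs_le.1 hx)
  exact ⟨l, hl⟩

/-- The last grid time before `t`. -/
def gridTime (t h : ℝ) : ℝ := ⌊t / (h / 8)⌋₊ * (h / 8)

lemma gridTime_nonneg {t h : ℝ} (hh : 0 < h) : 0 ≤ gridTime t h := by
  unfold gridTime; positivity

lemma gridTime_le {t h : ℝ} (ht : 0 ≤ t) (hh : 0 < h) : gridTime t h ≤ t := by
  have := Nat.floor_le (show 0 ≤ t / (h / 8) by positivity)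
  rwa [le_div_iff₀ (by positivity)] at this

lemma lt_gridTime_add {t h : ℝ} (hh : 0 < h) : t < gridTime t h + h / 8 := by
  have := Nat.lt_floor_add_one (t / (h / 8))
  rw [div_lt_iff₀ (by positivity)] at this
  unfold gridTime
  linarith

lemma tendsto_mesh : Filter.Tendsto (fun h : ℝ => h) meshUltrafilter (𝓝 0) :=
  (Ultrafilter.of_le _).trans nhdsWithin_le_nhds

lemma tendsto_gridTime {t : ℝ} (ht : 0 ≤ t) :
    Filter.Tendsto (gridTime t) meshUltrafilter (𝓝 t) := by
  have h1 : Filter.Tendsto (fun h : ℝ => t - h / 8) meshUltrafilter (𝓝 t) := by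
    simpa using (tendsto_mesh.div_const 8).const_sub t
  refine tendsto_of_tendsto_of_tendsto_of_le_of_le' h1 tendsto_const_nhds ?_ ?_
  · filter_upwards [eventually_mesh (eventually_small one_pos)] with h hh
    linarith [lt_gridTime_add (t := t) hh.1]
  · filter_upwards [eventually_mesh (eventually_small one_pos)] with h hh
    exact gridTime_le ht hh.1

lemma floor_grid {t t' T h : ℝ} (ht : 0 ≤ t) (htt' : t ≤ t') (hT : t' ≤ T) (hh : 0 < h) :
    ∃ j : ℕ, ⌊t' / (h / 8)⌋₊ = ⌊t / (h / 8)⌋₊ + j ∧ j * (h / 8) = gridTime t' h - gridTime t h ∧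
      (⌊t / (h / 8)⌋₊ + j : ℕ) * (h / 8) ≤ T := by
  obtain ⟨j, hj⟩ := Nat.exists_eq_add_of_le
    (show ⌊t / (h / 8)⌋₊ ≤ ⌊t' / (h / 8)⌋₊ from Nat.floor_mono (by gcongr))
  refine ⟨j, hj, ?_, ?_⟩
  · unfold gridTime
    rw [hj]
    push_cast
    ring
  · rw [← hj]
    exact (gridTime_le (ht.trans htt') hh).trans hT

/-- The discrete solution at time `t`. -/
def evolAt (P Q a : ℝ → ℝ) (s : ℝ) (w : WaveState) (t h : ℝ) : WaveState :=
  evol P Q a s h w ⌊t / (h / 8)⌋₊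

/-- The limit of the discrete solutions. -/
def limState (P Q a : ℝ → ℝ) (s : ℝ) (w : WaveState) (t : ℝ) : WaveState where
  f x := Filter.limUnder (meshUltrafilter : Filter ℝ) fun h => (evolAt P Q a s w t h).f x
  g x := Filter.limUnder (meshUltrafilter : Filter ℝ) fun h => (evolAt P Q a s w t h).g x
  y x := Filter.limUnder (meshUltrafilter : Filter ℝ) fun h => (evolAt P Q a s w t h).y x
  z x := Filter.limUnder (meshUltrafilter : Filter ℝ) fun h => (evolAt P Q a s w t h).z x

lemma evolAt_swap (P Q a : ℝ → ℝ) (s : ℝ) (w : WaveState) (t h : ℝ) :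
    evolAt P Q a (-s) w.swap t h = (evolAt P Q a s w t h).swap :=
  evol_swap _ _ _ _ _ _ _

lemma limState_swap (P Q a : ℝ → ℝ) (s : ℝ) (w : WaveState) (t : ℝ) :
    limState P Q a (-s) w.swap t = (limState P Q a s w t).swap := by
  unfold limState
  simp only [evolAt_swap]
  rfl

namespace SmallData

variable {P Q H a b : ℝ → ℝ} {δ L A κ K M : ℝ} {w : WaveState} {s : ℝ}

lemma tendsto_f (hd : SmallData P Q H a b δ L A κ K M w) (t x : ℝ) :
    Filter.Tendsto (fun h => (evolAt P Q a s w t h).f x) meshUltrafilter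
      (𝓝 ((limState P Q a s w t).f x)) := by
  refine tendsto_limUnder_mesh (B := M) ?_
  filter_upwards [hd.eventually_cfl] with h hh
  exact (hd.evol_bdd hh.1 hh.2.2 _).f_le x

lemma tendsto_g (hd : SmallData P Q H a b δ L A κ K M w) (t x : ℝ) :
    Filter.Tendsto (fun h => (evolAt P Q a s w t h).g x) meshUltrafilter
      (𝓝 ((limState P Q a s w t).g x)) := by
  refine tendsto_limUnder_mesh (B := M) ?_
  filter_upwards [hd.eventually_cfl] with h hh
  exact (hd.evol_bdd hh.1 hh.2.2 _).g_le x

lemma tendsto_y (hd : SmallData P Q H a b δ L A κ K M w) (hs : |s| = 1) {t : ℝ} (ht : 0 ≤ t)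
    (x : ℝ) : Filter.Tendsto (fun h => (evolAt P Q a s w t h).y x) meshUltrafilter
      (𝓝 ((limState P Q a s w t).y x)) := by
  refine tendsto_limUnder_mesh (B := 1) ?_
  filter_upwards [hd.eventually_deriv_le_one hs |x| ht, hd.eventually_cfl] with h h1 h2
  exact h1 _ (gridTime_le ht h2.1) x le_rfl

lemma lim_f_le (hd : SmallData P Q H a b δ L A κ K M w) (t x : ℝ) :
    |(limState P Q a s w t).f x| ≤ M := by
  refine le_of_tendsto (hd.tendsto_f t x).abs (eventually_mesh ?_)
  filter_upwards [hd.eventually_cfl] with h hh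
  exact (hd.evol_bdd hh.1 hh.2.2 _).f_le x

lemma lim_zero (w : WaveState) :
    (limState P Q a s w 0).f = w.f ∧ (limState P Q a s w 0).y = w.y := by
  simp [limState, evolAt, evol, tendsto_const_nhds.limUnder_eq]

lemma b_lip (hd : SmallData P Q H a b δ L A κ K M w) {t h : ℝ} (ht : 0 ≤ t) (hh : 0 < h) :
    b (gridTime t h) ≤ b t + A * h := by
  have h0 := gridTime_nonneg (t := t) hh
  have h1 := gridTime_le ht hh
  have h2 := lt_gridTime_add (t := t) hh
  have hA := hd.A_nonneg
  have h3 := hd.damping.sub_le (gridTime t h) (t - gridTime t h) h0 (by linarith)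
  rw [add_sub_cancel] at h3
  have hb := hd.damping.b_pos _ h0
  have hb1 := hd.damping.b_le_one _ h0
  have ha := hd.a_le h0
  have hκ := hd.damping.κ_pos
  have h4 : (a (gridTime t h) / 2 - κ * b (gridTime t h)) * b (gridTime t h) ≤ A := by
    calc _ ≤ A * b (gridTime t h) := by
          refine mul_le_mul_of_nonneg_right ?_ hb.le
          have : 0 ≤ κ * b (gridTime t h) := by positivity
          linarith
      _ ≤ A := mul_le_of_le_one_right hA hb1
  have h5 := mul_le_mul (by linarith : t - gridTime t h ≤ h) le_rfl hA hh.le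
  have h6 := mul_le_mul_of_nonneg_left h4 (by linarith : 0 ≤ t - gridTime t h)
  linarith

lemma lim_y_le (hd : SmallData P Q H a b δ L A κ K M w) (hs : |s| = 1) {t : ℝ} (ht : 0 ≤ t)
    (x : ℝ) : |(limState P Q a s w t).y x| ≤ 2 * ((K + A) * M) * b t := by
  obtain ⟨C, -, hC⟩ := hd.eventually_deriv hs |x| ht one_pos
  have hA := hd.A_nonneg
  have hM := hd.M_pos
  have hK := hd.K_pos
  have lim : Filter.Tendsto (fun h : ℝ => 2 * ((K + A) * M) * (b t + A * h)) meshUltrafilter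
      (𝓝 (2 * ((K + A) * M) * b t)) := by
    simpa using ((tendsto_mesh.const_mul A).const_add (b t)).const_mul (2 * ((K + A) * M))
  refine le_of_tendsto_of_tendsto (hd.tendsto_y hs ht x).abs lim (eventually_mesh ?_)
  filter_upwards [hC, hd.eventually_cfl] with h h1 h2
  refine (h1 _ (gridTime_le ht h2.1) x le_rfl).1.trans ?_
  exact mul_le_mul_of_nonneg_left (hd.b_lip ht h2.1) (by positivity)

lemma lim_y_space (hd : SmallData P Q H a b δ L A κ K M w) (hs : |s| = 1) (R : ℝ) {T σ : ℝ}
    (hT : 0 ≤ T) (hσ : 0 < σ) :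
    ∃ C, 1 ≤ C ∧ ∀ t, 0 ≤ t → t ≤ T → ∀ x x', |x| ≤ R → |x'| ≤ R →
      |(limState P Q a s w t).y x - (limState P Q a s w t).y x'| ≤ σ + C * |x - x'| := by
  obtain ⟨C, hC, h⟩ := hd.eventually_deriv hs R hT hσ
  refine ⟨C, hC, fun t ht htT x x' hx hx' =>
    le_of_tendsto ((hd.tendsto_y hs ht x).sub (hd.tendsto_y hs ht x')).abs (eventually_mesh ?_)⟩
  filter_upwards [h, hd.eventually_cfl] with h h1 h2
  exact (h1 _ ((gridTime_le ht h2.1).trans htT) x hx).2 x' hx'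

lemma lim_taylor_space (hd : SmallData P Q H a b δ L A κ K M w) (hs : |s| = 1) (R : ℝ) {T σ : ℝ}
    (hT : 0 ≤ T) (hσ : 0 < σ) :
    ∃ C, 1 ≤ C ∧ ∀ t, 0 ≤ t → t ≤ T → ∀ x x', |x| ≤ R → |x'| ≤ R →
      |(limState P Q a s w t).f x' - (limState P Q a s w t).f x
        - (limState P Q a s w t).y x * (x' - x)| ≤ (σ + C * |x' - x|) * |x' - x| := by
  obtain ⟨C, hC, h⟩ := hd.eventually_deriv hs R hT hσ
  refine ⟨C, hC, fun t ht htT x x' hx hx' =>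
    le_of_tendsto (((hd.tendsto_f t x').sub (hd.tendsto_f t x)).sub
      ((hd.tendsto_y hs ht x).mul_const (x' - x))).abs (eventually_mesh ?_)⟩
  filter_upwards [h, hd.eventually_cfl] with h h1 h2
  refine abs_sub_sub_mul_le (fun t _ => (hd.evol_bdd h2.1 h2.2.2 _).hf t) fun r hr => ?_
  refine ((h1 _ ((gridTime_le ht h2.1).trans htT) r (abs_le_of_mem_uIcc hx hx' hr)).2 x hx).trans ?_
  have := Set.abs_sub_left_of_mem_uIcc hr
  gcongr

lemma lim_f_time (hd : SmallData P Q H a b δ L A κ K M w) (hs : |s| = 1) {t t' : ℝ} (ht : 0 ≤ t)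
    (ht' : t ≤ t') (x : ℝ) :
    |(limState P Q a s w t').f x - (limState P Q a s w t).f x| ≤ (t' - t) * (12 + A * M) := by
  have ht'0 := ht.trans ht'
  refine le_of_tendsto_of_tendsto ((hd.tendsto_f t' x).sub (hd.tendsto_f t x)).abs
    (((tendsto_gridTime ht'0).sub (tendsto_gridTime ht)).mul_const (12 + A * M)) (eventually_mesh ?_)
  filter_upwards [hd.eventually_time_lip hs |x| ht'0, hd.eventually_cfl] with h h1 h2
  obtain ⟨j, e1, e2, e3⟩ := floor_grid ht ht' le_rfl h2.1
  have := h1 _ j e3 x le_rfl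
  rwa [e2, ← e1] at this

lemma lim_y_time (hd : SmallData P Q H a b δ L A κ K M w) (hs : |s| = 1) (R : ℝ) {T σ : ℝ}
    (hT : 0 ≤ T) (hσ : 0 < σ) :
    ∃ C, 0 ≤ C ∧ ∀ t t', 0 ≤ t → t ≤ t' → t' ≤ T → ∀ x, |x| ≤ R →
      |(limState P Q a s w t').y x - (limState P Q a s w t).y x| ≤ σ + C * (t' - t) := by
  obtain ⟨C, hC, h⟩ := hd.eventually_deriv_time hs R hT hσ
  refine ⟨C, hC, fun t t' ht ht' htT x hx => ?_⟩
  have ht'0 := ht.trans ht'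
  refine le_of_tendsto_of_tendsto ((hd.tendsto_y hs ht'0 x).sub (hd.tendsto_y hs ht x)).abs
    ((((tendsto_gridTime ht'0).sub (tendsto_gridTime ht)).const_mul C).const_add σ)
    (eventually_mesh ?_)
  filter_upwards [h, hd.eventually_cfl] with h h1 h2
  obtain ⟨j, e1, e2, e3⟩ := floor_grid ht ht' htT h2.1
  have := h1 _ j e3 x hx
  rwa [e2, ← e1] at this

lemma tendsto_rhs (hd : SmallData P Q H a b δ L A κ K M w) (hs : |s| = 1) {t : ℝ} (ht : 0 ≤ t)
    (x : ℝ) : Filter.Tendsto (fun h => rhs P s (a (gridTime t h)) ((evolAt P Q a s w t h).f x)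
      ((evolAt P Q a s w t h).g x) ((evolAt P Q a s w t h).y x)) meshUltrafilter
      (𝓝 (rhs P s (a t) ((limState P Q a s w t).f x) ((limState P Q a s w t).g x)
        ((limState P Q a s w t).y x))) := by
  have hf := hd.tendsto_f (s := s) t x
  have hg := hd.tendsto_g (s := s) t x
  have hy := hd.tendsto_y hs ht x
  have hg_le : |(limState P Q a s w t).g x| ≤ M := by
    have := hd.swap.lim_f_le (s := -s) t x
    rwa [limState_swap] at this
  have hP := (hd.profile.hasDerivAt_P _ ((abs_half_add_le (hd.lim_f_le t x) hg_le).trans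
    hd.M_le)).continuousAt.tendsto.comp ((hf.add hg).div_const 2)
  have ha : Filter.Tendsto (fun h => a (gridTime t h)) meshUltrafilter (𝓝 (a t)) := by
    rw [tendsto_iff_dist_tendsto_zero]
    have h1 : Filter.Tendsto (fun h => A * |gridTime t h - t|) meshUltrafilter (𝓝 0) := by
      simpa using (((tendsto_gridTime ht).sub_const t).abs).const_mul A
    refine squeeze_zero' (Filter.Eventually.of_forall fun _ => dist_nonneg) ?_ h1
    filter_upwards [eventually_mesh hd.eventually_cfl] with h h2
    exact hd.abs_a_sub_le (gridTime_nonneg h2.1) ht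
  exact (((hP.pow 2).const_mul s).mul hy).sub ((ha.div_const 2).mul (hf.sub hg))

lemma lim_taylor_time (hd : SmallData P Q H a b δ L A κ K M w) (hs : |s| = 1) (R : ℝ) {T σ : ℝ}
    (hT : 0 ≤ T) (hσ : 0 < σ) :
    ∃ C, 0 ≤ C ∧ ∀ t t' τ, 0 ≤ t → t ≤ τ → τ ≤ t' → t' ≤ T → ∀ x, |x| ≤ R →
      |(limState P Q a s w t').f x - (limState P Q a s w t).f x - (t' - t) *
        rhs P s (a τ) ((limState P Q a s w τ).f x) ((limState P Q a s w τ).g x)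
          ((limState P Q a s w τ).y x)| ≤ (t' - t) * (σ + C * (t' - t)) := by
  obtain ⟨C, hC, h⟩ := hd.eventually_taylor_time hs R hT hσ
  refine ⟨C, hC, fun t t' τ ht htτ hτ htT x hx => ?_⟩
  have hτ0 := ht.trans htτ
  have ht'0 := hτ0.trans hτ
  have hlim := (tendsto_gridTime ht'0).sub (tendsto_gridTime ht)
  refine le_of_tendsto_of_tendsto (((hd.tendsto_f t' x).sub (hd.tendsto_f t x)).sub
    (hlim.mul (hd.tendsto_rhs hs hτ0 x))).abs (hlim.mul ((hlim.const_mul C).const_add σ))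
    (eventually_mesh ?_)
  filter_upwards [h, hd.eventually_cfl] with h h1 h2
  have hh := h2.1
  obtain ⟨j, e1, e2, e3⟩ := floor_grid ht (htτ.trans hτ) htT hh
  have i1 : ⌊t / (h / 8)⌋₊ ≤ ⌊τ / (h / 8)⌋₊ := Nat.floor_mono (by gcongr)
  have i2 : ⌊τ / (h / 8)⌋₊ ≤ ⌊t / (h / 8)⌋₊ + j := by
    rw [← e1]
    exact Nat.floor_mono (by gcongr)
  have := h1 _ j _ i1 i2 e3 x hx
  rwa [e2, ← e1] at this

end SmallData

lemma hasDerivWithinAt_of_taylor {F : ℝ → ℝ} {S : Set ℝ} {x m : ℝ}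
    (h : ∀ σ > 0, ∃ C, 0 ≤ C ∧ ∀ᶠ x' in 𝓝[S] x,
      |F x' - F x - m * (x' - x)| ≤ (σ + C * |x' - x|) * |x' - x|) :
    HasDerivWithinAt F m S x := by
  rw [hasDerivWithinAt_iff_isLittleO, Asymptotics.isLittleO_iff]
  intro c hc
  obtain ⟨C, hC, h1⟩ := h (c / 2) (by positivity)
  have h2 : Filter.Tendsto (fun x' => C * |x' - x|) (𝓝[S] x) (𝓝 0) := by
    have : Continuous fun x' => C * |x' - x| := by fun_prop
    simpa using (this.tendsto x).mono_left nhdsWithin_le_nhds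
  filter_upwards [h1, h2.eventually_le_const (by positivity : 0 < c / 2)] with x' h3 h4
  rw [Real.norm_eq_abs, Real.norm_eq_abs, smul_eq_mul, mul_comm (x' - x)]
  refine h3.trans (mul_le_mul_of_nonneg_right (by linarith) (abs_nonneg _))

lemma continuousOn_of_moduli {Y : ℝ → ℝ → ℝ}
    (hx : ∀ R T σ : ℝ, 0 ≤ T → 0 < σ → ∃ C, ∀ t, 0 ≤ t → t ≤ T → ∀ x x', |x| ≤ R → |x'| ≤ R →
      |Y t x - Y t x'| ≤ σ + C * |x - x'|)
    (ht : ∀ R T σ : ℝ, 0 ≤ T → 0 < σ → ∃ C, ∀ t t', 0 ≤ t → t ≤ t' → t' ≤ T → ∀ x, |x| ≤ R →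
      |Y t' x - Y t x| ≤ σ + C * (t' - t)) :
    ContinuousOn (fun p : ℝ × ℝ => Y p.1 p.2) (Ici 0 ×ˢ univ) := by
  rintro ⟨t₀, x₀⟩ ⟨ht₀ : 0 ≤ t₀, -⟩
  rw [ContinuousWithinAt, Metric.tendsto_nhds]
  intro ε hε
  obtain ⟨C₁, h₁⟩ := hx (|x₀| + 1) (t₀ + 1) (ε / 4) (by positivity) (by positivity)
  obtain ⟨C₂, h₂⟩ := ht (|x₀| + 1) (t₀ + 1) (ε / 4) (by positivity) (by positivity)
  have hc : Continuous fun p : ℝ × ℝ => C₁ * |p.2 - x₀| + C₂ * |p.1 - t₀| := by fun_prop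
  have h3 := (hc.tendsto (t₀, x₀)).mono_left (nhdsWithin_le_nhds (s := Ici 0 ×ˢ univ))
  have h4 : Filter.Tendsto (fun p : ℝ × ℝ => p.1) (𝓝[Ici 0 ×ˢ univ] (t₀, x₀)) (𝓝 t₀) :=
    (continuous_fst.tendsto (t₀, x₀)).mono_left nhdsWithin_le_nhds
  have h5 : Filter.Tendsto (fun p : ℝ × ℝ => |p.2|) (𝓝[Ici 0 ×ˢ univ] (t₀, x₀)) (𝓝 |x₀|) :=
    (continuous_snd.abs.tendsto (t₀, x₀)).mono_left nhdsWithin_le_nhds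
  simp only [sub_self, abs_zero, mul_zero, add_zero] at h3
  filter_upwards [h3.eventually_lt_const (by positivity : 0 < ε / 4),
    h4.eventually_le_const (by linarith : t₀ < t₀ + 1),
    h5.eventually_le_const (by linarith : |x₀| < |x₀| + 1), self_mem_nhdsWithin]
    with p h6 h7 h8 h9
  have h9 : 0 ≤ p.1 := h9.1
  have i1 := h₁ p.1 h9 h7 p.2 x₀ h8 (by linarith)
  have i2 : |Y p.1 x₀ - Y t₀ x₀| ≤ ε / 4 + C₂ * |p.1 - t₀| := by
    rcases le_total t₀ p.1 with h | h
    · rw [abs_of_nonneg (sub_nonneg.2 h)]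
      exact h₂ _ _ ht₀ h h7 _ (by linarith)
    · rw [abs_sub_comm, abs_sub_comm p.1, abs_of_nonneg (sub_nonneg.2 h)]
      exact h₂ _ _ h9 h (by linarith) _ (by linarith)
  have i3 := abs_sub_le (Y p.1 p.2) (Y p.1 x₀) (Y t₀ x₀)
  rw [Real.dist_eq]
  linarith

/-- Extension to negative times by reflection about the initial value. -/
def oddExt (F : ℝ → ℝ → ℝ) (t x : ℝ) : ℝ := F (max t 0) x - F (max (-t) 0) x + F 0 x

section oddExt

variable {F Fx Ft : ℝ → ℝ → ℝ}

lemma oddExt_of_nonneg {t : ℝ} (ht : 0 ≤ t) : oddExt F t = F t := by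
  ext x
  simp [oddExt, ht]

lemma oddExt_of_nonpos {t : ℝ} (ht : t ≤ 0) (x : ℝ) : oddExt F t x = 2 * F 0 x - F (-t) x := by
  simp only [oddExt, max_eq_right ht, max_eq_left (neg_nonneg.2 ht)]
  ring

lemma continuous_clamp (hF : ContinuousOn (fun p : ℝ × ℝ => F p.1 p.2) (Ici 0 ×ˢ univ))
    {φ : ℝ → ℝ} (hφ : Continuous φ) (h0 : ∀ t, 0 ≤ φ t) :
    Continuous fun p : ℝ × ℝ => F (φ p.1) p.2 :=
  hF.comp_continuous (f := fun p : ℝ × ℝ => (φ p.1, p.2)) (by fun_prop)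
    fun p => ⟨h0 p.1, mem_univ _⟩

lemma continuous_oddExt (hF : ContinuousOn (fun p : ℝ × ℝ => F p.1 p.2) (Ici 0 ×ˢ univ)) :
    Continuous fun p : ℝ × ℝ => oddExt F p.1 p.2 :=
  ((continuous_clamp hF (φ := fun t => max t 0) (by fun_prop) fun _ => le_max_right _ _).sub
    (continuous_clamp hF (φ := fun t => max (-t) 0) (by fun_prop) fun _ => le_max_right _ _)).add
    (continuous_clamp hF (φ := fun _ => 0) (by fun_prop) fun _ => le_rfl)

lemma hasDerivAt_oddExt_space (hx : ∀ t, 0 ≤ t → ∀ x, HasDerivAt (F t) (Fx t x) x) (t x : ℝ) :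
    HasDerivAt (oddExt F t) (oddExt Fx t x) x :=
  ((hx _ (le_max_right _ _) x).sub (hx _ (le_max_right _ _) x)).add (hx _ le_rfl x)

lemma hasDerivAt_oddExt_time
    (ht : ∀ t, 0 ≤ t → ∀ x, HasDerivWithinAt (fun t => F t x) (Ft t x) (Ici 0) t) (t x : ℝ) :
    HasDerivAt (fun t => oddExt F t x) (Ft |t| x) t := by
  have h1 : ∀ t, 0 ≤ t → HasDerivWithinAt (fun t => oddExt F t x) (Ft |t| x) (Ici 0) t := by
    intro t h
    rw [abs_of_nonneg h]
    exact (ht t h x).congr (fun y hy => by rw [oddExt_of_nonneg hy]) (by rw [oddExt_of_nonneg h])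
  have h2 : ∀ t, t ≤ 0 → HasDerivWithinAt (fun t => oddExt F t x) (Ft |t| x) (Iic 0) t := by
    intro t h
    rw [abs_of_nonpos h]
    have h3 : HasDerivWithinAt (fun t => F (-t) x) (Ft (-t) x * (-1)) (Iic 0) t :=
      (ht (-t) (neg_nonneg.2 h) x).comp t (hasDerivAt_neg t).hasDerivWithinAt
        fun y hy => neg_nonneg.2 (mem_Iic.1 hy)
    have h4 := h3.const_sub (2 * F 0 x)
    rw [mul_neg_one, neg_neg] at h4
    exact h4.congr (fun y hy => oddExt_of_nonpos hy x) (oddExt_of_nonpos h x)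
  rcases lt_trichotomy t 0 with h | rfl | h
  · exact (h2 t h.le).hasDerivAt (Iic_mem_nhds h)
  · have := (h2 0 le_rfl).union (h1 0 le_rfl)
    rwa [Iic_union_Ici, hasDerivWithinAt_univ] at this
  · exact (h1 t h.le).hasDerivAt (Ici_mem_nhds h)

end oddExt

lemma contDiff_one_of_partials {F Ft Fx : ℝ → ℝ → ℝ}
    (ht : ∀ t x, HasDerivAt (fun t => F t x) (Ft t x) t) (hx : ∀ t x, HasDerivAt (F t) (Fx t x) x)
    (hct : Continuous fun p : ℝ × ℝ => Ft p.1 p.2) (hcx : Continuous fun p : ℝ × ℝ => Fx p.1 p.2) :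
    ContDiff ℝ 1 fun p : ℝ × ℝ => F p.1 p.2 := by
  have c1 : Continuous fun p : ℝ × ℝ => ContinuousLinearMap.toSpanSingleton ℝ (Ft p.1 p.2) :=
    (ContinuousLinearMap.toSpanSingletonCLE (𝕜 := ℝ) (E := ℝ)).continuous.comp hct
  have c2 : Continuous fun p : ℝ × ℝ => ContinuousLinearMap.toSpanSingleton ℝ (Fx p.1 p.2) :=
    (ContinuousLinearMap.toSpanSingletonCLE (𝕜 := ℝ) (E := ℝ)).continuous.comp hcx
  refine contDiff_one_iff_hasFDerivAt.2 ⟨fun p =>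
    (ContinuousLinearMap.toSpanSingleton ℝ (Ft p.1 p.2)).coprod
      (ContinuousLinearMap.toSpanSingleton ℝ (Fx p.1 p.2)), ?_, fun p => ?_⟩
  · fun_prop
  · exact (hasStrictFDerivAt_uncurry_coprod (f := F)
      (f₁ := fun t x => ContinuousLinearMap.toSpanSingleton ℝ (Ft t x))
      (f₂ := fun t x => ContinuousLinearMap.toSpanSingleton ℝ (Fx t x))
      (Filter.Eventually.of_forall fun v => (ht v.1 v.2).hasFDerivAt)
      (Filter.Eventually.of_forall fun v => (hx v.1 v.2).hasFDerivAt)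
      c1.continuousAt c2.continuousAt).hasFDerivAt

lemma contDiff_oddExt {F Ft Fx : ℝ → ℝ → ℝ}
    (ht : ∀ t, 0 ≤ t → ∀ x, HasDerivWithinAt (fun t => F t x) (Ft t x) (Ici 0) t)
    (hx : ∀ t, 0 ≤ t → ∀ x, HasDerivAt (F t) (Fx t x) x)
    (hct : ContinuousOn (fun p : ℝ × ℝ => Ft p.1 p.2) (Ici 0 ×ˢ univ))
    (hcx : ContinuousOn (fun p : ℝ × ℝ => Fx p.1 p.2) (Ici 0 ×ˢ univ)) :
    ContDiff ℝ 1 fun p : ℝ × ℝ => oddExt F p.1 p.2 :=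
  contDiff_one_of_partials (hasDerivAt_oddExt_time ht) (hasDerivAt_oddExt_space hx)
    (continuous_clamp hct (φ := fun t => |t|) (by fun_prop) abs_nonneg) (continuous_oddExt hcx)

namespace SmallData

variable {P Q H a b : ℝ → ℝ} {δ L A κ K M : ℝ} {w : WaveState} {s : ℝ}

lemma limState_swap_f (t : ℝ) :
    (limState P Q a (-s) w.swap t).f = (limState P Q a s w t).g := by
  rw [limState_swap, WaveState.swap]

lemma limState_swap_g (t : ℝ) :
    (limState P Q a (-s) w.swap t).g = (limState P Q a s w t).f := by
  rw [limState_swap, WaveState.swap]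

lemma limState_swap_y (t : ℝ) :
    (limState P Q a (-s) w.swap t).y = (limState P Q a s w t).z := by
  rw [limState_swap, WaveState.swap]

lemma lim_f_deriv (hd : SmallData P Q H a b δ L A κ K M w) (hs : |s| = 1) {t : ℝ} (ht : 0 ≤ t)
    (x : ℝ) : HasDerivAt (limState P Q a s w t).f ((limState P Q a s w t).y x) x := by
  rw [← hasDerivWithinAt_univ]
  refine hasDerivWithinAt_of_taylor fun σ hσ => ?_
  obtain ⟨C, hC, h⟩ := hd.lim_taylor_space (s := s) hs (|x| + 1) ht hσ
  refine ⟨C, by linarith, ?_⟩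
  rw [nhdsWithin_univ]
  filter_upwards [(continuous_abs.tendsto x).eventually_le_const (lt_add_one |x|)] with x' hx'
  exact h t ht le_rfl x x' (by linarith) hx'

lemma lim_y_le_one (hd : SmallData P Q H a b δ L A κ K M w) (hs : |s| = 1) {t : ℝ} (ht : 0 ≤ t)
    (x : ℝ) : |(limState P Q a s w t).y x| ≤ 1 := by
  have hA := hd.A_nonneg
  have hM := hd.M_pos
  have hK := hd.K_pos
  refine (hd.lim_y_le hs ht x).trans ((mul_le_of_le_one_right (by positivity)
    (hd.damping.b_le_one t ht)).trans hd.small_deriv)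

lemma lim_f_continuousOn (hd : SmallData P Q H a b δ L A κ K M w) (hs : |s| = 1) :
    ContinuousOn (fun p : ℝ × ℝ => (limState P Q a s w p.1).f p.2) (Ici 0 ×ˢ univ) := by
  refine continuousOn_of_moduli (Y := fun t => (limState P Q a s w t).f)
    (fun R T σ hT hσ => ⟨1, fun t ht htT x x' hx hx' => ?_⟩)
    fun R T σ hT hσ => ⟨12 + A * M, fun t t' ht htt' htT x hx => ?_⟩
  · have := abs_sub_le_mul_abs_sub (x := x') (x' := x) (fun r _ => hd.lim_f_deriv hs ht r)
      fun r _ => hd.lim_y_le_one hs ht r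
    linarith
  · have := hd.lim_f_time hs ht htt' x
    linarith

lemma lim_y_continuousOn (hd : SmallData P Q H a b δ L A κ K M w) (hs : |s| = 1) :
    ContinuousOn (fun p : ℝ × ℝ => (limState P Q a s w p.1).y p.2) (Ici 0 ×ˢ univ) := by
  refine continuousOn_of_moduli (Y := fun t => (limState P Q a s w t).y) (fun R T σ hT hσ => ?_) fun R T σ hT hσ => ?_
  · obtain ⟨C, -, h⟩ := hd.lim_y_space (s := s) hs R hT hσ
    exact ⟨C, h⟩
  · obtain ⟨C, -, h⟩ := hd.lim_y_time (s := s) hs R hT hσ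
    exact ⟨C, h⟩

lemma lim_f_hasDerivWithinAt (hd : SmallData P Q H a b δ L A κ K M w) (hs : |s| = 1) {t : ℝ}
    (ht : 0 ≤ t) (x : ℝ) :
    HasDerivWithinAt (fun t => (limState P Q a s w t).f x)
      (rhs P s (a t) ((limState P Q a s w t).f x) ((limState P Q a s w t).g x)
        ((limState P Q a s w t).y x)) (Ici 0) t := by
  refine hasDerivWithinAt_of_taylor fun σ hσ => ?_
  obtain ⟨C, hC, h⟩ := hd.lim_taylor_time (s := s) hs |x| (by linarith : 0 ≤ t + 1) hσ
  refine ⟨C, hC, ?_⟩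
  filter_upwards [self_mem_nhdsWithin,
    nhdsWithin_le_nhds (Iic_mem_nhds (lt_add_one t))] with t' h1 h2
  have h1 : 0 ≤ t' := h1
  have h2 : t' ≤ t + 1 := h2
  rcases le_total t t' with h3 | h3
  · rw [abs_of_nonneg (sub_nonneg.2 h3), mul_comm _ (t' - t), mul_comm _ (t' - t)]
    exact h t t' t ht le_rfl h3 h2 x le_rfl
  · rw [abs_sub_comm t', abs_of_nonneg (sub_nonneg.2 h3), mul_comm _ (t - t'), ← abs_neg]
    convert h t' t t h1 h3 le_rfl (by linarith) x le_rfl using 2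
    ring

lemma rhs_continuousOn (hd : SmallData P Q H a b δ L A κ K M w) (hs : |s| = 1) :
    ContinuousOn (fun p : ℝ × ℝ => rhs P s (a p.1) ((limState P Q a s w p.1).f p.2)
      ((limState P Q a s w p.1).g p.2) ((limState P Q a s w p.1).y p.2)) (Ici 0 ×ˢ univ) := by
  have hf := hd.lim_f_continuousOn hs
  have hy := hd.lim_y_continuousOn hs
  have hg : ContinuousOn (fun p : ℝ × ℝ => (limState P Q a s w p.1).g p.2) (Ici 0 ×ˢ univ) := by
    have := hd.swap.lim_f_continuousOn (s := -s) (by rwa [abs_neg])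
    simpa only [limState_swap_f] using this
  have hg_le : ∀ t x, |(limState P Q a s w t).g x| ≤ M := fun t x => by
    have := hd.swap.lim_f_le (s := -s) t x
    rwa [limState_swap] at this
  have ha : ContinuousOn (fun p : ℝ × ℝ => a p.1) (Ici 0 ×ˢ univ) := by
    have h1 : ContinuousOn a (Ici 0) := by
      have := LipschitzOnWith.of_dist_le_mul (s := Ici 0) (f := a) (K := ⟨A, hd.A_nonneg⟩)
        fun t ht t' ht' => hd.abs_a_sub_le ht ht'
      exact this.continuousOn
    exact h1.comp continuous_fst.continuousOn fun p hp => hp.1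
  have hP : ContinuousOn (fun p : ℝ × ℝ => P (((limState P Q a s w p.1).f p.2
      + (limState P Q a s w p.1).g p.2) / 2)) (Ici 0 ×ˢ univ) := fun p hp =>
    (hd.profile.hasDerivAt_P _ ((abs_half_add_le (hd.lim_f_le p.1 p.2) (hg_le p.1 p.2)).trans
      hd.M_le)).continuousAt.comp_continuousWithinAt
      (f := fun p : ℝ × ℝ => ((limState P Q a s w p.1).f p.2 + (limState P Q a s w p.1).g p.2) / 2)
      (((hf.add hg).div_const 2) p hp)
  exact (((continuousOn_const (c := s)).mul (hP.pow 2)).mul hy).sub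
    ((ha.div_const 2).mul (hf.sub hg))

lemma exists_half_solution (hd : SmallData P Q H a b δ L A κ K M w) (hs : |s| = 1) :
    ContDiff ℝ 1 (fun p : ℝ × ℝ => oddExt (fun t => (limState P Q a s w t).f) p.1 p.2) ∧
    (∀ x, oddExt (fun t => (limState P Q a s w t).f) 0 x = w.f x) ∧
    ∀ t, 0 ≤ t → ∀ x, |oddExt (fun t => (limState P Q a s w t).f) t x| ≤ M ∧
      |(limState P Q a s w t).y x| ≤ 2 * ((K + A) * M) * b t ∧
      HasDerivAt (oddExt (fun t => (limState P Q a s w t).f) t) ((limState P Q a s w t).y x) x ∧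
      HasDerivAt (fun t => oddExt (fun t => (limState P Q a s w t).f) t x)
        (rhs P s (a t) (oddExt (fun t => (limState P Q a s w t).f) t x)
          (oddExt (fun t => (limState P Q a s w t).g) t x) ((limState P Q a s w t).y x)) t := by
  refine ⟨contDiff_oddExt (Ft := fun t x => rhs P s (a t) ((limState P Q a s w t).f x)
      ((limState P Q a s w t).g x) ((limState P Q a s w t).y x))
    (fun t ht x => hd.lim_f_hasDerivWithinAt hs ht x) (fun t ht x => hd.lim_f_deriv hs ht x)
    (hd.rhs_continuousOn hs) (hd.lim_y_continuousOn hs), fun x => ?_, fun t ht x => ⟨?_, ?_, ?_, ?_⟩⟩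
  · rw [oddExt_of_nonneg le_rfl, (lim_zero w).1]
  · rw [oddExt_of_nonneg ht]
    exact hd.lim_f_le t x
  · exact hd.lim_y_le hs ht x
  · rw [oddExt_of_nonneg ht]
    exact hd.lim_f_deriv hs ht x
  · have := hasDerivAt_oddExt_time (F := fun t => (limState P Q a s w t).f)
      (fun t ht x => hd.lim_f_hasDerivWithinAt hs ht x) t x
    rw [abs_of_nonneg ht] at this
    rwa [oddExt_of_nonneg ht, oddExt_of_nonneg ht]

/-- Global existence for the diagonalised system with small data. -/
lemma exists_solution (hd : SmallData P Q H a b δ L A κ K M w) :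
    ∃ f g fx gx : ℝ → ℝ → ℝ, ContDiff ℝ 1 (fun p : ℝ × ℝ => f p.1 p.2) ∧
      ContDiff ℝ 1 (fun p : ℝ × ℝ => g p.1 p.2) ∧ (∀ x, f 0 x = w.f x) ∧ (∀ x, g 0 x = w.g x) ∧
      ∀ t, 0 ≤ t → ∀ x, |f t x| ≤ M ∧ |g t x| ≤ M ∧
        |fx t x| ≤ 2 * ((K + A) * M) * b t ∧ |gx t x| ≤ 2 * ((K + A) * M) * b t ∧
        HasDerivAt (f t) (fx t x) x ∧ HasDerivAt (g t) (gx t x) x ∧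
        HasDerivAt (fun t => f t x) (rhs P 1 (a t) (f t x) (g t x) (fx t x)) t ∧
        HasDerivAt (fun t => g t x) (rhs P (-1) (a t) (g t x) (f t x) (gx t x)) t := by
  obtain ⟨h1, h2, h3⟩ := hd.exists_half_solution (s := 1) abs_one
  obtain ⟨i1, i2, i3⟩ := hd.swap.exists_half_solution (s := -1) (by simp)
  simp only [limState_swap_f, limState_swap_g, limState_swap_y] at i1 i2 i3
  refine ⟨_, _, fun t => (limState P Q a 1 w t).y, fun t => (limState P Q a 1 w t).z, h1, i1, h2,
    i2, fun t ht x => ?_⟩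
  obtain ⟨j1, j2, j3, j4⟩ := h3 t ht x
  obtain ⟨k1, k2, k3, k4⟩ := i3 t ht x
  exact ⟨j1, k1, j2, k2, j3, k3, j4, k4⟩

end SmallData

/-- A weighted square cannot be maximal when the weight grows faster than the transport equation
allows. -/
lemma not_isMax_weighted {w : ℝ → ℝ → ℝ} {wt wx c z K c₁ Λ T t x : ℝ} (hT : T < t)
    (hΛ : 2 * (c₁ + 2 * K) < Λ) (hK : 0 ≤ K) (hc : |c| ≤ c₁)
    (ht : HasDerivAt (fun t => w t x) wt t) (hx : HasDerivAt (w t) wx x)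
    (hz : |z| ≤ |w t x|) (hw : w t x ≠ 0) (heq : |wt - c * wx| ≤ K * (|w t x| + |z|))
    (hmt : ∀ τ ∈ Icc T t, w τ x ^ 2 * exp (-(Λ * τ)) ≤ w t x ^ 2 * exp (-(Λ * t)))
    (hmx : ∀ ξ, w t ξ ^ 2 / (1 + ξ ^ 2) ≤ w t x ^ 2 / (1 + x ^ 2)) : False := by
  have hx2 : 0 < 1 + x ^ 2 := by positivity
  have e1 : wx * (1 + x ^ 2) = w t x * x := by
    have h1 : HasDerivAt (fun ξ => w t ξ ^ 2 / (1 + ξ ^ 2)) _ x :=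
      (hx.pow 2).div (((hasDerivAt_id x).pow 2).const_add 1) hx2.ne'
    have h2 := IsLocalMax.hasDerivAt_eq_zero (Filter.Eventually.of_forall hmx) h1
    rw [div_eq_zero_iff, or_iff_left (by positivity)] at h2
    simp only [id, Nat.cast_ofNat, Nat.add_one_sub_one, pow_one, mul_one, Pi.pow_apply] at h2
    have h3 : 2 * w t x * (wx * (1 + x ^ 2) - w t x * x) = 0 := by linear_combination h2
    rcases mul_eq_zero.1 h3 with h | h
    · exact absurd (by linarith) hw
    · linarith
  have e2 : 0 ≤ 2 * (w t x * wt) - Λ * w t x ^ 2 := by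
    have h1 : HasDerivAt (fun τ => w τ x ^ 2 * exp (-(Λ * τ)))
        (exp (-(Λ * t)) * (2 * (w t x * wt) - Λ * w t x ^ 2)) t := by
      refine ((ht.pow 2).mul ((((hasDerivAt_id t).const_mul Λ).neg).exp)).congr_deriv ?_
      simp only [id, Nat.cast_ofNat, Nat.add_one_sub_one, pow_one, mul_one, Pi.pow_apply, Pi.neg_apply]
      ring
    by_contra hneg
    have h2 : exp (-(Λ * t)) * (2 * (w t x * wt) - Λ * w t x ^ 2) < 0 :=
      mul_neg_of_pos_of_neg (exp_pos _) (not_le.1 hneg)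
    have h3 := (hasDerivAt_iff_tendsto_slope_left_right.1 h1).1
    have h4 := h3.eventually_lt_const h2
    obtain ⟨τ, h5, h6, h7⟩ := (h4.and (Ioo_mem_nhdsLT hT)).exists
    have h8 := hmt τ ⟨h6.le, h7.le⟩
    rw [slope_def_field, div_neg_iff] at h5
    rcases h5 with h5 | h5 <;> linarith [h5.1, h5.2]
  have hw2 : 0 < w t x ^ 2 := by positivity
  have hxx : |x| ≤ 1 + x ^ 2 := by
    rw [← sq_abs]
    nlinarith [sq_nonneg (|x| - 1 / 2)]
  have e3 : |w t x * wx| ≤ w t x ^ 2 := by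
    have h1 : |w t x * wx| * (1 + x ^ 2) = w t x ^ 2 * |x| := by
      have h2 : w t x * wx * (1 + x ^ 2) = w t x ^ 2 * x := by linear_combination w t x * e1
      rw [← abs_of_pos hx2, ← abs_mul, h2, abs_mul, abs_of_pos hw2]
    have h2 : w t x ^ 2 * |x| ≤ w t x ^ 2 * (1 + x ^ 2) := mul_le_mul_of_nonneg_left hxx hw2.le
    exact le_of_mul_le_mul_right (h1.trans_le h2) hx2
  have e4 : w t x * (wt - c * wx) ≤ 2 * K * w t x ^ 2 := by
    refine (le_abs_self _).trans ?_
    rw [abs_mul]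
    calc |w t x| * |wt - c * wx| ≤ |w t x| * (K * (|w t x| + |w t x|)) := by
          refine mul_le_mul_of_nonneg_left (heq.trans ?_) (abs_nonneg _)
          exact mul_le_mul_of_nonneg_left (by linarith) hK
      _ = 2 * K * |w t x| ^ 2 := by ring
      _ = _ := by rw [sq_abs]
  have e5 : c * (w t x * wx) ≤ c₁ * w t x ^ 2 := by
    refine (le_abs_self _).trans ?_
    rw [abs_mul]
    exact mul_le_mul hc e3 (abs_nonneg _) ((abs_nonneg _).trans hc)
  nlinarith

lemma transport_system_eq_zero {w z c c' : ℝ → ℝ → ℝ} {wt wx zt zx : ℝ → ℝ → ℝ}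
    {T₁ T₂ B K c₁ : ℝ} (hK : 0 ≤ K)
    (hcw : ContinuousOn (fun p : ℝ × ℝ => w p.1 p.2) (Icc T₁ T₂ ×ˢ univ))
    (hcz : ContinuousOn (fun p : ℝ × ℝ => z p.1 p.2) (Icc T₁ T₂ ×ˢ univ))
    (hBw : ∀ t ∈ Icc T₁ T₂, ∀ x, |w t x| ≤ B) (hBz : ∀ t ∈ Icc T₁ T₂, ∀ x, |z t x| ≤ B)
    (hw0 : ∀ x, w T₁ x = 0) (hz0 : ∀ x, z T₁ x = 0)
    (hwt : ∀ t ∈ Ioc T₁ T₂, ∀ x, HasDerivAt (fun t => w t x) (wt t x) t)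
    (hwx : ∀ t ∈ Ioc T₁ T₂, ∀ x, HasDerivAt (w t) (wx t x) x)
    (hzt : ∀ t ∈ Ioc T₁ T₂, ∀ x, HasDerivAt (fun t => z t x) (zt t x) t)
    (hzx : ∀ t ∈ Ioc T₁ T₂, ∀ x, HasDerivAt (z t) (zx t x) x)
    (hc : ∀ t ∈ Ioc T₁ T₂, ∀ x, |c t x| ≤ c₁) (hc' : ∀ t ∈ Ioc T₁ T₂, ∀ x, |c' t x| ≤ c₁)
    (hw : ∀ t ∈ Ioc T₁ T₂, ∀ x, |wt t x - c t x * wx t x| ≤ K * (|w t x| + |z t x|))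
    (hz : ∀ t ∈ Ioc T₁ T₂, ∀ x, |zt t x - c' t x * zx t x| ≤ K * (|z t x| + |w t x|)) :
    ∀ t ∈ Icc T₁ T₂, ∀ x, w t x = 0 ∧ z t x = 0 := by
  intro t₀ ht₀ x₀
  by_contra hne
  set Λ := 2 * (c₁ + 2 * K) + 1 with hΛ
  set E : ℝ × ℝ → ℝ := fun p => exp (-(Λ * p.1)) / (1 + p.2 ^ 2) with hE
  have E_pos : ∀ p, 0 < E p := fun p => by positivity
  have hEc : Continuous E := by
    refine Continuous.div (by fun_prop) (by fun_prop) fun p => by positivity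
  set G : ℝ × ℝ → ℝ := fun p => max (w p.1 p.2 ^ 2) (z p.1 p.2 ^ 2) * E p with hG
  have G_pos : 0 < G (t₀, x₀) := by
    refine mul_pos ?_ (E_pos _)
    rcases not_and_or.1 hne with h | h
    · exact lt_max_of_lt_left (by positivity)
    · exact lt_max_of_lt_right (by positivity)
  have hGc : ContinuousOn G (Icc T₁ T₂ ×ˢ univ) :=
    (ContinuousOn.sup (hcw.pow 2) (hcz.pow 2)).mul hEc.continuousOn
  set D := B ^ 2 * exp (|Λ| * (|T₁| + |T₂|)) with hD
  have G_le : ∀ t ∈ Icc T₁ T₂, ∀ x, G (t, x) * (1 + x ^ 2) ≤ D := by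
    intro t ht x
    have h1 : max (w t x ^ 2) (z t x ^ 2) ≤ B ^ 2 :=
      max_le (sq_le_sq' (abs_le.1 (hBw t ht x)).1 (abs_le.1 (hBw t ht x)).2)
        (sq_le_sq' (abs_le.1 (hBz t ht x)).1 (abs_le.1 (hBz t ht x)).2)
    have h2 : -(Λ * t) ≤ |Λ| * (|T₁| + |T₂|) := by
      refine (neg_le_abs _).trans ?_
      rw [abs_mul]
      refine mul_le_mul_of_nonneg_left ?_ (abs_nonneg _)
      rw [abs_le]
      constructor
      · linarith [ht.1, neg_abs_le T₁, abs_nonneg T₂]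
      · linarith [ht.2, le_abs_self T₂, abs_nonneg T₁]
    have h3 : G (t, x) * (1 + x ^ 2) = max (w t x ^ 2) (z t x ^ 2) * exp (-(Λ * t)) := by
      simp only [hG, hE]
      field_simp
    rw [h3]
    exact mul_le_mul h1 (exp_le_exp.2 h2) (exp_pos _).le (sq_nonneg _)
  have hD0 : 0 ≤ D := by positivity
  set R := |x₀| + D / G (t₀, x₀) + 1 with hR
  have hR1 : 1 ≤ R := by
    have : 0 ≤ D / G (t₀, x₀) := by positivity
    linarith [abs_nonneg x₀]
  obtain ⟨⟨t, x⟩, ⟨ht, -⟩, hmax⟩ := (isCompact_Icc.prod (isCompact_Icc (a := -R) (b := R))).exists_isMaxOn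
    ⟨(t₀, x₀), ht₀, abs_le.1 (by
      have : 0 ≤ D / G (t₀, x₀) := by positivity
      linarith : |x₀| ≤ R)⟩ (hGc.mono (prod_mono le_rfl (subset_univ _)))
  have h00 : G (t₀, x₀) ≤ G (t, x) := hmax ⟨ht₀, abs_le.1 (by
      have : 0 ≤ D / G (t₀, x₀) := by positivity
      linarith : |x₀| ≤ R)⟩
  have hall : ∀ τ ∈ Icc T₁ T₂, ∀ ξ, G (τ, ξ) ≤ G (t, x) := by
    intro τ hτ ξ
    by_cases hξ : |ξ| ≤ R
    · exact hmax ⟨hτ, abs_le.1 hξ⟩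
    · refine le_trans ?_ h00
      by_contra hlt
      have h1 := G_le τ hτ ξ
      have h2 : R ≤ 1 + ξ ^ 2 := by
        rw [← sq_abs]
        nlinarith [not_le.1 hξ]
      have h3 : D < G (t₀, x₀) * R := by
        have : G (t₀, x₀) * R = G (t₀, x₀) * (|x₀| + 1) + D := by
          rw [hR]
          field_simp
          ring
        rw [this]
        have : 0 < G (t₀, x₀) * (|x₀| + 1) := by positivity
        linarith
      have h4 : G (t₀, x₀) * R ≤ G (τ, ξ) * (1 + ξ ^ 2) :=
        mul_le_mul (not_le.1 hlt).le h2 (by linarith) (G_pos.trans (not_le.1 hlt)).le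
      linarith
  have hGp := G_pos.trans_le h00
  have htT : T₁ < t := by
    refine lt_of_le_of_ne ht.1 fun h => hGp.ne' ?_
    simp [hG, ← h, hw0, hz0]
  have hIoc : t ∈ Ioc T₁ T₂ := ⟨htT, ht.2⟩
  have hsub : ∀ τ ∈ Icc T₁ t, τ ∈ Icc T₁ T₂ := fun τ hτ => ⟨hτ.1, hτ.2.trans ht.2⟩
  have key : ∀ W Z : ℝ → ℝ → ℝ, (∀ τ ξ, W τ ξ ^ 2 * E (τ, ξ) ≤ G (τ, ξ)) →
      G (t, x) = W t x ^ 2 * E (t, x) → Z t x ^ 2 ≤ W t x ^ 2 →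
      (∀ τ ∈ Icc T₁ t, W τ x ^ 2 * exp (-(Λ * τ)) ≤ W t x ^ 2 * exp (-(Λ * t))) ∧
      (∀ ξ, W t ξ ^ 2 / (1 + ξ ^ 2) ≤ W t x ^ 2 / (1 + x ^ 2)) ∧ W t x ≠ 0 ∧
      |Z t x| ≤ |W t x| := by
    intro W Z h1 h2 h3
    refine ⟨fun τ hτ => ?_, fun ξ => ?_, fun h => hGp.ne' ?_, sq_le_sq.1 h3⟩
    · have := ((h1 τ x).trans (hall τ (hsub τ hτ) x)).trans_eq h2
      simp only [hE, ← mul_div_assoc] at this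
      exact (div_le_div_iff_of_pos_right (by positivity)).1 this
    · have := ((h1 t ξ).trans (hall t ht ξ)).trans_eq h2
      simp only [hE] at this
      rw [← mul_le_mul_iff_left₀ (exp_pos (-(Λ * t)))]
      calc _ = W t ξ ^ 2 * (exp (-(Λ * t)) / (1 + ξ ^ 2)) := by ring
        _ ≤ _ := this
        _ = _ := by ring
    · rw [h2, h]
      ring
  rcases le_total (z t x ^ 2) (w t x ^ 2) with h | h
  · obtain ⟨k1, k2, k3, k4⟩ := key w z
      (fun τ ξ => mul_le_mul_of_nonneg_right (le_max_left _ _) (E_pos _).le)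
      (by simp only [hG]; rw [max_eq_left h]) h
    exact not_isMax_weighted htT (by linarith) hK (hc t hIoc x) (hwt t hIoc x) (hwx t hIoc x) k4 k3
      (hw t hIoc x) k1 k2
  · obtain ⟨k1, k2, k3, k4⟩ := key z w
      (fun τ ξ => mul_le_mul_of_nonneg_right (le_max_right _ _) (E_pos _).le)
      (by simp only [hG]; rw [max_eq_right h]) h
    exact not_isMax_weighted htT (by linarith) hK (hc' t hIoc x) (hzt t hIoc x) (hzx t hIoc x) k4 k3
      (hz t hIoc x) k1 k2

section RiemannInvariants

variable {γ : ℝ}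

lemma hasDerivAt_rInv (hγ : 1 < γ) {U V : ℝ → ℝ} {U' V' y : ℝ} (hU : HasDerivAt U U' y)
    (hV : HasDerivAt V V' y) (hpos : 0 < U y) :
    HasDerivAt (fun y => rInv γ (U y) (V y)) (V' + cspeed γ (U y) * U') y := by
  have h := (hV.sub ((hU.rpow_const (p := -(γ - 1) / 2) (Or.inl hpos.ne')).const_mul
    (2 / (γ - 1)))).add_const (2 / (γ - 1))
  refine h.congr_deriv ?_
  have : -(γ - 1) / 2 - 1 = -(γ + 1) / 2 := by ring
  have h1 : γ - 1 ≠ 0 := by linarith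
  rw [this, cspeed]
  field_simp
  ring

lemma hasDerivAt_sInv (hγ : 1 < γ) {U V : ℝ → ℝ} {U' V' y : ℝ} (hU : HasDerivAt U U' y)
    (hV : HasDerivAt V V' y) (hpos : 0 < U y) :
    HasDerivAt (fun y => sInv γ (U y) (V y)) (V' - cspeed γ (U y) * U') y := by
  have h := (hV.add ((hU.rpow_const (p := -(γ - 1) / 2) (Or.inl hpos.ne')).const_mul
    (2 / (γ - 1)))).sub_const (2 / (γ - 1))
  refine h.congr_deriv ?_
  have : -(γ - 1) / 2 - 1 = -(γ + 1) / 2 := by ring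
  have h1 : γ - 1 ≠ 0 := by linarith
  rw [this, cspeed]
  field_simp
  ring

lemma cspeed_sq {u : ℝ} (hu : 0 < u) : cspeed γ u ^ 2 = u ^ (-γ - 1) := by
  rw [cspeed, ← rpow_natCast, ← rpow_mul hu.le]
  congr 1
  push_cast
  ring

lemma hasDerivAt_pres (hγ : 1 < γ) {U : ℝ → ℝ} {U' y : ℝ} (hU : HasDerivAt U U' y)
    (hpos : 0 < U y) : HasDerivAt (fun y => pres γ (U y)) (-(cspeed γ (U y) ^ 2 * U')) y := by
  refine ((hU.rpow_const (p := -γ) (Or.inl hpos.ne')).div_const γ).congr_deriv ?_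
  have h1 : γ ≠ 0 := by linarith
  rw [cspeed_sq hpos]
  field_simp

lemma rInv_add_sInv (u v : ℝ) : rInv γ u v + sInv γ u v = 2 * v := by
  simp only [rInv, sInv]
  ring

lemma sInv_sub_rInv (hγ : 1 < γ) (u v : ℝ) :
    u ^ (-(γ - 1) / 2) = 1 + (γ - 1) / 4 * (sInv γ u v - rInv γ u v) := by
  have h1 : γ - 1 ≠ 0 := by linarith
  simp only [rInv, sInv]
  field_simp
  ring

lemma cspeed_eq_rpow (hγ : 1 < γ) {u : ℝ} (hu : 0 < u) :
    cspeed γ u = (u ^ (-(γ - 1) / 2)) ^ ((γ + 1) / (γ - 1)) := by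
  have h1 : γ - 1 ≠ 0 := by linarith
  rw [← rpow_mul hu.le, cspeed]
  congr 1
  field_simp

lemma eq_of_rInv_eq (hγ : 1 < γ) {u v u' v' : ℝ} (hu : 0 < u) (hu' : 0 < u')
    (hr : rInv γ u' v' = rInv γ u v) (hs : sInv γ u' v' = sInv γ u v) : u' = u ∧ v' = v := by
  constructor
  · have h := sInv_sub_rInv hγ u' v'
    rw [hr, hs, ← sInv_sub_rInv hγ u v] at h
    exact (Real.rpow_left_inj hu'.le hu.le (by linarith)).1 h
  · linarith [rInv_add_sInv (γ := γ) u v, rInv_add_sInv (γ := γ) u' v']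

lemma cspeed_pos {u : ℝ} (hu : 0 < u) : 0 < cspeed γ u := rpow_pos_of_pos hu _

lemma cspeed_anti (hγ : 1 < γ) {u u' : ℝ} (hu : 0 < u) (h : u ≤ u') : cspeed γ u' ≤ cspeed γ u :=
  rpow_le_rpow_of_nonpos hu h (by linarith)

lemma abs_cspeed_sub_le (hγ : 1 < γ) {k : ℝ} (hk : 0 < k) : ∃ Λ, 0 ≤ Λ ∧
    ∀ u u' v v', k ≤ u → k ≤ u' → |cspeed γ u' - cspeed γ u|
      ≤ Λ * (|rInv γ u' v' - rInv γ u v| + |sInv γ u' v' - sInv γ u v|) := by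
  have h1 : 0 < γ - 1 := by linarith
  set p := (γ + 1) / (γ - 1) with hp
  have hp1 : 1 ≤ p := by
    rw [hp, le_div_iff₀ h1]
    linarith
  set Y := k ^ (-(γ - 1) / 2) with hY
  refine ⟨p * Y ^ (p - 1) * ((γ - 1) / 4), by positivity, fun u u' v v' hu hu' => ?_⟩
  have pos := hk.trans_le hu
  have pos' := hk.trans_le hu'
  have hle : ∀ u, k ≤ u → u ^ (-(γ - 1) / 2) ≤ Y := fun u hu =>
    rpow_le_rpow_of_nonpos hk hu (by linarith)
  have lip : |(u' ^ (-(γ - 1) / 2)) ^ p - (u ^ (-(γ - 1) / 2)) ^ p|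
      ≤ p * Y ^ (p - 1) * |u' ^ (-(γ - 1) / 2) - u ^ (-(γ - 1) / 2)| := by
    refine abs_sub_le_mul_abs_sub (F := fun y => y ^ p) (F' := fun y => p * y ^ (p - 1))
      (fun y _ => hasDerivAt_rpow_const (Or.inr hp1)) fun y hy => ?_
    have h2 : 0 ≤ y ∧ y ≤ Y := by
      have g1 := hle u hu
      have g2 := hle u' hu'
      have g3 := (rpow_pos_of_pos pos (-(γ - 1) / 2)).le
      have g4 := (rpow_pos_of_pos pos' (-(γ - 1) / 2)).le
      rcases mem_uIcc.1 hy with h | h <;> constructor <;> linarith [h.1, h.2]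
    rw [abs_of_nonneg (mul_nonneg (by linarith) (rpow_nonneg h2.1 _))]
    exact mul_le_mul_of_nonneg_left (rpow_le_rpow h2.1 h2.2 (by linarith)) (by linarith)
  rw [cspeed_eq_rpow hγ pos, cspeed_eq_rpow hγ pos', ← hp]
  refine lip.trans ?_
  rw [mul_assoc (p * _)]
  refine mul_le_mul_of_nonneg_left ?_ (by positivity)
  rw [sInv_sub_rInv hγ u v, sInv_sub_rInv hγ u' v']
  have e : 1 + (γ - 1) / 4 * (sInv γ u' v' - rInv γ u' v')
      - (1 + (γ - 1) / 4 * (sInv γ u v - rInv γ u v))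
      = (γ - 1) / 4 * ((sInv γ u' v' - sInv γ u v) - (rInv γ u' v' - rInv γ u v)) := by ring
  rw [e, abs_mul, abs_of_nonneg (by linarith : 0 ≤ (γ - 1) / 4)]
  refine mul_le_mul_of_nonneg_left ?_ (by linarith)
  rw [add_comm |rInv γ u' v' - _|]
  exact abs_sub _ _

lemma abs_rInv_le (hγ : 1 < γ) {k u v B : ℝ} (hk : 0 < k) (hu : k ≤ u) (hv : |v| ≤ B) :
    |rInv γ u v| ≤ B + 2 / (γ - 1) * (k ^ (-(γ - 1) / 2) + 1) ∧
    |sInv γ u v| ≤ B + 2 / (γ - 1) * (k ^ (-(γ - 1) / 2) + 1) := by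
  have h1 : 0 < 2 / (γ - 1) := div_pos two_pos (by linarith)
  have h2 : u ^ (-(γ - 1) / 2) ≤ k ^ (-(γ - 1) / 2) :=
    rpow_le_rpow_of_nonpos hk hu (by linarith)
  have h3 := mul_le_mul_of_nonneg_left h2 h1.le
  have h4 : 0 ≤ 2 / (γ - 1) * u ^ (-(γ - 1) / 2) := mul_nonneg h1.le (rpow_nonneg (by linarith) _)
  have h5 := abs_le.1 hv
  simp only [rInv, sInv, mul_add, mul_one]
  constructor <;> rw [abs_le] <;> constructor <;> linarith [h5.1, h5.2]

end RiemannInvariants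

lemma IsC1On.hasDerivAt {f : ℝ → ℝ → ℝ} (h : IsC1On f stripInf) {t : ℝ} (ht : 0 < t) (x : ℝ) :
    HasDerivAt (fun t => f t x) (pdt f t x) t ∧ HasDerivAt (f t) (pdx f t x) x := by
  have h1 : DifferentiableAt ℝ (fun p : ℝ × ℝ => f p.1 p.2) (t, x) :=
    (h.contDiffAt (prod_mem_nhds (Ici_mem_nhds ht) Filter.univ_mem)).differentiableAt one_ne_zero
  constructor
  · have : DifferentiableAt ℝ (fun t => f t x) t :=
      DifferentiableAt.comp (f := fun t : ℝ => (t, x)) t h1 (by fun_prop)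
    exact this.hasDerivAt
  · have : DifferentiableAt ℝ (f t) x :=
      DifferentiableAt.comp (f := fun x : ℝ => (t, x)) x h1 (by fun_prop)
    exact this.hasDerivAt

lemma damping_le {lam μ t : ℝ} (hlam : 0 ≤ lam) (hμ : 0 ≤ μ) (ht : 0 ≤ t) :
    0 ≤ lam / (1 + t) ^ μ ∧ lam / (1 + t) ^ μ ≤ lam :=
  ⟨div_nonneg hlam (rpow_nonneg (by linarith) _),
    div_le_self hlam (one_le_rpow (by linarith) hμ)⟩

/-- The Riemann invariants of a solution satisfy transport equations. -/
lemma euler_diagonal {γ lam μ : ℝ} (hγ : 1 < γ) {u v : ℝ → ℝ → ℝ} (hu : IsC1On u stripInf)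
    (hv : IsC1On v stripInf) (he : IsEulerOn γ lam μ u v stripInf) {t x : ℝ} (ht : 0 < t)
    (hpos : 0 < u t x) :
    HasDerivAt (fun t => rInv γ (u t x) (v t x))
      (cspeed γ (u t x) * (pdx v t x + cspeed γ (u t x) * pdx u t x)
        - lam / (1 + t) ^ μ * v t x) t ∧
    HasDerivAt (fun t => sInv γ (u t x) (v t x))
      (-cspeed γ (u t x) * (pdx v t x - cspeed γ (u t x) * pdx u t x)
        - lam / (1 + t) ^ μ * v t x) t ∧
    HasDerivAt (fun x => rInv γ (u t x) (v t x)) (pdx v t x + cspeed γ (u t x) * pdx u t x) x ∧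
    HasDerivAt (fun x => sInv γ (u t x) (v t x)) (pdx v t x - cspeed γ (u t x) * pdx u t x) x := by
  obtain ⟨hut, hux⟩ := hu.hasDerivAt ht x
  obtain ⟨hvt, hvx⟩ := hv.hasDerivAt ht x
  obtain ⟨e1, e2⟩ := he (t, x) ⟨ht.le, mem_univ _⟩
  have hp : pdx (fun t x => pres γ (u t x)) t x = _ := (hasDerivAt_pres hγ hux hpos).deriv
  simp only [hp] at e1 e2
  have hrt : HasDerivAt (fun t => rInv γ (u t x) (v t x)) _ t := hasDerivAt_rInv hγ hut hvt hpos
  have hst : HasDerivAt (fun t => sInv γ (u t x) (v t x)) _ t := hasDerivAt_sInv hγ hut hvt hpos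
  refine ⟨hrt.congr_deriv ?_, hst.congr_deriv ?_, hasDerivAt_rInv hγ hux hvx hpos,
    hasDerivAt_sInv hγ hux hvx hpos⟩
  · linear_combination e2 + cspeed γ (u t x) * e1
  · linear_combination e2 - cspeed γ (u t x) * e1

lemma IsC1On.continuousOn_Icc {f : ℝ → ℝ → ℝ} (h : IsC1On f stripInf) {T₁ T₂ : ℝ} (hT : 0 ≤ T₁) :
    ContinuousOn (fun p : ℝ × ℝ => f p.1 p.2) (Icc T₁ T₂ ×ˢ univ) :=
  h.continuousOn.mono (prod_mono (fun _ h => hT.trans h.1) le_rfl)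

lemma unique_on_slab {γ lam μ : ℝ} (hγ : 1 < γ) (hlam : 0 ≤ lam) (hμ : 0 ≤ μ)
    {u v u' v' : ℝ → ℝ → ℝ} (hu : IsC1bOn u stripInf) (hv : IsC1bOn v stripInf)
    (he : IsEulerOn γ lam μ u v stripInf) (hu' : IsC1bOn u' stripInf) (hv' : IsC1bOn v' stripInf)
    (he' : IsEulerOn γ lam μ u' v' stripInf) {T₁ T₂ k : ℝ} (hT : 0 ≤ T₁) (hk : 0 < k)
    (hku : ∀ t ∈ Icc T₁ T₂, ∀ x, k ≤ u t x) (hku' : ∀ t ∈ Icc T₁ T₂, ∀ x, k ≤ u' t x)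
    (h0 : ∀ x, u' T₁ x = u T₁ x ∧ v' T₁ x = v T₁ x) :
    ∀ t ∈ Icc T₁ T₂, ∀ x, u' t x = u t x ∧ v' t x = v t x := by
  obtain ⟨hu, Mu, hMu⟩ := hu
  obtain ⟨hv, Mv, hMv⟩ := hv
  obtain ⟨hu', -⟩ := hu'
  obtain ⟨hv', Mv', hMv'⟩ := hv'
  obtain ⟨Λ, hΛ, hlip⟩ := abs_cspeed_sub_le hγ hk
  have hstrip : ∀ t ∈ Icc T₁ T₂, ∀ x, (t, x) ∈ stripInf := fun t ht x =>
    ⟨hT.trans ht.1, mem_univ _⟩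
  have hIoc : ∀ t ∈ Ioc T₁ T₂, 0 < t ∧ t ∈ Icc T₁ T₂ := fun t ht =>
    ⟨hT.trans_lt ht.1, ht.1.le, ht.2⟩
  set c₁ := cspeed γ k with hc₁
  have hc1 : ∀ u, k ≤ u → |cspeed γ u| ≤ c₁ := fun u h => by
    rw [abs_of_pos (cspeed_pos (hk.trans_le h))]
    exact cspeed_anti hγ hk h
  have hvB : ∀ t ∈ Icc T₁ T₂, ∀ x, |v t x| ≤ |Mv| + |Mv'| := fun t ht x => by
    have := hMv _ (hstrip t ht x)
    simp only at this
    linarith [abs_nonneg (pdt v t x), abs_nonneg (pdx v t x), le_abs_self Mv, abs_nonneg Mv']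
  have hvB' : ∀ t ∈ Icc T₁ T₂, ∀ x, |v' t x| ≤ |Mv| + |Mv'| := fun t ht x => by
    have := hMv' _ (hstrip t ht x)
    simp only at this
    linarith [abs_nonneg (pdt v' t x), abs_nonneg (pdx v' t x), le_abs_self Mv', abs_nonneg Mv]
  set N := |Mv| + c₁ * |Mu| with hN
  have hN' : ∀ t ∈ Ioc T₁ T₂, ∀ x, |pdx v t x| + |cspeed γ (u t x) * pdx u t x| ≤ N :=
    fun t ht x => by
      have h1 := hMv _ (hstrip t (hIoc t ht).2 x)
      have h2 := hMu _ (hstrip t (hIoc t ht).2 x)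
      simp only at h1 h2
      rw [abs_mul]
      refine add_le_add ?_ (mul_le_mul (hc1 _ (hku t (hIoc t ht).2 x)) ?_ (abs_nonneg _)
        (cspeed_pos hk).le)
      · linarith [abs_nonneg (pdt v t x), abs_nonneg (v t x), le_abs_self Mv]
      · linarith [abs_nonneg (pdt u t x), abs_nonneg (u t x), le_abs_self Mu]
  have hN0 : 0 ≤ N := by
    have := (cspeed_pos (γ := γ) hk).le
    positivity
  have hd := fun t (ht : t ∈ Ioc T₁ T₂) x =>
    euler_diagonal hγ hu hv he (hIoc t ht).1 (hk.trans_le (hku t (hIoc t ht).2 x))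
  have hd' := fun t (ht : t ∈ Ioc T₁ T₂) x =>
    euler_diagonal hγ hu' hv' he' (hIoc t ht).1 (hk.trans_le (hku' t (hIoc t ht).2 x))
  have cont : ∀ U V : ℝ → ℝ → ℝ, IsC1On U stripInf → IsC1On V stripInf →
      (∀ t ∈ Icc T₁ T₂, ∀ x, k ≤ U t x) →
      ContinuousOn (fun p : ℝ × ℝ => rInv γ (U p.1 p.2) (V p.1 p.2)) (Icc T₁ T₂ ×ˢ univ) ∧
      ContinuousOn (fun p : ℝ × ℝ => sInv γ (U p.1 p.2) (V p.1 p.2)) (Icc T₁ T₂ ×ˢ univ) := by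
    intro U V hU hV hkU
    have h1 := hV.continuousOn_Icc (T₂ := T₂) hT
    have h2 : ContinuousOn (fun p : ℝ × ℝ => 2 / (γ - 1) * U p.1 p.2 ^ (-(γ - 1) / 2))
        (Icc T₁ T₂ ×ˢ univ) := continuousOn_const.mul
      ((hU.continuousOn_Icc (T₂ := T₂) hT).rpow_const fun p hp =>
        Or.inl (hk.trans_le (hkU p.1 hp.1 p.2)).ne')
    exact ⟨(h1.sub h2).add continuousOn_const, (h1.add h2).sub continuousOn_const⟩
  obtain ⟨cr, cs⟩ := cont u v hu hv hku
  obtain ⟨cr', cs'⟩ := cont u' v' hu' hv' hku'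
  set B := |Mv| + |Mv'| + 2 / (γ - 1) * (k ^ (-(γ - 1) / 2) + 1) with hB
  have final := transport_system_eq_zero
    (w := fun t x => rInv γ (u' t x) (v' t x) - rInv γ (u t x) (v t x))
    (z := fun t x => sInv γ (u' t x) (v' t x) - sInv γ (u t x) (v t x))
    (c := fun t x => cspeed γ (u' t x)) (c' := fun t x => -cspeed γ (u' t x))
    (T₁ := T₁) (T₂ := T₂) (B := B + B) (K := Λ * N + lam) (c₁ := c₁) (by positivity)
    (cr'.sub cr) (cs'.sub cs)
    (fun t ht x => (abs_sub _ _).trans (add_le_add (abs_rInv_le hγ hk (hku' t ht x) (hvB' t ht x)).1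
      (abs_rInv_le hγ hk (hku t ht x) (hvB t ht x)).1))
    (fun t ht x => (abs_sub _ _).trans (add_le_add (abs_rInv_le hγ hk (hku' t ht x) (hvB' t ht x)).2
      (abs_rInv_le hγ hk (hku t ht x) (hvB t ht x)).2))
    (fun x => by simp [h0 x]) (fun x => by simp [h0 x])
    (fun t ht x => (hd' t ht x).1.sub (hd t ht x).1)
    (fun t ht x => (hd' t ht x).2.2.1.sub (hd t ht x).2.2.1)
    (fun t ht x => (hd' t ht x).2.1.sub (hd t ht x).2.1)
    (fun t ht x => (hd' t ht x).2.2.2.sub (hd t ht x).2.2.2)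
    (fun t ht x => hc1 _ (hku' t (hIoc t ht).2 x))
    (fun t ht x => by rw [abs_neg]; exact hc1 _ (hku' t (hIoc t ht).2 x))
    (fun t ht x => ?_) (fun t ht x => ?_)
  · intro t ht x
    obtain ⟨h1, h2⟩ := final t ht x
    exact eq_of_rInv_eq hγ (hk.trans_le (hku t ht x)) (hk.trans_le (hku' t ht x))
      (sub_eq_zero.1 h1) (sub_eq_zero.1 h2)
  all_goals
    have hl := hlip (u t x) (u' t x) (v t x) (v' t x) (hku t (hIoc t ht).2 x)
      (hku' t (hIoc t ht).2 x)
    have hn := hN' t ht x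
    obtain ⟨ha0, ha1⟩ := damping_le hlam hμ (hIoc t ht).1.le
    have e1 := rInv_add_sInv (γ := γ) (u t x) (v t x)
    have e2 := rInv_add_sInv (γ := γ) (u' t x) (v' t x)
    have hav : |lam / (1 + t) ^ μ * (v' t x - v t x)| ≤ lam *
        (|rInv γ (u' t x) (v' t x) - rInv γ (u t x) (v t x)|
          + |sInv γ (u' t x) (v' t x) - sInv γ (u t x) (v t x)|) := by
      rw [abs_mul, abs_of_nonneg ha0]
      refine mul_le_mul ha1 ?_ (abs_nonneg _) hlam
      have : v' t x - v t x = ((rInv γ (u' t x) (v' t x) - rInv γ (u t x) (v t x))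
        + (sInv γ (u' t x) (v' t x) - sInv γ (u t x) (v t x))) / 2 := by linarith
      rw [this, abs_div, abs_two]
      have := abs_add_le (rInv γ (u' t x) (v' t x) - rInv γ (u t x) (v t x))
        (sInv γ (u' t x) (v' t x) - sInv γ (u t x) (v t x))
      linarith [abs_nonneg (rInv γ (u' t x) (v' t x) - rInv γ (u t x) (v t x)),
        abs_nonneg (sInv γ (u' t x) (v' t x) - sInv γ (u t x) (v t x))]
  · have hx : |pdx v t x + cspeed γ (u t x) * pdx u t x| ≤ N := (abs_add_le _ _).trans hn
    have hprod : |(cspeed γ (u' t x) - cspeed γ (u t x)) *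
        (pdx v t x + cspeed γ (u t x) * pdx u t x)| ≤ Λ * (|rInv γ (u' t x) (v' t x) - rInv γ (u t x) (v t x)|
          + |sInv γ (u' t x) (v' t x) - sInv γ (u t x) (v t x)|) * N := by
      rw [abs_mul]
      exact mul_le_mul hl hx (abs_nonneg _) ((abs_nonneg _).trans hl)
    refine le_trans (le_of_eq ?_) ((abs_sub _ _).trans ((add_le_add hprod hav).trans
      (le_of_eq ?_)))
    · congr 1
      ring
    · ring
  · have hx : |pdx v t x - cspeed γ (u t x) * pdx u t x| ≤ N := (abs_sub _ _).trans hn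
    have hprod : |(cspeed γ (u' t x) - cspeed γ (u t x)) *
        (pdx v t x - cspeed γ (u t x) * pdx u t x)| ≤ Λ * (|rInv γ (u' t x) (v' t x) - rInv γ (u t x) (v t x)|
          + |sInv γ (u' t x) (v' t x) - sInv γ (u t x) (v t x)|) * N := by
      rw [abs_mul]
      exact mul_le_mul hl hx (abs_nonneg _) ((abs_nonneg _).trans hl)
    rw [← abs_neg] at hprod
    refine le_trans (le_of_eq ?_) ((abs_sub _ _).trans ((add_le_add hprod hav).trans
      (le_of_eq ?_)))
    · congr 1
      ring
    · ring

/-- Solutions with `u` bounded away from zero are unique among all `C¹_b` solutions. -/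
lemma euler_unique {γ lam μ : ℝ} (hγ : 1 < γ) (hlam : 0 ≤ lam) (hμ : 0 ≤ μ)
    {u v u' v' : ℝ → ℝ → ℝ} (hu : IsC1bOn u stripInf) (hv : IsC1bOn v stripInf)
    (he : IsEulerOn γ lam μ u v stripInf) (hu' : IsC1bOn u' stripInf) (hv' : IsC1bOn v' stripInf)
    (he' : IsEulerOn γ lam μ u' v' stripInf) {k : ℝ} (hk : 0 < k)
    (hku : ∀ t, 0 ≤ t → ∀ x, k ≤ u t x) (h0 : ∀ x, u' 0 x = u 0 x ∧ v' 0 x = v 0 x)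
    {t : ℝ} (ht : 0 ≤ t) (x : ℝ) : u' t x = u t x ∧ v' t x = v t x := by
  obtain ⟨M, hM⟩ := hu'.2
  have hM0 : 0 ≤ M := by
    have := hM (0, 0) ⟨le_refl (0 : ℝ), mem_univ _⟩
    exact le_trans (by positivity) this
  have lip : ∀ t₁ t₂ x, 0 ≤ t₁ → t₁ ≤ t₂ → |u' t₂ x - u' t₁ x| ≤ M * (t₂ - t₁) := by
    intro t₁ t₂ x h1 h2
    rcases h2.eq_or_lt with rfl | h2
    · simp
    have hc : ContinuousOn (fun t => u' t x) (Icc t₁ t₂) :=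
      (hu'.1.continuousOn_Icc h1).comp (f := fun t : ℝ => (t, x)) (by fun_prop)
        fun t ht => ⟨ht, mem_univ _⟩
    obtain ⟨c, hc, e⟩ := exists_hasDerivAt_eq_slope (fun t => u' t x) (fun t => pdt u' t x) h2 hc
      fun t ht => (hu'.1.hasDerivAt (h1.trans_lt ht.1) x).1
    have hMc := hM (c, x) ⟨(h1.trans_lt hc.1).le, mem_univ _⟩
    simp only at hMc
    rw [eq_div_iff (by linarith)] at e
    rw [← e, abs_mul, abs_of_pos (by linarith : 0 < t₂ - t₁)]
    refine mul_le_mul_of_nonneg_right ?_ (by linarith)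
    linarith [abs_nonneg (u' c x), abs_nonneg (pdx u' c x)]
  set d := k / (2 * (M + 1)) with hd
  have hd0 : 0 < d := by positivity
  have hMd : M * d ≤ k / 2 := by
    rw [hd, mul_div_assoc', div_le_div_iff₀ (by positivity) two_pos]
    nlinarith
  have slab : ∀ n : ℕ, (∀ x, u' (n * d) x = u (n * d) x ∧ v' (n * d) x = v (n * d) x) →
      ∀ t ∈ Icc (n * d) ((n + 1) * d), ∀ x, u' t x = u t x ∧ v' t x = v t x := by
    intro n hn
    have hnd : 0 ≤ n * d := by positivity
    refine unique_on_slab hγ hlam hμ hu hv he hu' hv' he' hnd (half_pos hk)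
      (fun t ht x => ?_) (fun t ht x => ?_) hn
    · linarith [hku t (hnd.trans ht.1) x]
    · have h1 := (abs_le.1 (lip _ t x hnd ht.1)).1
      have h2 := hku _ hnd x
      rw [(hn x).1] at h1
      have h3 : M * (t - n * d) ≤ M * d := mul_le_mul_of_nonneg_left (by linarith [ht.2]) hM0
      linarith
  have base : ∀ n : ℕ, ∀ x, u' (n * d) x = u (n * d) x ∧ v' (n * d) x = v (n * d) x := by
    intro n
    induction n with
    | zero => simpa using h0
    | succ n ih =>
      have := slab n ih ((n + 1) * d) ⟨by nlinarith, le_rfl⟩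
      simpa using this
  refine slab ⌊t / d⌋₊ (base _) t ⟨?_, ?_⟩ x
  · exact (le_div_iff₀ hd0).1 (Nat.floor_le (by positivity))
  · exact ((div_lt_iff₀ hd0).1 (Nat.lt_floor_add_one _)).le

section DampingRate

lemma rpow_neg_sub_le {μ x k : ℝ} (hμ : 0 ≤ μ) (hx : 0 < x) (hk : 0 ≤ k) :
    0 ≤ x ^ (-μ) - (x + k) ^ (-μ) ∧ x ^ (-μ) - (x + k) ^ (-μ) ≤ k * (μ * x ^ (-μ - 1)) := by
  have h0 : (x + k) ^ (-μ) ≤ x ^ (-μ) := rpow_le_rpow_of_nonpos hx (by linarith) (by linarith)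
  refine ⟨by linarith, ?_⟩
  have h := abs_sub_le_mul_abs_sub (F := fun y : ℝ => y ^ (-μ)) (F' := fun y => -μ * y ^ (-μ - 1))
    (x := x) (x' := x + k) (B := μ * x ^ (-μ - 1)) (fun y hy => ?_) (fun y hy => ?_)
  · simp only [add_sub_cancel_left, abs_of_nonneg hk] at h
    linarith [(abs_le.1 h).1]
  · rw [uIcc_of_le (by linarith)] at hy
    exact hasDerivAt_rpow_const (Or.inl (hx.trans_le hy.1).ne')
  · rw [uIcc_of_le (by linarith)] at hy
    rw [abs_mul, abs_neg, abs_of_nonneg hμ, abs_of_pos (rpow_pos_of_pos (hx.trans_le hy.1) _)]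
    exact mul_le_mul_of_nonneg_left (rpow_le_rpow_of_nonpos hx hy.1 (by linarith)) hμ

lemma one_add_rpow_neg_le {ν μ t₀ t : ℝ} (hν : 0 ≤ ν) (hν' : ν ≤ 2) (ht₀ : 1 ≤ t₀) (ht : 0 ≤ t)
    (hμ : ν ≤ μ) : (1 + t) ^ (-μ) ≤ t₀ ^ 2 * (t₀ + t) ^ (-ν) := by
  have h1 : (1 + t) ^ (-μ) ≤ (1 + t) ^ (-ν) := rpow_le_rpow_of_exponent_le (by linarith) (by linarith)
  have h2 : (t₀ * (1 + t)) ^ (-ν) ≤ (t₀ + t) ^ (-ν) :=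
    rpow_le_rpow_of_nonpos (by linarith) (by nlinarith) (by linarith)
  have h3 : t₀ ^ ν ≤ t₀ ^ 2 := by
    rw [← rpow_natCast t₀ 2]
    exact rpow_le_rpow_of_exponent_le ht₀ (by simpa using hν')
  have h4 : t₀ ^ ν * t₀ ^ (-ν) = 1 := by
    rw [← rpow_add (by linarith), add_neg_cancel, rpow_zero]
  rw [mul_rpow (by linarith) (by linarith)] at h2
  have h5 : 0 < (t₀ + t) ^ (-ν) := rpow_pos_of_pos (by linarith) _
  calc (1 + t) ^ (-μ) ≤ (t₀ ^ ν * t₀ ^ (-ν)) * (1 + t) ^ (-ν) := by rw [h4, one_mul]; exact h1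
    _ = t₀ ^ ν * (t₀ ^ (-ν) * (1 + t) ^ (-ν)) := by ring
    _ ≤ t₀ ^ ν * (t₀ + t) ^ (-ν) := mul_le_mul_of_nonneg_left h2 (by positivity)
    _ ≤ t₀ ^ 2 * (t₀ + t) ^ (-ν) := mul_le_mul_of_nonneg_right h3 h5.le

lemma exists_time_shift {lam μ : ℝ}
    (hcase : (0 ≤ μ ∧ μ < 1 ∧ 0 < lam) ∨ (μ = 1 ∧ 2 < lam)) :
    ∃ t₀ : ℝ, 1 ≤ t₀ ∧ μ * t₀ ^ (μ - 1) < lam / 2 := by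
  rcases hcase with ⟨h0, h1, h2⟩ | ⟨rfl, h2⟩
  · have h := (tendsto_rpow_neg_atTop (y := 1 - μ) (by linarith)).const_mul μ
    rw [mul_zero] at h
    obtain ⟨t₀, ht, ht'⟩ := ((h.eventually_lt_const (half_pos h2)).and
      (Filter.eventually_ge_atTop 1)).exists
    refine ⟨t₀, ht', ?_⟩
    rwa [neg_sub] at ht
  · exact ⟨1, le_rfl, by norm_num; linarith⟩

lemma exists_damping {lam μ : ℝ}
    (hcase : (0 ≤ μ ∧ μ < 1 ∧ 0 < lam) ∨ (μ = 1 ∧ 2 < lam)) :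
    ∃ b : ℝ → ℝ, ∃ A κ : ℝ, 0 ≤ A ∧ Damping (fun t => lam / (1 + t) ^ μ) b A κ ∧
      ∀ t, 0 ≤ t → b t ≤ (1 + t) ^ (-μ) := by
  obtain ⟨t₀, ht₀, hlt⟩ := exists_time_shift hcase
  have hμ : 0 ≤ μ := by rcases hcase with h | h <;> linarith [h.1]
  have hμ1 : μ ≤ 1 := by rcases hcase with h | h <;> linarith [h.1, h.2]
  have hlam : 0 < lam := by
    rcases hcase with h | h
    · exact h.2.2
    · linarith [h.2]
  have ha : ∀ t, 0 ≤ t → lam / (1 + t) ^ μ = lam * (1 + t) ^ (-μ) := fun t ht => by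
    rw [rpow_neg (by linarith), div_eq_mul_inv]
  have hb : ∀ t, 0 ≤ t → (t₀ + t) ^ (-μ) ≤ (1 + t) ^ (-μ) := fun t ht =>
    rpow_le_rpow_of_nonpos (by linarith) (by linarith) (by linarith)
  refine ⟨fun t => (t₀ + t) ^ (-μ), lam * t₀ ^ 2, lam / 2 - μ * t₀ ^ (μ - 1), by positivity,
    ⟨by linarith, fun t ht => ?_, fun t ht => ?_, fun t ht => ?_, fun t ht => ?_,
      fun t k ht hk => ?_, fun t k ht hk => ?_, fun t t' ht htt' => ?_⟩, hb⟩
  · have : 0 < 1 + t := by linarith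
    positivity
  · rw [ha t ht, mul_assoc]
    exact mul_le_mul_of_nonneg_left (one_add_rpow_neg_le hμ (by linarith) ht₀ ht le_rfl) hlam.le
  · exact rpow_pos_of_pos (by linarith) _
  · exact rpow_le_one_of_one_le_of_nonpos (by linarith) (by linarith)
  · obtain ⟨h1, h2⟩ := rpow_neg_sub_le hμ (by linarith : 0 < 1 + t) hk
    have h3 := one_add_rpow_neg_le (ν := 2 * μ) (μ := μ + 1) (by linarith) (by linarith) ht₀ ht
      (by linarith)
    have h4 : (t₀ + t) ^ (-(2 * μ)) = ((t₀ + t) ^ (-μ)) ^ 2 := by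
      rw [← rpow_natCast, ← rpow_mul (by linarith)]
      congr 1
      push_cast
      ring
    rw [h4, show -(μ + 1) = -μ - 1 by ring] at h3
    have h5 : μ * (1 + t) ^ (-μ - 1) ≤ t₀ ^ 2 * ((t₀ + t) ^ (-μ)) ^ 2 :=
      (mul_le_of_le_one_left (rpow_nonneg (by linarith) _) hμ1).trans h3
    rw [ha t ht, ha (t + k) (by linarith), ← mul_sub, abs_mul, abs_of_pos hlam, abs_sub_comm,
      ← add_assoc, abs_of_nonneg h1]
    calc lam * ((1 + t) ^ (-μ) - (1 + t + k) ^ (-μ))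
        ≤ lam * (k * (t₀ ^ 2 * ((t₀ + t) ^ (-μ)) ^ 2)) :=
          mul_le_mul_of_nonneg_left (h2.trans (mul_le_mul_of_nonneg_left h5 hk)) hlam.le
      _ = _ := by ring
  · have h2 := (rpow_neg_sub_le hμ (by linarith : 0 < t₀ + t) hk).2
    rw [add_assoc] at h2
    refine h2.trans (mul_le_mul_of_nonneg_left ?_ hk)
    have hpos : 0 < (t₀ + t) ^ (-μ) := rpow_pos_of_pos (by linarith) _
    have e : (t₀ + t) ^ (-μ - 1) = (t₀ + t) ^ (μ - 1) * (t₀ + t) ^ (-μ) * (t₀ + t) ^ (-μ) := by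
      rw [← rpow_add (by linarith), ← rpow_add (by linarith)]
      congr 1
      ring
    have h3 : (t₀ + t) ^ (μ - 1) ≤ t₀ ^ (μ - 1) :=
      rpow_le_rpow_of_nonpos (by linarith) (by linarith) (by linarith)
    rw [e, ← mul_assoc, ← mul_assoc]
    refine mul_le_mul_of_nonneg_right ?_ hpos.le
    rw [ha t ht]
    have h4 := mul_le_mul_of_nonneg_left (hb t ht) hlam.le
    have h5 := mul_le_mul_of_nonneg_right (mul_le_mul_of_nonneg_left h3 hμ) hpos.le
    linarith
  · exact rpow_le_rpow_of_nonpos (by linarith) (by linarith) (by linarith)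

end DampingRate

section SoundProfile

lemma hasDerivAt_one_sub_mul_rpow {m q ρ : ℝ} (h : 0 < 1 - m * ρ) :
    HasDerivAt (fun ρ => (1 - m * ρ) ^ q) (-(m * q) * (1 - m * ρ) ^ (q - 1)) ρ := by
  have h1 : HasDerivAt (fun ρ => 1 - m * ρ) (-m) ρ := by
    simpa using ((hasDerivAt_id ρ).const_mul m).const_sub 1
  refine (h1.rpow_const (p := q) (Or.inl h.ne')).congr_deriv ?_
  ring

lemma exists_antideriv_one_div {m : ℝ} (hm : 0 < m) (q : ℝ) :
    ∃ H : ℝ → ℝ, H 0 = 0 ∧ ∀ ρ, 0 < 1 - m * ρ → HasDerivAt H (1 / (1 - m * ρ) ^ q) ρ := by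
  by_cases hq : q = 1
  · refine ⟨fun ρ => -(1 / m) * Real.log (1 - m * ρ), by simp, fun ρ h => ?_⟩
    have h1 : HasDerivAt (fun ρ => 1 - m * ρ) (-m) ρ := by
      simpa using ((hasDerivAt_id ρ).const_mul m).const_sub 1
    refine ((h1.log h.ne').const_mul _).congr_deriv ?_
    rw [hq, rpow_one]
    field_simp
  · refine ⟨fun ρ => -(1 / (m * (1 - q))) * ((1 - m * ρ) ^ (1 - q) - 1), by simp, fun ρ h => ?_⟩
    have hq' : 1 - q ≠ 0 := sub_ne_zero.2 (Ne.symm hq)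
    refine (((hasDerivAt_one_sub_mul_rpow h).sub_const 1).const_mul _).congr_deriv ?_
    rw [show 1 - q - 1 = -q by ring, rpow_neg h.le]
    field_simp

lemma exists_bound_one_sub_mul_rpow (m q : ℝ) :
    ∃ δ > 0, ∀ ρ, |ρ| ≤ δ → 0 < 1 - m * ρ ∧ |(1 - m * ρ) ^ q - 1| ≤ 1 / 2 := by
  have c0 : ContinuousAt (fun ρ : ℝ => 1 - m * ρ) 0 := by fun_prop
  have c1 : ContinuousAt (fun ρ : ℝ => |(1 - m * ρ) ^ q - 1|) 0 :=
    ((c0.rpow_const (Or.inl (by simp))).sub continuousAt_const).abs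
  have e0 : ∀ᶠ ρ in 𝓝 (0 : ℝ), 0 < 1 - m * ρ := c0.eventually_const_lt (by simp)
  have e1 : ∀ᶠ ρ in 𝓝 (0 : ℝ), |(1 - m * ρ) ^ q - 1| < 1 / 2 :=
    c1.eventually_lt_const (by simp)
  obtain ⟨δ, hδ, h⟩ := Metric.eventually_nhds_iff.1 (e0.and e1)
  refine ⟨δ / 2, half_pos hδ, fun ρ hρ => ?_⟩
  obtain ⟨h0, h1⟩ := h (y := ρ) (by rw [Real.dist_eq, sub_zero]; linarith)
  exact ⟨h0, h1.le⟩

lemma exists_profile {m : ℝ} (hm : 0 < m) (q : ℝ) : ∃ Q H : ℝ → ℝ, ∃ δ L : ℝ, 0 < δ ∧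
    m * δ ≤ 1 / 2 ∧ Profile (fun ρ => (1 - m * ρ) ^ q) Q H δ L := by
  obtain ⟨H, hH0, hH⟩ := exists_antideriv_one_div hm q
  obtain ⟨δ₀, hδ₀, h₀⟩ := exists_bound_one_sub_mul_rpow m q
  obtain ⟨δ₁, hδ₁, h₁⟩ := exists_bound_one_sub_mul_rpow m (q - 1)
  obtain ⟨δ₂, hδ₂, h₂⟩ := exists_bound_one_sub_mul_rpow m (q - 1 - 1)
  set B₁ := |m * q| * 2 with hB₁
  set B₂ := |m * q| * (|m * (q - 1)| * 2) with hB₂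
  have hB₁0 : 0 ≤ B₁ := by positivity
  have hB₂0 : 0 ≤ B₂ := by positivity
  have two : ∀ y : ℝ, |y - 1| ≤ 1 / 2 → |y| ≤ 2 := fun y hy => by
    rw [abs_le] at *
    constructor <;> linarith
  refine ⟨fun ρ => -(m * q) * (1 - m * ρ) ^ (q - 1), H, min (1 / (2 * m)) (min δ₀ (min δ₁ δ₂)),
    1 + B₁ + B₂, by positivity, ?_, ?_⟩
  · refine (mul_le_mul_of_nonneg_left (min_le_left _ _) hm.le).trans (le_of_eq ?_)
    field_simp
  have d₀ : ∀ ρ, |ρ| ≤ min (1 / (2 * m)) (min δ₀ (min δ₁ δ₂)) → |ρ| ≤ δ₀ := fun ρ h =>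
    h.trans ((min_le_right _ _).trans (min_le_left _ _))
  have d₁ : ∀ ρ, |ρ| ≤ min (1 / (2 * m)) (min δ₀ (min δ₁ δ₂)) → |ρ| ≤ δ₁ := fun ρ h =>
    h.trans ((min_le_right _ _).trans ((min_le_right _ _).trans (min_le_left _ _)))
  have d₂ : ∀ ρ, |ρ| ≤ min (1 / (2 * m)) (min δ₀ (min δ₁ δ₂)) → |ρ| ≤ δ₂ := fun ρ h =>
    h.trans ((min_le_right _ _).trans ((min_le_right _ _).trans (min_le_right _ _)))
  exact
    { one_le := by linarith
      hasDerivAt_P := fun ρ hρ => hasDerivAt_one_sub_mul_rpow (h₀ ρ (d₀ ρ hρ)).1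
      hasDerivAt_H := fun ρ hρ => hH ρ (h₀ ρ (d₀ ρ hρ)).1
      le_P := fun ρ hρ => by linarith [(abs_le.1 (h₀ ρ (d₀ ρ hρ)).2).1]
      P_le := fun ρ hρ => by linarith [(abs_le.1 (h₀ ρ (d₀ ρ hρ)).2).2]
      Q_le := fun ρ hρ => by
        rw [abs_mul, abs_neg]
        have := mul_le_mul_of_nonneg_left (two _ (h₁ ρ (d₁ ρ hρ)).2) (abs_nonneg (m * q))
        linarith
      Q_lip := fun ρ ρ' hρ hρ' => by
        refine le_trans (abs_sub_le_mul_abs_sub (B := B₂)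
          (F := fun ρ => -(m * q) * (1 - m * ρ) ^ (q - 1))
          (F' := fun ρ => -(m * q) * (-(m * (q - 1)) * (1 - m * ρ) ^ (q - 1 - 1)))
          (fun t ht => ?_) (fun t ht => ?_)) (mul_le_mul_of_nonneg_right ?_ (abs_nonneg _))
        · have := abs_le_of_mem_uIcc hρ hρ' ht
          exact (hasDerivAt_one_sub_mul_rpow (h₁ t (d₁ t this)).1).const_mul _
        · have := abs_le_of_mem_uIcc hρ hρ' ht
          rw [abs_mul, abs_neg, abs_mul (-(m * (q - 1))), abs_neg]
          exact mul_le_mul_of_nonneg_left (mul_le_mul_of_nonneg_left (two _ (h₂ t (d₂ t this)).2)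
            (abs_nonneg _)) (abs_nonneg _)
        · linarith
      H_zero := hH0 }

end SoundProfile

section Reconstruction

/-- The specific volume with Riemann invariants `r = f` and `s = -g`. -/
def specVolume (γ f g : ℝ) : ℝ := (1 - (γ - 1) / 2 * ((f + g) / 2)) ^ (-(2 / (γ - 1)))

variable {γ : ℝ}

lemma specVolume_pos {f g : ℝ} (h : 0 < 1 - (γ - 1) / 2 * ((f + g) / 2)) :
    0 < specVolume γ f g := rpow_pos_of_pos h _

lemma specVolume_rpow (hγ : 1 < γ) {f g : ℝ} (h : 0 < 1 - (γ - 1) / 2 * ((f + g) / 2)) :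
    specVolume γ f g ^ (-(γ - 1) / 2) = 1 - (γ - 1) / 2 * ((f + g) / 2) := by
  have h1 : γ - 1 ≠ 0 := by linarith
  rw [specVolume, ← rpow_mul h.le, show -(2 / (γ - 1)) * (-(γ - 1) / 2) = 1 by field_simp, rpow_one]

lemma specVolume_invariants (hγ : 1 < γ) {u : ℝ} (v : ℝ) (hu : 0 < u) :
    specVolume γ (rInv γ u v) (-sInv γ u v) = u := by
  have h1 : γ - 1 ≠ 0 := by linarith
  have h := sInv_sub_rInv hγ u v
  rw [specVolume, show 1 - (γ - 1) / 2 * ((rInv γ u v + -sInv γ u v) / 2)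
    = 1 + (γ - 1) / 4 * (sInv γ u v - rInv γ u v) by ring, ← h, ← rpow_mul hu.le,
    show -(γ - 1) / 2 * -(2 / (γ - 1)) = 1 by field_simp, rpow_one]

lemma cspeed_specVolume (hγ : 1 < γ) {f g : ℝ} (h : 0 < 1 - (γ - 1) / 2 * ((f + g) / 2)) :
    cspeed γ (specVolume γ f g)
      = ((1 - (γ - 1) / 2 * ((f + g) / 2)) ^ ((γ + 1) / (2 * (γ - 1)))) ^ 2 := by
  have h1 : γ - 1 ≠ 0 := by linarith
  rw [cspeed, specVolume, ← rpow_mul h.le, ← rpow_natCast, ← rpow_mul h.le]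
  congr 1
  push_cast
  field_simp

lemma hasDerivAt_specVolume (hγ : 1 < γ) {F G : ℝ → ℝ} {F' G' y : ℝ} (hF : HasDerivAt F F' y)
    (hG : HasDerivAt G G' y) (h : 0 < 1 - (γ - 1) / 2 * ((F y + G y) / 2)) :
    HasDerivAt (fun y => specVolume γ (F y) (G y))
      ((F' + G') / (2 * cspeed γ (specVolume γ (F y) (G y)))) y := by
  have h1 : γ - 1 ≠ 0 := by linarith
  have hW : HasDerivAt (fun y => 1 - (γ - 1) / 2 * ((F y + G y) / 2))
      (-((γ - 1) / 2 * ((F' + G') / 2))) y :=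
    (((hF.add hG).div_const 2).const_mul ((γ - 1) / 2)).const_sub 1
  refine (hW.rpow_const (p := -(2 / (γ - 1))) (Or.inl h.ne')).congr_deriv ?_
  rw [cspeed, specVolume, ← rpow_mul h.le, show -(2 / (γ - 1)) - 1
    = -(-(2 / (γ - 1)) * (-(γ + 1) / 2)) by field_simp; ring, rpow_neg h.le]
  field_simp

/-- Changing variables from `f`, `g` to the Riemann invariants of the reconstructed state. -/
lemma hasDerivAt_invariants_specVolume (hγ : 1 < γ) {F G : ℝ → ℝ} {F' G' y : ℝ}
    (hF : HasDerivAt F F' y) (hG : HasDerivAt G G' y)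
    (h : 0 < 1 - (γ - 1) / 2 * ((F y + G y) / 2)) :
    HasDerivAt (fun y => rInv γ (specVolume γ (F y) (G y)) ((F y - G y) / 2)) F' y ∧
    HasDerivAt (fun y => sInv γ (specVolume γ (F y) (G y)) ((F y - G y) / 2)) (-G') y := by
  have hpos := specVolume_pos h
  have hc := (cspeed_pos (γ := γ) hpos).ne'
  have hu := hasDerivAt_specVolume hγ hF hG h
  have hv : HasDerivAt (fun y => (F y - G y) / 2) ((F' - G') / 2) y := (hF.sub hG).div_const 2
  constructor
  · refine (hasDerivAt_rInv hγ hu hv hpos).congr_deriv ?_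
    field_simp
    ring
  · refine (hasDerivAt_sInv hγ hu hv hpos).congr_deriv ?_
    field_simp
    ring

lemma specVolume_bounds (hγ : 1 < γ) {f g M : ℝ} (hf : |f| ≤ M) (hg : |g| ≤ M)
    (hM : (γ - 1) / 2 * M ≤ 1 / 2) :
    0 < 1 - (γ - 1) / 2 * ((f + g) / 2) ∧ (3 / 2 : ℝ) ^ (-(2 / (γ - 1))) ≤ specVolume γ f g ∧
      specVolume γ f g ≤ (1 / 2 : ℝ) ^ (-(2 / (γ - 1))) := by
  have h1 : 0 < γ - 1 := by linarith
  have h2 : -(2 / (γ - 1)) ≤ 0 := by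
    have : 0 < 2 / (γ - 1) := by positivity
    linarith
  have h3 : |(γ - 1) / 2 * ((f + g) / 2)| ≤ 1 / 2 := by
    rw [abs_mul, abs_of_pos (by linarith : 0 < (γ - 1) / 2)]
    refine le_trans (mul_le_mul_of_nonneg_left ?_ (by linarith)) hM
    rw [abs_le] at *
    constructor <;> linarith [hf.1, hf.2, hg.1, hg.2]
  rw [abs_le] at h3
  exact ⟨by linarith [h3.2], rpow_le_rpow_of_nonpos (by linarith [h3.2]) (by linarith [h3.1]) h2,
    rpow_le_rpow_of_nonpos (by norm_num) (by linarith [h3.2]) h2⟩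

end Reconstruction

section InitialData

variable {γ : ℝ} {φ ψ : ℝ → ℝ} {B ε : ℝ}

/-- The Riemann unknowns of the initial state `(1 + ε φ, ε ψ)`. -/
def initialState (γ : ℝ) (φ ψ : ℝ → ℝ) (ε : ℝ) : WaveState where
  f x := rInv γ (1 + ε * φ x) (ε * ψ x)
  g x := -sInv γ (1 + ε * φ x) (ε * ψ x)
  y x := ε * deriv ψ x + cspeed γ (1 + ε * φ x) * (ε * deriv φ x)
  z x := -(ε * deriv ψ x - cspeed γ (1 + ε * φ x) * (ε * deriv φ x))

lemma half_le_one_add_mul {ε B y : ℝ} (hε : 0 ≤ ε) (hy : |y| ≤ B) (hB : ε * B ≤ 1 / 2) :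
    1 / 2 ≤ 1 + ε * y := by
  have := mul_le_mul_of_nonneg_left (abs_le.1 hy).1 hε
  linarith

lemma abs_cspeed_mul_le (hγ : 1 < γ) {u y B : ℝ} (hu : 1 / 2 ≤ u) (hy : |y| ≤ B) :
    |cspeed γ u * y| ≤ cspeed γ (1 / 2) * B := by
  rw [abs_mul, abs_of_pos (cspeed_pos (by linarith))]
  exact mul_le_mul (cspeed_anti hγ (by norm_num) hu) hy (abs_nonneg _)
    (cspeed_pos (by norm_num)).le

lemma abs_invariants_le (hγ : 1 < γ) {a b B : ℝ} (hε : 0 ≤ ε) (ha : |a| ≤ B) (hb : |b| ≤ B)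
    (hB : ε * B ≤ 1 / 2) :
    |rInv γ (1 + ε * a) (ε * b)| ≤ ε * (B + cspeed γ (1 / 2) * B) ∧
    |sInv γ (1 + ε * a) (ε * b)| ≤ ε * (B + cspeed γ (1 / 2) * B) := by
  have hB0 : 0 ≤ B := (abs_nonneg _).trans ha
  have hlow : ∀ s ∈ uIcc 0 ε, 1 / 2 ≤ 1 + s * a := fun s hs => by
    rw [uIcc_of_le hε] at hs
    exact half_le_one_add_mul hs.1 ha ((mul_le_mul_of_nonneg_right hs.2 hB0).trans hB)
  have hu : ∀ s, HasDerivAt (fun s => 1 + s * a) a s := fun s => by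
    simpa using ((hasDerivAt_id s).mul_const a).const_add 1
  have hv : ∀ s, HasDerivAt (fun s => s * b) b s := fun s => by
    simpa using (hasDerivAt_id s).mul_const b
  constructor
  · have := abs_sub_le_mul_abs_sub (F := fun s => rInv γ (1 + s * a) (s * b))
      (F' := fun s => b + cspeed γ (1 + s * a) * a) (x := 0) (x' := ε)
      (B := B + cspeed γ (1 / 2) * B)
      (fun s hs => hasDerivAt_rInv hγ (hu s) (hv s) (by linarith [hlow s hs]))
      (fun s hs => (abs_add_le _ _).trans (add_le_add hb (abs_cspeed_mul_le hγ (hlow s hs) ha)))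
    have h0 : rInv γ (1 + 0 * a) (0 * b) = 0 := by simp [rInv]
    simpa only [h0, sub_zero, abs_of_nonneg hε, mul_comm ε] using this
  · have := abs_sub_le_mul_abs_sub (F := fun s => sInv γ (1 + s * a) (s * b))
      (F' := fun s => b - cspeed γ (1 + s * a) * a) (x := 0) (x' := ε)
      (B := B + cspeed γ (1 / 2) * B)
      (fun s hs => hasDerivAt_sInv hγ (hu s) (hv s) (by linarith [hlow s hs]))
      (fun s hs => (abs_sub _ _).trans (add_le_add hb (abs_cspeed_mul_le hγ (hlow s hs) ha)))
    have h0 : sInv γ (1 + 0 * a) (0 * b) = 0 := by simp [sInv]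
    simpa only [h0, sub_zero, abs_of_nonneg hε, mul_comm ε] using this

end InitialData

section InitialState

variable {γ : ℝ} {φ ψ : ℝ → ℝ} {B ε : ℝ}

lemma abs_initial_deriv_le (hγ : 1 < γ) {u a b : ℝ} (hε : 0 ≤ ε) (hu : 1 / 2 ≤ u) (ha : |a| ≤ B)
    (hb : |b| ≤ B) :
    |ε * b + cspeed γ u * (ε * a)| ≤ ε * (B + cspeed γ (1 / 2) * B) ∧
    |-(ε * b - cspeed γ u * (ε * a))| ≤ ε * (B + cspeed γ (1 / 2) * B) := by
  have h := abs_cspeed_mul_le hγ hu ha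
  constructor
  · rw [show ε * b + cspeed γ u * (ε * a) = ε * (b + cspeed γ u * a) by ring, abs_mul,
      abs_of_nonneg hε]
    exact mul_le_mul_of_nonneg_left ((abs_add_le _ _).trans (add_le_add hb h)) hε
  · rw [show -(ε * b - cspeed γ u * (ε * a)) = -(ε * (b - cspeed γ u * a)) by ring, abs_neg, abs_mul,
      abs_of_nonneg hε]
    exact mul_le_mul_of_nonneg_left ((abs_sub _ _).trans (add_le_add hb h)) hε

lemma initialState_bdd (hγ : 1 < γ) (hφ : ContDiff ℝ 1 φ) (hψ : ContDiff ℝ 1 ψ)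
    (hφB : ∀ x, |φ x| ≤ B) (hψB : ∀ x, |ψ x| ≤ B) (hε : 0 ≤ ε) (hB : ε * B ≤ 1 / 2) :
    (initialState γ φ ψ ε).Bdd (ε * (B + cspeed γ (1 / 2) * B)) := by
  have hlow := fun x => half_le_one_add_mul hε (hφB x) hB
  have hu : ∀ x, HasDerivAt (fun x => 1 + ε * φ x) (ε * deriv φ x) x := fun x =>
    (((hφ.differentiable one_ne_zero) x).hasDerivAt.const_mul ε).const_add 1
  have hv : ∀ x, HasDerivAt (fun x => ε * ψ x) (ε * deriv ψ x) x := fun x =>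
    ((hψ.differentiable one_ne_zero) x).hasDerivAt.const_mul ε
  exact
    { f_le := fun x => (abs_invariants_le hγ hε (hφB x) (hψB x) hB).1
      g_le := fun x => by
        rw [initialState, abs_neg]
        exact (abs_invariants_le hγ hε (hφB x) (hψB x) hB).2
      hf := fun x => hasDerivAt_rInv hγ (hu x) (hv x) (by linarith [hlow x])
      hg := fun x => (hasDerivAt_sInv hγ (hu x) (hv x) (by linarith [hlow x])).neg }

lemma initialState_deriv_continuous (hφ : ContDiff ℝ 1 φ) (hψ : ContDiff ℝ 1 ψ)
    (hpos : ∀ x, 0 < 1 + ε * φ x) :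
    Continuous (initialState γ φ ψ ε).y ∧ Continuous (initialState γ φ ψ ε).z := by
  have h1 : Continuous (deriv φ) := hφ.continuous_deriv le_rfl
  have h2 : Continuous (deriv ψ) := hψ.continuous_deriv le_rfl
  have h3 : Continuous fun x => cspeed γ (1 + ε * φ x) :=
    (continuous_const.add (continuous_const.mul hφ.continuous)).rpow_const
      fun x => Or.inl (hpos x).ne'
  exact ⟨(continuous_const.mul h2).add (h3.mul (continuous_const.mul h1)),
    ((continuous_const.mul h2).sub (h3.mul (continuous_const.mul h1))).neg⟩

lemma IsC1b.exists_common_bound (hφ : IsC1b φ) (hψ : IsC1b ψ) :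
    ∃ B > 0, ∀ x, |φ x| ≤ B ∧ |ψ x| ≤ B ∧ |deriv φ x| ≤ B ∧ |deriv ψ x| ≤ B := by
  obtain ⟨-, M, hM⟩ := hφ
  obtain ⟨-, N, hN⟩ := hψ
  refine ⟨|M| + |N| + 1, by positivity, fun x => ?_⟩
  have h1 := hM x
  have h2 := hN x
  have h3 := le_abs_self M
  have h4 := le_abs_self N
  refine ⟨?_, ?_, ?_, ?_⟩ <;>
    linarith [abs_nonneg (φ x), abs_nonneg (ψ x), abs_nonneg (deriv φ x), abs_nonneg (deriv ψ x),
      abs_nonneg M, abs_nonneg N]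

/-- Small multiples of `C¹_b` perturbations give small data for the diagonalised system. -/
lemma exists_smallData (hγ : 1 < γ) (hφ : IsC1b φ) (hψ : IsC1b ψ) {P Q H a b : ℝ → ℝ}
    {δ L A κ : ℝ} (hδ : 0 < δ) (hP : Profile P Q H δ L) (hA : 0 ≤ A) (hab : Damping a b A κ) :
    ∃ K C ε₀ : ℝ, 0 < ε₀ ∧ ∀ ε, 0 < ε → ε ≤ ε₀ → (∀ x, 0 < 1 + ε * φ x) ∧
      SmallData P Q H a b δ L A κ K (ε * C) (initialState γ φ ψ ε) := by
  obtain ⟨B, hB0, hB⟩ := hφ.exists_common_bound hψ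
  have hκ := hab.κ_pos
  have hb0 := hab.b_pos 0 le_rfl
  have hL : 0 < L := by linarith [hP.one_le]
  have hc := cspeed_pos (γ := γ) (by norm_num : (0 : ℝ) < 1 / 2)
  set K := (2 + A) / b 0 + (A ^ 2 + 2 * A + 2) / κ with hK
  have hK0 : 0 ≤ K := by positivity
  set C := B + cspeed γ (1 / 2) * B with hC
  have hC0 : 0 < C := by positivity
  set D := 2 * B + C * (1 / δ + L * (K + A) ^ 2 + 2 * (K + A)) with hD
  have hD0 : 0 < D := by positivity
  refine ⟨K, C, 1 / D, by positivity, fun ε hε hεD => ?_⟩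
  have hM := (le_div_iff₀ hD0).1 hεD
  have e : ε * D = 2 * (ε * B) + (ε * C / δ + L * (ε * C) * (K + A) ^ 2
    + 2 * ((K + A) * (ε * C))) := by
    rw [hD]
    ring
  rw [e] at hM
  have p1 : 0 ≤ ε * C / δ := by positivity
  have p2 : 0 ≤ L * (ε * C) * (K + A) ^ 2 := by positivity
  have p3 : 0 ≤ 2 * ((K + A) * (ε * C)) := by positivity
  have p4 : 0 < ε * B := by positivity
  have hεB : ε * B ≤ 1 / 2 := by linarith
  have hlow := fun x => half_le_one_add_mul hε.le (hB x).1 hεB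
  have hpos : ∀ x, 0 < 1 + ε * φ x := fun x => by linarith [hlow x]
  have hcont := initialState_deriv_continuous (γ := γ) hφ.1 hψ.1 hpos
  have hderiv := fun x => abs_initial_deriv_le hγ hε.le (hlow x) (hB x).2.2.1 (hB x).2.2.2
  refine ⟨hpos,
    { profile := hP
      damping := hab
      M_pos := by positivity
      M_le := ?_
      K_nonneg := hK0
      small := ?_
      small_deriv := by linarith
      large := ?_
      bdd := initialState_bdd hγ hφ.1 hψ.1 (fun x => (hB x).1) (fun x => (hB x).2.1) hε.le hεB
      y_le := fun x => (hderiv x).1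
      z_le := fun x => (hderiv x).2
      y_cont := hcont.1
      z_cont := hcont.2 }⟩
  · have : ε * C / δ ≤ 1 := by linarith
    rwa [div_le_one hδ] at this
  · have h1 : κ * K = κ * ((2 + A) / b 0) + (A ^ 2 + 2 * A + 2) := by
      rw [hK]
      field_simp
    have h2 : 0 ≤ κ * ((2 + A) / b 0) := by positivity
    linarith
  · have h1 : K * b 0 = (2 + A) + (A ^ 2 + 2 * A + 2) / κ * b 0 := by
      rw [hK]
      field_simp
    have h2 : 0 ≤ (A ^ 2 + 2 * A + 2) / κ * b 0 := by positivity
    linarith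

end InitialState

section GlobalSolution

lemma SmallData.abs_rhs_le {P Q H a b : ℝ → ℝ} {δ L A κ K M : ℝ} {w : WaveState}
    (hd : SmallData P Q H a b δ L A κ K M w) {s t f g y N : ℝ} (hs : |s| = 1) (ht : 0 ≤ t)
    (hf : |f| ≤ M) (hg : |g| ≤ M) (hy : |y| ≤ N * b t) :
    |SmallData.rhs P s (a t) f g y| ≤ (4 * N + A * M) * b t := by
  have hρ : |(f + g) / 2| ≤ δ := by
    have := hd.M_le
    rw [abs_le] at *
    constructor <;> linarith [hf.1, hf.2, hg.1, hg.2]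
  have hP := hd.profile.le_P _ hρ
  have hP' := hd.profile.P_le _ hρ
  have hP2 : P ((f + g) / 2) ^ 2 ≤ 4 := by nlinarith
  have ha := hd.damping.nonneg t ht
  have hfg : |f - g| ≤ 2 * M := (abs_sub _ _).trans (by linarith)
  have h1 : |s * P ((f + g) / 2) ^ 2 * y| ≤ 4 * (N * b t) := by
    rw [abs_mul, abs_mul, hs, one_mul, abs_of_nonneg (sq_nonneg (P _))]
    exact mul_le_mul hP2 hy (abs_nonneg _) (by norm_num)
  have h2 : |a t / 2 * (f - g)| ≤ a t / 2 * (2 * M) := by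
    rw [abs_mul, abs_of_nonneg (by linarith)]
    exact mul_le_mul_of_nonneg_left hfg (by linarith)
  have h3 := mul_le_mul_of_nonneg_right (hd.damping.le_mul t ht) hd.M_pos.le
  refine (abs_sub _ _).trans ((add_le_add h1 h2).trans ?_)
  linarith

variable {γ lam μ : ℝ} {Q H b : ℝ → ℝ} {δ L A κ K M : ℝ} {w : WaveState}

/-- Global solutions of the damped Euler system from small data. -/
lemma SmallData.exists_euler (hγ : 1 < γ) (hM : (γ - 1) / 2 * M ≤ 1 / 2)
    (hd : SmallData (fun ρ => (1 - (γ - 1) / 2 * ρ) ^ ((γ + 1) / (2 * (γ - 1)))) Q H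
      (fun t => lam / (1 + t) ^ μ) b δ L A κ K M w) :
    ∃ u v : ℝ → ℝ → ℝ, IsC1bOn u stripInf ∧ IsC1bOn v stripInf ∧
      IsEulerOn γ lam μ u v stripInf ∧
      (∀ x, u 0 x = specVolume γ (w.f x) (w.g x) ∧ v 0 x = (w.f x - w.g x) / 2) ∧
      (∃ k > 0, ∀ t, 0 ≤ t → ∀ x, k ≤ u t x) ∧
      ∃ C > 0, ∀ t, 0 ≤ t → ∀ x,
        |pdt (fun t x => rInv γ (u t x) (v t x)) t x| +
        |pdt (fun t x => sInv γ (u t x) (v t x)) t x| +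
        |pdx (fun t x => rInv γ (u t x) (v t x)) t x| +
        |pdx (fun t x => sInv γ (u t x) (v t x)) t x| ≤ C * b t := by
  obtain ⟨f, g, fx, gx, hf1, hg1, hf0, hg0, hsol⟩ := hd.exists_solution
  set P : ℝ → ℝ := fun ρ => (1 - (γ - 1) / 2 * ρ) ^ ((γ + 1) / (2 * (γ - 1))) with hPdef
  set a : ℝ → ℝ := fun t => lam / (1 + t) ^ μ with hadef
  set N := 2 * ((K + A) * M) with hN
  set ft : ℝ → ℝ → ℝ := fun t x => SmallData.rhs P 1 (a t) (f t x) (g t x) (fx t x) with hft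
  set gt : ℝ → ℝ → ℝ := fun t x => SmallData.rhs P (-1) (a t) (g t x) (f t x) (gx t x) with hgt
  set u : ℝ → ℝ → ℝ := fun t x => specVolume γ (f t x) (g t x) with hu
  set v : ℝ → ℝ → ℝ := fun t x => (f t x - g t x) / 2 with hv
  have hMpos := hd.M_pos
  have hb0 := hd.damping.b_pos 0 le_rfl
  have hA : 0 ≤ A := nonneg_of_mul_nonneg_left
    ((hd.damping.nonneg 0 le_rfl).trans (hd.damping.le_mul 0 le_rfl)) hb0
  have hN0 : 0 ≤ N := by
    have := hd.K_nonneg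
    positivity
  have bound : ∀ t, 0 ≤ t → ∀ x, |fx t x| ≤ N * b t ∧ |gx t x| ≤ N * b t ∧
      |ft t x| ≤ (4 * N + A * M) * b t ∧ |gt t x| ≤ (4 * N + A * M) * b t := fun t ht x => by
    obtain ⟨h1, h2, h3, h4, -⟩ := hsol t ht x
    exact ⟨h3, h4, hd.abs_rhs_le abs_one ht h1 h2 h3, hd.abs_rhs_le (by simp) ht h2 h1 h4⟩
  have bd := fun t (ht : 0 ≤ t) x => specVolume_bounds hγ (hsol t ht x).1 (hsol t ht x).2.1 hM
  have hc : ∀ t, 0 ≤ t → ∀ x, cspeed γ (u t x) = P ((f t x + g t x) / 2) ^ 2 := fun t ht x =>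
    cspeed_specVolume hγ (bd t ht x).1
  have hut : ∀ t, 0 ≤ t → ∀ x, HasDerivAt (fun t => u t x) ((fx t x - gx t x) / 2) t := by
    intro t ht x
    obtain ⟨-, -, -, -, -, -, h7, h8⟩ := hsol t ht x
    refine (hasDerivAt_specVolume hγ h7 h8 (bd t ht x).1).congr_deriv ?_
    have h1 := hc t ht x
    have h2 := (cspeed_pos (γ := γ) (specVolume_pos (bd t ht x).1)).ne'
    simp only [hu] at h1
    rw [div_eq_div_iff (mul_ne_zero two_ne_zero h2) two_ne_zero, h1, SmallData.rhs, SmallData.rhs,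
      add_comm (g t x) (f t x)]
    ring
  have hux : ∀ t, 0 ≤ t → ∀ x,
      HasDerivAt (u t) ((fx t x + gx t x) / (2 * cspeed γ (u t x))) x := fun t ht x =>
    hasDerivAt_specVolume hγ (hsol t ht x).2.2.2.2.1 (hsol t ht x).2.2.2.2.2.1 (bd t ht x).1
  have hvt : ∀ t, 0 ≤ t → ∀ x, HasDerivAt (fun t => v t x) ((ft t x - gt t x) / 2) t :=
    fun t ht x => ((hsol t ht x).2.2.2.2.2.2.1.sub (hsol t ht x).2.2.2.2.2.2.2).div_const 2
  have hvx : ∀ t, 0 ≤ t → ∀ x, HasDerivAt (v t) ((fx t x - gx t x) / 2) x :=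
    fun t ht x => ((hsol t ht x).2.2.2.2.1.sub (hsol t ht x).2.2.2.2.2.1).div_const 2
  have hcl : ∀ t, 0 ≤ t → ∀ x, 1 / 4 ≤ cspeed γ (u t x) := fun t ht x => by
    obtain ⟨h1, h2, -⟩ := hsol t ht x
    have hρ : |(f t x + g t x) / 2| ≤ δ := by
      have := hd.M_le
      rw [abs_le] at *
      constructor <;> linarith [h1.1, h1.2, h2.1, h2.2]
    have := hd.profile.le_P _ hρ
    rw [hc t ht x]
    nlinarith
  have hbN : ∀ t, 0 ≤ t → ∀ C, 0 ≤ C → C * b t ≤ C := fun t ht C hC =>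
    mul_le_of_le_one_right hC (hd.damping.b_le_one t ht)
  have hAM : 0 ≤ 4 * N + A * M := by positivity
  refine ⟨u, v, ⟨?_, (1 / 2) ^ (-(2 / (γ - 1))) + N + 4 * N, fun p hp => ?_⟩,
    ⟨?_, M + (4 * N + A * M) + N, fun p hp => ?_⟩, fun p hp => ?_, fun x => ?_,
    ⟨(3 / 2) ^ (-(2 / (γ - 1))), by positivity, fun t ht x => (bd t ht x).2.1⟩,
    2 * (4 * N + A * M) + 2 * N + 1, by positivity, fun t ht x => ?_⟩
  · refine ContDiffOn.rpow_const_of_ne ?_ fun p hp => (bd p.1 hp.1 p.2).1.ne'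
    exact (contDiff_const.sub (contDiff_const.mul ((hf1.add hg1).div_const 2))).contDiffOn
  · obtain ⟨t, x⟩ := p
    have ht : 0 ≤ t := hp.1
    obtain ⟨h1, h2, -, -⟩ := bound t ht x
    have hbt := hbN t ht N hN0
    have hcp := hcl t ht x
    simp only [pdt, pdx, (hut t ht x).deriv, (hux t ht x).deriv]
    refine add_le_add (add_le_add ?_ ?_) ?_
    · rw [abs_of_pos (specVolume_pos (bd t ht x).1)]
      exact (bd t ht x).2.2
    · rw [abs_div, abs_two, div_le_iff₀ two_pos]
      linarith [abs_sub (fx t x) (gx t x)]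
    · rw [abs_div, abs_of_pos (by linarith : 0 < 2 * cspeed γ (u t x)), div_le_iff₀ (by linarith)]
      have := mul_le_mul_of_nonneg_left hcp hN0
      linarith [abs_add_le (fx t x) (gx t x)]
  · exact ((hf1.sub hg1).div_const 2).contDiffOn
  · obtain ⟨t, x⟩ := p
    have ht : 0 ≤ t := hp.1
    obtain ⟨h1, h2, -⟩ := hsol t ht x
    obtain ⟨h3, h4, h5, h6⟩ := bound t ht x
    have hbt := hbN t ht N hN0
    have hbt' := hbN t ht _ hAM
    simp only [pdt, pdx, (hvt t ht x).deriv, (hvx t ht x).deriv]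
    refine add_le_add (add_le_add ?_ ?_) ?_ <;> rw [abs_div, abs_two, div_le_iff₀ two_pos]
    · linarith [abs_sub (f t x) (g t x)]
    · linarith [abs_sub (ft t x) (gt t x)]
    · linarith [abs_sub (fx t x) (gx t x)]
  · obtain ⟨t, x⟩ := p
    have ht : 0 ≤ t := hp.1
    have hp := hasDerivAt_pres hγ (hux t ht x) (specVolume_pos (bd t ht x).1)
    simp only [pdt, pdx, (hut t ht x).deriv, (hvt t ht x).deriv, (hvx t ht x).deriv, hp.deriv]
    refine ⟨sub_self _, ?_⟩
    have hcp := hcl t ht x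
    have e : cspeed γ (u t x) ^ 2 * ((fx t x + gx t x) / (2 * cspeed γ (u t x)))
        = cspeed γ (u t x) * (fx t x + gx t x) / 2 := by
      have : cspeed γ (u t x) ≠ 0 := by linarith
      field_simp
    rw [e, hc t ht x]
    simp only [hft, hgt, hv, hadef, SmallData.rhs, add_comm (g t x) (f t x)]
    ring
  · simp only [hu, hv, hf0, hg0, and_self]
  · obtain ⟨h1, h2, h3, h4, h5, h6, h7, h8⟩ := hsol t ht x
    obtain ⟨i3, i4, i5, i6⟩ := bound t ht x
    obtain ⟨j1, j2⟩ := hasDerivAt_invariants_specVolume hγ h7 h8 (bd t ht x).1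
    obtain ⟨j3, j4⟩ := hasDerivAt_invariants_specVolume hγ h5 h6 (bd t ht x).1
    simp only [pdt, pdx, hu, hv, j1.deriv, j2.deriv, j3.deriv, j4.deriv, abs_neg]
    have := hd.damping.b_pos t ht
    simp only [hft, hgt] at i5 i6
    linarith

end GlobalSolution

end Construction

/-- main theorem. If `0 ≤ μ < 1, λ > 0` or `μ = 1, λ > 2`, then
for sufficiently small `ε > 0` the Cauchy problem with data
`(1 + εφ, εψ)` has a unique global `C¹_b` solution with `u > 0`, whose Riemann
invariants satisfy `‖(r_t,s_t)(t)‖_∞ + ‖(r_x,s_x)(t)‖_∞ ≤ Cε(1+t)^(-μ)`. -/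
theorem global_existence_decay
    (γ lam μ : ℝ) (φ ψ : ℝ → ℝ) (hγ : 1 < γ)
    (hφ : IsC1b φ) (hψ : IsC1b ψ)
    (hcase : (0 ≤ μ ∧ μ < 1 ∧ 0 < lam) ∨ (μ = 1 ∧ 2 < lam)) :
    ∃ ε₀ > 0, ∀ ε : ℝ, 0 < ε → ε ≤ ε₀ →
      ∃ u v : ℝ → ℝ → ℝ,
        (IsC1bOn u stripInf ∧ IsC1bOn v stripInf ∧
          IsEulerOn γ lam μ u v stripInf ∧
          (∀ x, u 0 x = 1 + ε * φ x ∧ v 0 x = ε * ψ x) ∧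
          (∀ p ∈ stripInf, 0 < u p.1 p.2) ∧
          (∃ C > 0, ∀ t ≥ (0:ℝ), ∀ x : ℝ,
            |pdt (fun t x => rInv γ (u t x) (v t x)) t x| +
            |pdt (fun t x => sInv γ (u t x) (v t x)) t x| +
            |pdx (fun t x => rInv γ (u t x) (v t x)) t x| +
            |pdx (fun t x => sInv γ (u t x) (v t x)) t x|
              ≤ C * ε * (1 + t) ^ (-μ))) ∧
        (∀ u' v' : ℝ → ℝ → ℝ,
          IsC1bOn u' stripInf → IsC1bOn v' stripInf →
          IsEulerOn γ lam μ u' v' stripInf →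
          (∀ x, u' 0 x = 1 + ε * φ x ∧ v' 0 x = ε * ψ x) →
          ∀ p ∈ stripInf, u' p.1 p.2 = u p.1 p.2 ∧ v' p.1 p.2 = v p.1 p.2) := by
  have hm : 0 < (γ - 1) / 2 := by linarith
  have hμ : 0 ≤ μ := by rcases hcase with h | h <;> linarith [h.1]
  have hlam : 0 ≤ lam := by
    rcases hcase with h | h
    · exact h.2.2.le
    · linarith [h.2]
  obtain ⟨Q, H, δ, L, hδ, hmδ, hP⟩ := exists_profile hm ((γ + 1) / (2 * (γ - 1)))
  obtain ⟨b, A, κ, hA, hab, hb⟩ := exists_damping hcase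
  obtain ⟨K, C₀, ε₀, hε₀, hdata⟩ := exists_smallData hγ hφ hψ hδ hP hA hab
  refine ⟨ε₀, hε₀, fun ε hε hεε₀ => ?_⟩
  obtain ⟨hpos, hd⟩ := hdata ε hε hεε₀
  obtain ⟨u, v, hu, hv, he, h0, ⟨k, hk, hku⟩, C, hC, hdecay⟩ :=
    hd.exists_euler hγ ((mul_le_mul_of_nonneg_left hd.M_le hm.le).trans hmδ)
  have h0' : ∀ x, u 0 x = 1 + ε * φ x ∧ v 0 x = ε * ψ x := fun x => by
    refine ⟨(h0 x).1.trans (specVolume_invariants hγ _ (hpos x)), (h0 x).2.trans ?_⟩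
    simp only [initialState]
    linarith [rInv_add_sInv (γ := γ) (1 + ε * φ x) (ε * ψ x)]
  refine ⟨u, v, ⟨hu, hv, he, h0', fun p hp => hk.trans_le (hku p.1 hp.1 p.2),
    C / ε, by positivity, fun t ht x => ?_⟩, fun u' v' hu' hv' he' hi p hp =>
    euler_unique hγ hlam hμ hu hv he hu' hv' he' hk hku
      (fun x => ⟨(hi x).1.trans (h0' x).1.symm, (hi x).2.trans (h0' x).2.symm⟩) hp.1 p.2⟩
  rw [div_mul_cancel₀ C hε.ne']
  exact (hdecay t ht x).trans (mul_le_mul_of_nonneg_left (hb t ht) hC.le)
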